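/- arXiv:2402.13354 — 4 statements merged into one kernel-verified Lean document; each statement's English description precedes it below -/
import Mathlib

section
/- With P = k[x,y,z,w], Φ a degree-3 Macaulay inverse system, ann Φ containing no nonzero linear form, p bijective, and the symmetric matrix SM of rank at least 2, the algebra P/ann Φ is a hypersurface section of a codimension-three Gorenstein algebra. Precisely: there exist homogeneous quadrics g₁,…,g₅, f ∈ P and an alternating 5×5 matrix X over P (X^T = −X with zero diagonal) whose entries are homogeneous of degree 1, such that, writing J for the ideal (g₁,…,g₅): (1) ann Φ = J + (f); (2) f is a nonzerodivisor on P/J, i.e. J : (f) = J; and (3) the complex 0 → P → P⁵ → P⁵ → P, whose maps are given by the column vector (g₁,…,g₅)^T, the matrix X, and the row vector (g₁,…,g₅), is exact at the three interior positions (so P/J is a codimension-three Gorenstein ring resolved by this self-dual complex). -/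
open MvPolynomial

noncomputable section

variable (k : Type*) [Field k]

/-- The annihilator ideal `ann Φ = {f : Φ(f·g) = 0 for all g}` of the
linear functional `Φ`. -/
def annIdeal (Φ : MvPolynomial (Fin 4) k →ₗ[k] k) : Ideal (MvPolynomial (Fin 4) k) where
  carrier := {f | ∀ g, Φ (f * g) = 0}
  add_mem' := by
    intro a b ha hb g
    rw [add_mul, map_add, ha g, hb g, add_zero]
  zero_mem' := by intro g; simp
  smul_mem' := by
    intro c a ha g
    have h : c • a * g = a * (c * g) := by rw [smul_eq_mul]; ring
    rw [h]; exact ha (c * g)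

/-- The Macaulay map `p : P₁ → Hom(P₁, k)`, `p(u)(v) = Φ(x·u·v)`. -/
def pMap (Φ : MvPolynomial (Fin 4) k →ₗ[k] k) :
    homogeneousSubmodule (Fin 4) k 1 →ₗ[k]
      (homogeneousSubmodule (Fin 4) k 1 →ₗ[k] k) where
  toFun u :=
    { toFun := fun v => Φ (X 0 * u.1 * v.1)
      map_add' := fun v w => by simp [mul_add]
      map_smul' := fun c v => by simp [mul_smul_comm] }
  map_add' u u' := by
    ext v
    simp [add_mul, mul_add]
  map_smul' c u := by
    ext v
    simp [mul_smul_comm, smul_mul_assoc]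

/-- The symmetric `3 × 3` matrix `SM` of (6.3), built from the Macaulay inverse
system `Φ` and the linear forms `ℓ_q` (`p⁻¹(q·Φ)` for the quadrics `q`);
here `⟨q,q'⟩ = Φ(q·ℓ_{q'})`. -/
def smMatrix (Φ : MvPolynomial (Fin 4) k →ₗ[k] k)
    (ly2 lyz lyw lz2 lzw lw2 : MvPolynomial (Fin 4) k) : Matrix (Fin 3) (Fin 3) k :=
  !![Φ (X 2 ^ 2 * lw2) - Φ (X 2 * X 3 * lzw),
      Φ (X 2 * X 3 * lyw) - Φ (X 2 * X 1 * lw2),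
      Φ (X 1 * X 2 * lzw) - Φ (X 2 ^ 2 * lyw);
    Φ (X 1 * X 3 * lzw) - Φ (X 1 * X 2 * lw2),
      Φ (X 1 ^ 2 * lw2) - Φ (X 1 * X 3 * lyw),
      Φ (X 1 * X 2 * lyw) - Φ (X 1 ^ 2 * lzw);
    Φ (X 1 * X 2 * lzw) - Φ (X 1 * X 3 * lz2),
      Φ (X 1 * X 3 * lyz) - Φ (X 1 ^ 2 * lzw),
      Φ (X 1 ^ 2 * lz2) - Φ (X 1 * X 2 * lyz)]

/-- The `R`-linear map `R → Rⁿ` given by a column vector `g`. -/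
def colMap {R : Type*} [CommRing R] {n : ℕ} (g : Fin n → R) :
    R →ₗ[R] (Fin n → R) where
  toFun t := fun i => g i * t
  map_add' a b := by funext i; simp [mul_add]
  map_smul' c a := by funext i; simp [smul_eq_mul, mul_left_comm]

/-- The `R`-linear map `Rⁿ → R` given by a row vector `g`. -/
def rowMap {R : Type*} [CommRing R] {n : ℕ} (g : Fin n → R) :
    (Fin n → R) →ₗ[R] R where
  toFun v := ∑ i, g i * v i
  map_add' a b := by simp [mul_add, Finset.sum_add_distrib]
  map_smul' c a := by simp [smul_eq_mul, Finset.mul_sum, mul_left_comm]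

section Pf
variable {R : Type*} [CommRing R]

/-- generic alternating matrix -/
def altM (e : Fin 10 → R) : Matrix (Fin 5) (Fin 5) R :=
  !![0, e 0, e 1, e 2, e 3;
     -e 0, 0, e 4, e 5, e 6;
     -e 1, -e 4, 0, e 7, e 8;
     -e 2, -e 5, -e 7, 0, e 9;
     -e 3, -e 6, -e 8, -e 9, 0]

/-- signed Pfaffians -/
def pfV (e : Fin 10 → R) : Fin 5 → R :=
  ![e 4 * e 9 - e 5 * e 8 + e 6 * e 7,
    -(e 1 * e 9 - e 2 * e 8 + e 3 * e 7),
    e 0 * e 9 - e 2 * e 6 + e 3 * e 5,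
    -(e 0 * e 8 - e 1 * e 6 + e 3 * e 4),
    e 0 * e 7 - e 1 * e 5 + e 2 * e 4]

/-- homotopies -/
def htM (e : Fin 10 → R) : Fin 5 → Matrix (Fin 5) (Fin 5) R :=
  ![!![0,0,0,0,0; 0,0,e 9,-e 8,e 7; 0,-e 9,0,e 6,-e 5; 0,e 8,-e 6,0,e 4; 0,-e 7,e 5,-e 4,0],
    !![0,0,-e 9,e 8,-e 7; 0,0,0,0,0; e 9,0,0,-e 3,e 2; -e 8,0,e 3,0,-e 1; e 7,0,-e 2,e 1,0],
    !![0,e 9,0,-e 6,e 5; -e 9,0,0,e 3,-e 2; 0,0,0,0,0; e 6,-e 3,0,0,e 0; -e 5,e 2,0,-e 0,0],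
    !![0,-e 8,e 6,0,-e 4; e 8,0,-e 3,0,e 1; -e 6,e 3,0,0,-e 0; 0,0,0,0,0; e 4,-e 1,e 0,0,0],
    !![0,e 7,-e 5,e 4,0; -e 7,0,e 2,-e 1,0; e 5,-e 2,0,e 0,0; -e 4,e 1,-e 0,0,0; 0,0,0,0,0]]

theorem ht1 (e : Fin 10 → R) (i j : Fin 5) (v : Fin 5 → R) :
    pfV e i * v j - (if j = i then ∑ l, pfV e l * v l else 0)
      = -(altM e).mulVec ((htM e i).mulVec v) j := by
  fin_cases i <;> fin_cases j <;>
  simp [altM, pfV, htM, Matrix.mulVec, dotProduct, Fin.sum_univ_succ] <;> ring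

theorem ht2 (e : Fin 10 → R) (i j : Fin 5) (v : Fin 5 → R) :
    pfV e i * v j - pfV e j * v i
      = -(htM e i).mulVec ((altM e).mulVec v) j := by
  fin_cases i <;> fin_cases j <;>
  simp [altM, pfV, htM, Matrix.mulVec, dotProduct, Fin.sum_univ_succ] <;> ring

theorem altM_pfV (e : Fin 10 → R) (j : Fin 5) : (altM e).mulVec (pfV e) j = 0 := by
  fin_cases j <;>
  simp [altM, pfV, Matrix.mulVec, dotProduct, Fin.sum_univ_succ] <;> ring

theorem pfV_altM (e : Fin 10 → R) (v : Fin 5 → R) :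
    ∑ i, pfV e i * (altM e).mulVec v i = 0 := by
  simp [altM, pfV, Matrix.mulVec, dotProduct, Fin.sum_univ_succ]; ring
end Pf

section Acyc
variable {R : Type*} [CommRing R]

theorem span_pf_coeff (e : Fin 10 → R) {a : R} (ha : a ∈ Ideal.span (Set.range (pfV e))) :
    ∃ c : Fin 5 → R, a = ∑ i, c i * pfV e i := by
  obtain ⟨c, hc⟩ := (Submodule.mem_span_range_iff_exists_fun R).1 ha
  exact ⟨c, by simpa using hc.symm⟩

theorem ht1' (e : Fin 10 → R) (c v : Fin 5 → R) (hv : ∑ l, pfV e l * v l = 0) :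
    ∃ u : Fin 5 → R, ∀ j, (∑ i, c i * pfV e i) * v j = (altM e).mulVec u j := by
  refine ⟨-∑ i, c i • (htM e i).mulVec v, fun j => ?_⟩
  rw [Matrix.mulVec_neg, Matrix.mulVec_sum]
  simp only [Matrix.mulVec_smul, Pi.neg_apply, Finset.sum_apply, Pi.smul_apply, smul_eq_mul]
  rw [Finset.sum_mul, ← Finset.sum_neg_distrib]
  refine Finset.sum_congr rfl fun i _ => ?_
  have := ht1 e i j v
  rw [hv] at this
  simp only [ite_self, sub_zero] at this
  rw [mul_assoc, this]; ring

theorem ht2' (e : Fin 10 → R) (c v : Fin 5 → R) (hv : (altM e).mulVec v = 0) (j : Fin 5) :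
    (∑ i, c i * pfV e i) * v j = pfV e j * ∑ i, c i * v i := by
  rw [Finset.sum_mul, Finset.mul_sum]
  refine Finset.sum_congr rfl fun i _ => ?_
  have := ht2 e i j v
  rw [hv] at this
  simp only [Matrix.mulVec_zero, Pi.zero_apply, neg_zero] at this
  linear_combination c i * this

theorem acyc2 (e : Fin 10 → R) {a1 a2 : R}
    (h1 : a1 ∈ Ideal.span (Set.range (pfV e)))
    (h2 : a2 ∈ Ideal.span (Set.range (pfV e)))
    (r1 : ∀ t, a1 * t = 0 → t = 0)
    (r2 : ∀ t, (∃ p, a2 * t = a1 * p) → ∃ p, t = a1 * p)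
    (v : Fin 5 → R) (hv : (altM e).mulVec v = 0) : ∃ t, ∀ j, v j = pfV e j * t := by
  obtain ⟨c1, hc1⟩ := span_pf_coeff e h1
  obtain ⟨c2, hc2⟩ := span_pf_coeff e h2
  have k1 := fun j => ht2' e c1 v hv j
  rw [← hc1] at k1
  obtain ⟨t, ht⟩ := r2 (∑ i, c1 i * v i) ⟨∑ i, c2 i * v i, by
    rw [hc2, Finset.sum_mul, Finset.mul_sum]
    refine Finset.sum_congr rfl fun i _ => ?_
    linear_combination (-c2 i) * k1 i⟩
  refine ⟨t, fun j => ?_⟩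
  have := r1 (v j - pfV e j * t) (by
    have := k1 j
    rw [ht] at this
    linear_combination this)
  linear_combination this

theorem acyc1 (e : Fin 10 → R) {a1 a2 a3 : R}
    (h1 : a1 ∈ Ideal.span (Set.range (pfV e)))
    (h2 : a2 ∈ Ideal.span (Set.range (pfV e)))
    (h3 : a3 ∈ Ideal.span (Set.range (pfV e)))
    (r1 : ∀ t, a1 * t = 0 → t = 0)
    (r2 : ∀ t, (∃ p, a2 * t = a1 * p) → ∃ p, t = a1 * p)
    (r3 : ∀ t, (∃ p q, a3 * t = a1 * p + a2 * q) → ∃ p q, t = a1 * p + a2 * q)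
    (v : Fin 5 → R) (hv : ∑ l, pfV e l * v l = 0) : ∃ u, v = (altM e).mulVec u := by
  obtain ⟨c1, hc1⟩ := span_pf_coeff e h1
  obtain ⟨c2, hc2⟩ := span_pf_coeff e h2
  obtain ⟨c3, hc3⟩ := span_pf_coeff e h3
  obtain ⟨u1, hu1⟩ := ht1' e c1 v hv
  obtain ⟨u2, hu2⟩ := ht1' e c2 v hv
  rw [← hc1] at hu1
  rw [← hc2] at hu2
  obtain ⟨t, ht⟩ := acyc2 e h1 h2 r1 r2 (a2 • u1 - a1 • u2) (by
    funext j
    rw [Matrix.mulVec_sub, Matrix.mulVec_smul, Matrix.mulVec_smul]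
    simp only [Pi.sub_apply, Pi.smul_apply, smul_eq_mul, Pi.zero_apply, ← hu1, ← hu2]
    ring)
  simp only [Pi.sub_apply, Pi.smul_apply, smul_eq_mul] at ht
  obtain ⟨p, q, hpq⟩ := r3 t ⟨-∑ i, c3 i * u2 i, ∑ i, c3 i * u1 i, by
    rw [hc3, Finset.sum_mul, mul_neg, Finset.mul_sum, Finset.mul_sum, neg_add_eq_sub,
      ← Finset.sum_sub_distrib]
    refine Finset.sum_congr rfl fun i _ => ?_
    linear_combination (-c3 i) * ht i⟩
  have : ∀ j, ∃ u, u1 j - pfV e j * q = a1 * u := fun j =>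
    r2 _ ⟨u2 j + pfV e j * p, by
      have := ht j
      rw [hpq] at this
      linear_combination this⟩
  choose u hu using this
  refine ⟨u, ?_⟩
  funext j
  have key : (altM e).mulVec u1 = a1 • (altM e).mulVec u := by
    have : u1 = a1 • u + q • pfV e := by
      funext j
      simp only [Pi.add_apply, Pi.smul_apply, smul_eq_mul]
      linear_combination hu j
    rw [this, Matrix.mulVec_add, Matrix.mulVec_smul, Matrix.mulVec_smul]
    funext j
    simp [altM_pfV]
  have := r1 (v j - (altM e).mulVec u j) (by
    have h := hu1 j
    rw [key] at h
    simp only [Pi.smul_apply, smul_eq_mul] at h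
    linear_combination h)
  linear_combination this
end Acyc

section Reg
theorem mono_reg {k : Type*} [Field k] {σ : Type*} (T : Set σ) (i : σ) (hi : i ∉ T)
    (A : MvPolynomial σ k)
    (h : (X i : MvPolynomial σ k) ^ 4 * A ∈ Ideal.span ((fun j => (X j : MvPolynomial σ k) ^ 4) '' T)) :
    A ∈ Ideal.span ((fun j => (X j : MvPolynomial σ k) ^ 4) '' T) := by
  have hT : (fun j => (X j : MvPolynomial σ k) ^ 4) '' T
      = (fun s => monomial s (1 : k)) '' ((fun j => Finsupp.single j 4) '' T) := by
    rw [Set.image_image]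
    simp only [X_pow_eq_monomial]
  rw [hT, mem_ideal_span_monomial_image] at h ⊢
  intro m hm
  have := h (Finsupp.single i 4 + m) (by
    rw [mem_support_iff, X_pow_eq_monomial, coeff_monomial_mul, one_mul]
    exact mem_support_iff.1 hm)
  obtain ⟨_, ⟨j, hj, rfl⟩, hle⟩ := this
  refine ⟨_, ⟨j, hj, rfl⟩, ?_⟩
  have hij : i ≠ j := fun h => hi (h ▸ hj)
  have h2 := hle j
  intro l
  by_cases hl : j = l
  · subst hl
    simpa [Finsupp.single_apply, hij] using h2
  · simp [Finsupp.single_apply, hl]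

open Polynomial in
theorem poly_reg {S : Type*} [CommRing S] (F : Polynomial S) (hF : F.Monic) (I : Ideal S) (a : S)
    (ha : ∀ s, a * s ∈ I → s ∈ I) (A : Polynomial S)
    (h : Polynomial.C a * A ∈ Ideal.span {F} ⊔ I.map Polynomial.C) :
    A ∈ Ideal.span {F} ⊔ I.map Polynomial.C := by
  obtain ⟨b, hb, c, hc, hbc⟩ := Submodule.mem_sup.1 h
  obtain ⟨B, rfl⟩ := Ideal.mem_span_singleton'.1 hb
  have hc' : c %ₘ F ∈ I.map Polynomial.C := by
    have hz : c.map (Ideal.Quotient.mk I) = 0 := by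
      ext n
      rw [Polynomial.coeff_map, Polynomial.coeff_zero]
      exact Ideal.Quotient.eq_zero_iff_mem.2 (Ideal.mem_map_C_iff.1 hc n)
    have : (c %ₘ F).map (Ideal.Quotient.mk I) = 0 := by
      rw [Polynomial.map_modByMonic _ hF, hz, Polynomial.zero_modByMonic]
    rw [Ideal.mem_map_C_iff]
    intro n
    rw [← Ideal.Quotient.eq_zero_iff_mem, ← Polynomial.coeff_map, this, Polynomial.coeff_zero]
  have h1 : Polynomial.C a * (A %ₘ F) = c %ₘ F := by
    rw [← Polynomial.smul_eq_C_mul, ← Polynomial.smul_modByMonic, Polynomial.smul_eq_C_mul, ← hbc,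
      Polynomial.add_modByMonic, (Polynomial.modByMonic_eq_zero_iff_dvd hF).2 (Dvd.intro_left _ rfl),
      zero_add]
  rw [← Polynomial.modByMonic_add_div A F]
  rw [add_comm]
  refine Submodule.add_mem_sup (Ideal.mul_mem_right _ _ (Ideal.mem_span_singleton_self _)) ?_
  rw [Ideal.mem_map_C_iff]
  intro n
  apply ha
  rw [← Polynomial.coeff_C_mul, h1]
  exact Ideal.mem_map_C_iff.1 hc' n

theorem mv_reg {k : Type*} [Field k] (f : MvPolynomial (Fin 4) k)
    (hf : (finSuccEquiv k 3 f).Monic) (T : Set (Fin 3)) (i : Fin 3) (hi : i ∉ T)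
    (A : MvPolynomial (Fin 4) k)
    (h : (X i.succ : MvPolynomial (Fin 4) k) ^ 4 * A ∈
      Ideal.span {f} ⊔ Ideal.span ((fun j : Fin 3 => (X j.succ : MvPolynomial (Fin 4) k) ^ 4) '' T)) :
    A ∈ Ideal.span {f} ⊔
      Ideal.span ((fun j : Fin 3 => (X j.succ : MvPolynomial (Fin 4) k) ^ 4) '' T) := by
  set φ := (finSuccEquiv k 3).toRingEquiv with hφ
  have key : ∀ B, B ∈ Ideal.span {f} ⊔
      Ideal.span ((fun j : Fin 3 => (X j.succ : MvPolynomial (Fin 4) k) ^ 4) '' T) ↔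
      φ B ∈ Ideal.span {finSuccEquiv k 3 f} ⊔
        (Ideal.span ((fun j : Fin 3 => (X j : MvPolynomial (Fin 3) k) ^ 4) '' T)).map Polynomial.C := by
    intro B
    have : Ideal.span {finSuccEquiv k 3 f} ⊔
        (Ideal.span ((fun j : Fin 3 => (X j : MvPolynomial (Fin 3) k) ^ 4) '' T)).map Polynomial.C
        = (Ideal.span {f} ⊔
      Ideal.span ((fun j : Fin 3 => (X j.succ : MvPolynomial (Fin 4) k) ^ 4) '' T)).map φ := by
      rw [Ideal.map_sup, Ideal.map_span, Ideal.map_span, Ideal.map_span, Set.image_singleton,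
        Set.image_image, Set.image_image]
      simp [hφ, finSuccEquiv_X_succ]
    rw [this]
    constructor
    · exact fun h => Ideal.mem_map_of_mem _ h
    · intro h
      rw [Ideal.mem_map_of_equiv] at h
      obtain ⟨x, hx, hxB⟩ := h
      rwa [← φ.injective hxB]
  rw [key] at h ⊢
  refine poly_reg _ hf _ (X i ^ 4) (fun s hs => mono_reg T i hi s hs) _ ?_
  rw [map_mul] at h
  convert h using 2
  simp [hφ, finSuccEquiv_X_succ]

theorem mv_monic {k : Type*} [Field k] (c0 c1 c2 c3 : k) :
    (finSuccEquiv k 3 (X 0 ^ 2 - X 1 * (C c0 * X 1 + C c1 * X 2 + C c2 * X 3 + C c3 * X 0))).Monic := by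
  have h1 : finSuccEquiv k 3 (X 1) = Polynomial.C (X 0) := finSuccEquiv_X_succ (j := 0)
  have h2 : finSuccEquiv k 3 (X 2) = Polynomial.C (X 1) := finSuccEquiv_X_succ (j := 1)
  have h3 : finSuccEquiv k 3 (X 3) = Polynomial.C (X 2) := finSuccEquiv_X_succ (j := 2)
  have hC : ∀ c : k, finSuccEquiv k 3 (C c) = Polynomial.C (C c) := fun c => by
    simp [finSuccEquiv_apply]
  have : finSuccEquiv k 3 (X 0 ^ 2 - X 1 * (C c0 * X 1 + C c1 * X 2 + C c2 * X 3 + C c3 * X 0))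
      = Polynomial.X ^ 2 + (Polynomial.C (-(X 0 * C c3)) * Polynomial.X +
        Polynomial.C (-(X 0 * (C c0 * X 0 + C c1 * X 1 + C c2 * X 2)))) := by
    simp only [map_sub, map_pow, map_mul, map_add, map_neg, h1, h2, h3, hC, finSuccEquiv_X_zero]
    ring
  rw [this]
  exact Polynomial.monic_X_pow_add Polynomial.degree_linear_lt
end Reg

section Nak
variable {k : Type*} [Field k]

theorem hcomp_mul {a b : MvPolynomial (Fin 4) k} {d : ℕ} (ha : a.IsHomogeneous d) (n : ℕ) :
    homogeneousComponent n (a * b) = a * (if d ≤ n then homogeneousComponent (n - d) b else 0) := by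
  let _ : GradedAlgebra (homogeneousSubmodule (Fin 4) k) := MvPolynomial.gradedAlgebra
  have key : ∀ (p : MvPolynomial (Fin 4) k) (i : ℕ),
      (DirectSum.decompose (homogeneousSubmodule (Fin 4) k) p i : MvPolynomial (Fin 4) k)
        = homogeneousComponent i p := fun p i => decomposition.decompose'_apply p i
  have := DirectSum.coe_decompose_mul_of_left_mem (𝒜 := homogeneousSubmodule (Fin 4) k)
    (a := a) (b := b) (i := d) n ha
  rw [key, key] at this
  rw [this]
  split_ifs <;> simp

theorem nak {ι κ : Type*} [Fintype ι] (N1 : Matrix (Fin 5) ι (MvPolynomial (Fin 4) k))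
    (N2 : Matrix κ (Fin 5) (MvPolynomial (Fin 4) k)) (d1 d2 : ℕ)
    (h1 : ∀ i j, (N1 i j).IsHomogeneous d1) (h2 : ∀ i j, (N2 i j).IsHomogeneous d2)
    (h12 : ∀ u, N2.mulVec (N1.mulVec u) = 0)
    (f : MvPolynomial (Fin 4) k) (hf : f.IsHomogeneous 2) (hf0 : f ≠ 0)
    (hmod : ∀ v, N2.mulVec v = 0 → ∃ u r, v = N1.mulVec u + f • r) :
    ∀ v, N2.mulVec v = 0 → ∃ u, v = N1.mulVec u := by
  have hom : ∀ n : ℕ, ∀ v : Fin 5 → MvPolynomial (Fin 4) k, (∀ j, (v j).IsHomogeneous n) →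
      N2.mulVec v = 0 → ∃ u, v = N1.mulVec u := by
    intro n
    induction n using Nat.strong_induction_on with
    | _ n ih =>
      intro v hv hv2
      obtain ⟨u, r, hur⟩ := hmod v hv2
      set u' : ι → MvPolynomial (Fin 4) k :=
        fun i => if d1 ≤ n then homogeneousComponent (n - d1) (u i) else 0 with hu'
      set r' : Fin 5 → MvPolynomial (Fin 4) k :=
        fun i => if 2 ≤ n then homogeneousComponent (n - 2) (r i) else 0 with hr'
      have hv' : v = N1.mulVec u' + f • r' := by
        funext j
        have h := congrArg (homogeneousComponent n) (congrFun hur j)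
        rw [homogeneousComponent_eq_self (hv j)] at h
        rw [h]
        simp only [Pi.add_apply, Pi.smul_apply, smul_eq_mul, map_add, hcomp_mul hf,
          Matrix.mulVec, dotProduct, map_sum, hcomp_mul (h1 j _), hu', hr']
      have hr2 : N2.mulVec r' = 0 := by
        rw [hv', Matrix.mulVec_add, h12, zero_add, Matrix.mulVec_smul] at hv2
        exact (smul_eq_zero.1 hv2).resolve_left hf0
      have : ∃ u, r' = N1.mulVec u := by
        by_cases hn : 2 ≤ n
        · refine ih (n - 2) (by omega) r' (fun j => ?_) hr2
          simp only [hr', if_pos hn]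
          exact homogeneousComponent_isHomogeneous _ _
        · refine ⟨0, ?_⟩
          rw [Matrix.mulVec_zero]
          funext j
          simp only [hr', if_neg hn, Pi.zero_apply]
      obtain ⟨u'', hu''⟩ := this
      refine ⟨u' + f • u'', ?_⟩
      rw [Matrix.mulVec_add, Matrix.mulVec_smul, ← hu'', ← hv']
  intro v hv
  have hc : ∀ n, N2.mulVec (fun j => homogeneousComponent n (v j)) = 0 := by
    intro n
    funext i
    have h := congrArg (homogeneousComponent (n + d2)) (congrFun hv i)
    simp only [Matrix.mulVec, dotProduct, map_sum, hcomp_mul (h2 i _), Pi.zero_apply, map_zero] at h ⊢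
    rw [← h]
    simp
  have := fun n => hom n (fun j => homogeneousComponent n (v j))
    (fun j => homogeneousComponent_isHomogeneous _ _) (hc n)
  choose u hu using this
  refine ⟨∑ n ∈ Finset.range (∑ j, (v j).totalDegree + 1), u n, ?_⟩
  rw [Matrix.mulVec_sum]
  funext j
  rw [Finset.sum_apply]
  simp only [← hu]
  conv_lhs => rw [← sum_homogeneousComponent (v j)]
  refine Finset.sum_subset ?_ ?_
  · intro a ha
    rw [Finset.mem_range] at ha ⊢
    have := Finset.single_le_sum (f := fun j => (v j).totalDegree) (fun _ _ => Nat.zero_le _)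
      (Finset.mem_univ j)
    omega
  · intro a _ ha
    rw [Finset.mem_range] at ha
    exact homogeneousComponent_eq_zero _ _ (by omega)

theorem theta_reg (f : MvPolynomial (Fin 4) k)
    (θ : MvPolynomial (Fin 4) k ≃ₐ[k] MvPolynomial (Fin 4) k)
    (hf : (finSuccEquiv k 3 (θ.symm f)).Monic) (T : Set (Fin 3)) (i : Fin 3) (hi : i ∉ T)
    (A : MvPolynomial (Fin 4) k)
    (h : (θ (X i.succ)) ^ 4 * A ∈
      Ideal.span ((fun j : Fin 3 => (θ (X j.succ)) ^ 4) '' T) ⊔ Ideal.span {f}) :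
    A ∈ Ideal.span ((fun j : Fin 3 => (θ (X j.succ)) ^ 4) '' T) ⊔ Ideal.span {f} := by
  have key : ∀ B, B ∈ Ideal.span ((fun j : Fin 3 => (θ (X j.succ)) ^ 4) '' T) ⊔ Ideal.span {f} ↔
      θ.symm B ∈ Ideal.span {θ.symm f} ⊔
      Ideal.span ((fun j : Fin 3 => (X j.succ : MvPolynomial (Fin 4) k) ^ 4) '' T) := by
    intro B
    have : Ideal.span {θ.symm f} ⊔
      Ideal.span ((fun j : Fin 3 => (X j.succ : MvPolynomial (Fin 4) k) ^ 4) '' T) =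
      (Ideal.span ((fun j : Fin 3 => (θ (X j.succ)) ^ 4) '' T) ⊔ Ideal.span {f}).map
        (θ.symm.toRingEquiv) := by
      rw [Ideal.map_sup, Ideal.map_span, Ideal.map_span, Set.image_singleton,
        Set.image_image, sup_comm]
      simp
    rw [this]
    constructor
    · exact fun h => Ideal.mem_map_of_mem (θ.symm.toRingEquiv) h
    · intro h
      rw [Ideal.mem_map_of_equiv] at h
      obtain ⟨x, hx, hxB⟩ := h
      rwa [← θ.symm.toRingEquiv.injective hxB]
  rw [key] at h ⊢
  refine mv_reg _ hf T i hi _ ?_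
  convert h using 1
  simp

theorem pfV_map {R S : Type*} [CommRing R] [CommRing S] (φ : R →+* S) (e : Fin 10 → R) (i : Fin 5) :
    pfV (fun i => φ (e i)) i = φ (pfV e i) := by
  fin_cases i <;> simp [pfV]

theorem altM_map {R S : Type*} [CommRing R] [CommRing S] (φ : R →+* S) (e : Fin 10 → R)
    (v : Fin 5 → R) (j : Fin 5) :
    (altM (fun i => φ (e i))).mulVec (fun i => φ (v i)) j = φ ((altM e).mulVec v j) := by
  fin_cases j <;> simp [altM, Matrix.mulVec, dotProduct, Fin.sum_univ_succ]

theorem altM_hom (e : Fin 10 → MvPolynomial (Fin 4) k) (he : ∀ i, (e i).IsHomogeneous 1)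
    (i j : Fin 5) : (altM e i j).IsHomogeneous 1 := by
  fin_cases i <;> fin_cases j <;>
    simp [altM, he, isHomogeneous_zero, IsHomogeneous.neg]

theorem pfV_hom (e : Fin 10 → MvPolynomial (Fin 4) k) (he : ∀ i, (e i).IsHomogeneous 1)
    (i : Fin 5) : (pfV e i).IsHomogeneous 2 := by
  have h : ∀ a b c d p q, (e a * e b - e c * e d + e p * e q).IsHomogeneous 2 := fun a b c d p q =>
    (((he a).mul (he b)).sub ((he c).mul (he d))).add ((he p).mul (he q))
  fin_cases i
  · exact h _ _ _ _ _ _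
  · exact (h _ _ _ _ _ _).neg
  · exact h _ _ _ _ _ _
  · exact (h _ _ _ _ _ _).neg
  · exact h _ _ _ _ _ _

theorem hom_main (e : Fin 10 → MvPolynomial (Fin 4) k) (he : ∀ i, (e i).IsHomogeneous 1)
    (f : MvPolynomial (Fin 4) k) (hf : f.IsHomogeneous 2)
    (θ : MvPolynomial (Fin 4) k ≃ₐ[k] MvPolynomial (Fin 4) k)
    (hmon : (finSuccEquiv k 3 (θ.symm f)).Monic)
    (hpow : ∀ i : Fin 3, (θ (X i.succ)) ^ 4 ∈ Ideal.span (Set.range (pfV e)) ⊔ Ideal.span {f}) :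
    (∀ h, h * f ∈ Ideal.span (Set.range (pfV e)) → h ∈ Ideal.span (Set.range (pfV e))) ∧
    (∀ t, (∀ i, pfV e i * t = 0) → t = 0) ∧
    (∀ v, (altM e).mulVec v = 0 → ∃ t, ∀ j, v j = pfV e j * t) ∧
    (∀ v, ∑ l, pfV e l * v l = 0 → ∃ u, v = (altM e).mulVec u) := by
  have hf0 : f ≠ 0 := by
    rintro rfl
    rw [map_zero, map_zero] at hmon
    exact hmon.ne_zero rfl
  set mk := Ideal.Quotient.mk (Ideal.span {f}) with hmk
  have hmk0 : ∀ p, mk p = 0 ↔ ∃ r, p = f * r := fun p => by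
    rw [hmk, Ideal.Quotient.eq_zero_iff_mem, Ideal.mem_span_singleton]; rfl
  have hJ : ∀ i : Fin 3, mk (θ (X i.succ) ^ 4) ∈ Ideal.span (Set.range (pfV (fun i => mk (e i)))) := by
    intro i
    have := Ideal.mem_quotient_iff_mem_sup.2 (hpow i)
    rw [Ideal.map_span, ← Set.range_comp] at this
    have h2 : pfV (fun i => mk (e i)) = mk ∘ pfV e := funext fun j => pfV_map mk e j
    rw [h2]
    exact this
  have reg : ∀ (T : Set (Fin 3)) (i : Fin 3), i ∉ T → ∀ t,
      mk (θ (X i.succ) ^ 4) * t ∈ Ideal.span ((fun j : Fin 3 => mk (θ (X j.succ) ^ 4)) '' T) →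
      t ∈ Ideal.span ((fun j : Fin 3 => mk (θ (X j.succ) ^ 4)) '' T) := by
    intro T i hi t ht
    obtain ⟨t, rfl⟩ := Ideal.Quotient.mk_surjective t
    have e1 : Ideal.span ((fun j : Fin 3 => mk (θ (X j.succ) ^ 4)) '' T)
      = (Ideal.span ((fun j : Fin 3 => (θ (X j.succ)) ^ 4) '' T)).map mk := by
      rw [Ideal.map_span, Set.image_image]
    rw [e1] at ht ⊢
    rw [← map_mul, Ideal.mem_quotient_iff_mem_sup] at ht
    rw [Ideal.mem_quotient_iff_mem_sup]
    exact theta_reg f θ hmon T i hi t ht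
  have r1 : ∀ t, mk (θ (X (0 : Fin 3).succ) ^ 4) * t = 0 → t = 0 := fun t ht => by
    have := reg ∅ 0 (by simp) t (by rw [ht]; exact Ideal.zero_mem _)
    simpa using this
  have r2 : ∀ t, (∃ p, mk (θ (X (1 : Fin 3).succ) ^ 4) * t = mk (θ (X (0 : Fin 3).succ) ^ 4) * p) →
      ∃ p, t = mk (θ (X (0 : Fin 3).succ) ^ 4) * p := by
    rintro t ⟨p, hp⟩
    have := reg {0} 1 (by simp) t (by
      rw [hp, Set.image_singleton]
      exact Ideal.mul_mem_right _ _ (Ideal.mem_span_singleton_self _))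
    rw [Set.image_singleton, Ideal.mem_span_singleton] at this
    exact this
  have r3 : ∀ t, (∃ p q, mk (θ (X (2 : Fin 3).succ) ^ 4) * t = mk (θ (X (0 : Fin 3).succ) ^ 4) * p
        + mk (θ (X (1 : Fin 3).succ) ^ 4) * q) →
      ∃ p q, t = mk (θ (X (0 : Fin 3).succ) ^ 4) * p + mk (θ (X (1 : Fin 3).succ) ^ 4) * q := by
    rintro t ⟨p, q, hp⟩
    have := reg {0, 1} 2 (by simp) t (by
      rw [hp, Set.image_pair, Ideal.mem_span_pair]
      exact ⟨p, q, by ring⟩)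
    rw [Set.image_pair, Ideal.mem_span_pair] at this
    obtain ⟨p, q, h⟩ := this
    exact ⟨p, q, by rw [← h]; ring⟩
  have E1 : ∀ v, mk (∑ l, pfV e l * v l) = 0 → ∃ u r, v = (altM e).mulVec u + f • r := by
    intro v hv
    obtain ⟨u, hu⟩ := acyc1 (fun i => mk (e i)) (hJ 0) (hJ 1) (hJ 2) r1 r2 r3 (fun i => mk (v i)) (by
      simp only [pfV_map mk e, ← map_mul, ← map_sum]
      exact hv)
    choose u' hu' using fun i => Ideal.Quotient.mk_surjective (u i)
    have : u = fun i => mk (u' i) := funext fun i => (hu' i).symm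
    subst this
    have := fun j => (hmk0 (v j - (altM e).mulVec u' j)).1 (by
      rw [map_sub, ← altM_map mk e u' j]
      exact sub_eq_zero.2 (congrFun hu j))
    choose r hr using this
    refine ⟨u', r, ?_⟩
    funext j
    simp only [Pi.add_apply, Pi.smul_apply, smul_eq_mul]
    linear_combination hr j
  have E2 : ∀ v, (altM e).mulVec v = 0 → ∃ (t : MvPolynomial (Fin 4) k) (r : Fin 5 → MvPolynomial (Fin 4) k), v = t • (pfV e) + f • r := by
    intro v hv
    obtain ⟨t, ht⟩ := acyc2 (fun i => mk (e i)) (hJ 0) (hJ 1) r1 r2 (fun i => mk (v i)) (by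
      funext j
      rw [altM_map mk e v j, hv]; simp)
    obtain ⟨t, rfl⟩ := Ideal.Quotient.mk_surjective t
    have := fun j => (hmk0 (v j - t * pfV e j)).1 (by
      have := ht j
      rw [pfV_map mk e] at this
      rw [map_sub, this, map_mul]; ring)
    choose r hr using this
    refine ⟨t, r, ?_⟩
    funext j
    simp only [Pi.add_apply, Pi.smul_apply, smul_eq_mul]
    linear_combination hr j
  refine ⟨?_, ?_, ?_, ?_⟩
  · intro h hh
    obtain ⟨c, hc⟩ := span_pf_coeff e hh
    obtain ⟨u, r, hur⟩ := E1 c ((hmk0 _).2 ⟨h, by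
      rw [mul_comm, hc]
      exact Finset.sum_congr rfl fun i _ => mul_comm _ _⟩)
    have : h = ∑ l, r l * pfV e l := by
      apply mul_right_cancel₀ hf0
      rw [hc, hur]
      have := pfV_altM e u
      simp only [Pi.add_apply, Pi.smul_apply, smul_eq_mul, add_mul, Finset.sum_add_distrib]
      have h' : ∑ i, (altM e).mulVec u i * pfV e i = 0 := by
        rw [← this]; exact Finset.sum_congr rfl fun i _ => mul_comm _ _
      rw [h', zero_add, Finset.sum_mul]
      exact Finset.sum_congr rfl fun i _ => by ring
    rw [this]
    exact Ideal.sum_mem _ fun i _ => Ideal.mul_mem_left _ _ (Ideal.subset_span ⟨i, rfl⟩)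
  · intro t ht
    by_contra ht0
    have hz : ∀ i, pfV e i = 0 := fun i => (mul_eq_zero.1 (ht i)).resolve_right ht0
    have : Ideal.span (Set.range (pfV e)) = ⊥ := by
      rw [Ideal.span_eq_bot]
      rintro _ ⟨i, rfl⟩
      exact hz i
    have h0 := hpow 0
    rw [this, bot_sup_eq, Ideal.mem_span_singleton] at h0
    have h1 : (1 : MvPolynomial (Fin 4) k ⧸ Ideal.span {f}) = 0 := r1 1 (by
      rw [mul_one]; exact (hmk0 _).2 h0)
    rw [← map_one mk] at h1
    obtain ⟨r, hr⟩ := (hmk0 _).1 h1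
    have := congrArg constantCoeff hr
    rw [map_mul, map_one, constantCoeff_eq, hf.coeff_eq_zero (by simp)] at this
    simp at this
  · intro v hv
    obtain ⟨u, hu⟩ := nak (Matrix.of fun i (_ : Fin 1) => pfV e i) (altM e) 2 1
      (fun i _ => pfV_hom e he i) (altM_hom e he) (by
        intro u
        have : (Matrix.of fun i (_ : Fin 1) => pfV e i).mulVec u = u 0 • pfV e := by
          funext j; simp [Matrix.mulVec, dotProduct, mul_comm]
        rw [this, Matrix.mulVec_smul]
        funext j
        simp [altM_pfV]) f hf hf0 (by
        intro v hv
        obtain ⟨t, r, h⟩ := E2 v hv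
        refine ⟨fun _ => t, r, ?_⟩
        rw [h]
        congr 1
        funext j; simp [Matrix.mulVec, dotProduct, mul_comm]) v hv
    refine ⟨u 0, fun j => ?_⟩
    rw [hu]; simp [Matrix.mulVec, dotProduct]
  · intro v hv
    have hrow : ∀ w : Fin 5 → MvPolynomial (Fin 4) k, (Matrix.of fun (_ : Fin 1) i => pfV e i).mulVec w
      = fun _ => ∑ l, pfV e l * w l := fun w => by
        funext j; simp [Matrix.mulVec, dotProduct]
    refine nak (altM e) (Matrix.of fun (_ : Fin 1) i => pfV e i) 1 2 (altM_hom e he)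
      (fun _ i => pfV_hom e he i) (by
        intro u
        rw [hrow, pfV_altM]; rfl) f hf hf0 (by
        intro v hv
        rw [hrow] at hv
        exact E1 v (by rw [congrFun hv 0]; simp)) v (by rw [hrow, hv]; rfl)
end Nak

section PfIdent
set_option linter.unusedVariables false
set_option linter.style.longLine false

theorem pf_ident {R : Type*} [CommRing R] (x y z w a b c d l111 l112 l113 l121 l122 l123 l131 l132 l133 l221 l222 l223 l231 l232 l233 l331 l332 l333 α11 α12 α13 α22 α23 α33 R11 R12 R13 R22 R23 R33 : R)
    (L11 : -b * l113 - c * l123 + d * l132 = 0)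
    (L12 : a * l113 - c * l223 - d * l131 + d * l232 = 0)
    (L13 : b * l111 - a * l112 - b * l133 + c * l121 - b * l122 - c * l233 + d * l332 = 0)
    (L22 : a * l123 + b * l223 - d * l231 = 0)
    (L23 : b * l121 - a * l122 + a * l133 + c * l221 - b * l222 + b * l233 - d * l331 = 0)
    (L33 : b * l131 - a * l132 + c * l231 - b * l232 = 0)
    (K212 : l111 * l132 - l112 * l131 + l112 * l232 - l122 * l132 + l113 * l332 - l132 * l133 + R23 * c = 0)
    (K112 : α13 + l122 * l131 - l121 * l132 + l132 * l222 - l122 * l232 + l133 * l232 - l123 * l332 + R23 * b = 0)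
    (K332 : -α13 + l112 * l231 - l122 * l131 + l122 * l232 - l132 * l222 + l132 * l233 - l133 * l232 = 0)
    (K122 : α23 + l122 * l231 - l132 * l221 + l232 * l233 - l223 * l332 - R23 * a = 0)
    (K222 : l121 * l132 - l112 * l231 + l123 * l332 - l132 * l233 - R23 * b = 0)
    (K331 : α23 + l111 * l231 - l121 * l131 + l121 * l232 - l132 * l221 + l131 * l233 - l133 * l231 = 0)
    (K132 : α33 + l122 * l331 - l132 * l231 + l222 * l332 - l232 * l232 + l232 * l333 - l233 * l332 - R12 * b + R22 * a = 0)
    (K312 : -α11 + l112 * l121 - l111 * l122 + l122 * l122 - l112 * l222 + l123 * l132 - l113 * l232 - R22 * d = 0)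
    (K232 : l131 * l132 - l112 * l331 + l132 * l232 - l122 * l332 + l133 * l332 - l132 * l333 - R12 * c + R22 * b = 0)
    (K311 : α12 + l121 * l122 - l112 * l221 + l123 * l131 - l113 * l231 - R12 * d = 0)
    (K322 : -α12 + l112 * l221 - l121 * l122 + l132 * l223 - l123 * l232 + R12 * d = 0)
    (K131 : l121 * l331 - l131 * l231 + l221 * l332 - l231 * l232 + l231 * l333 - l233 * l331 - R11 * b + R12 * a = 0)
    (K321 : α22 + l111 * l221 - l121 * l121 + l121 * l222 - l122 * l221 + l131 * l223 - l123 * l231 + R11 * d = 0)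
    (K231 : -α33 + l131 * l131 - l111 * l331 + l132 * l231 - l121 * l332 + l133 * l331 - l131 * l333 - R11 * c + R12 * b = 0) :
    ((b * z + x * (d * l331 - b * l121 - c * l221)) * (c * w + x * (-b * l132 - c * l232)) - (-b * y + c * z + x * (d * l332 + b * l111 - b * l122 + c * l121 - c * l222)) * (b * w + x * (-a * l132 - b * l232)) + (-c * y + x * (b * l112 + c * l122)) * (a * w + x * (-a * l131 - b * l231))
      = -((a * c - b ^ 2) * (y * w - x * (α13 * x + l131 * y + l132 * z + l133 * w)))) ∧
    ((a * z + x * (-a * l121 - b * l221)) * (c * w + x * (-b * l132 - c * l232)) - (-a * y + b * z + x * (-d * l331 + a * l111 - a * l122 + b * l121 - b * l222)) * (b * w + x * (-a * l132 - b * l232)) + (-b * y + x * (-d * l332 + a * l112 + b * l122)) * (a * w + x * (-a * l131 - b * l231))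
      = (a * c - b ^ 2) * (z * w - x * (α23 * x + l231 * y + l232 * z + l233 * w))) ∧
    ((d * w + x * (d * l232 - d * l333 + a * l113 + b * l123)) * (c * w + x * (-b * l132 - c * l232)) - (-a * y + b * z + x * (-d * l331 + a * l111 - a * l122 + b * l121 - b * l222)) * (-c * y + x * (b * l112 + c * l122)) + (-b * y + x * (-d * l332 + a * l112 + b * l122)) * (-b * y + c * z + x * (d * l332 + b * l111 - b * l122 + c * l121 - c * l222))
      = -((a * c - b ^ 2) * (y * y - x * (α11 * x + l111 * y + l112 * z + l113 * w)) - c * d * (w * w - x * (α33 * x + l331 * y + l332 * z + l333 * w)))) ∧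
    ((d * w + x * (d * l232 - d * l333 + a * l113 + b * l123)) * (b * w + x * (-a * l132 - b * l232)) - (a * z + x * (-a * l121 - b * l221)) * (-c * y + x * (b * l112 + c * l122)) + (-b * y + x * (-d * l332 + a * l112 + b * l122)) * (b * z + x * (d * l331 - b * l121 - c * l221))
      = (a * c - b ^ 2) * (y * z - x * (α12 * x + l121 * y + l122 * z + l123 * w)) + b * d * (w * w - x * (α33 * x + l331 * y + l332 * z + l333 * w))) ∧
    ((d * w + x * (d * l232 - d * l333 + a * l113 + b * l123)) * (a * w + x * (-a * l131 - b * l231)) - (a * z + x * (-a * l121 - b * l221)) * (-b * y + c * z + x * (d * l332 + b * l111 - b * l122 + c * l121 - c * l222)) + (-a * y + b * z + x * (-d * l331 + a * l111 - a * l122 + b * l121 - b * l222)) * (b * z + x * (d * l331 - b * l121 - c * l221))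
      = -((a * c - b ^ 2) * (z * z - x * (α22 * x + l221 * y + l222 * z + l223 * w)) - a * d * (w * w - x * (α33 * x + l331 * y + l332 * z + l333 * w)))) := by
  refine ⟨?_, ?_, ?_, ?_, ?_⟩
  · linear_combination w*x*(-b*L13-c*L23)+x*y*(b*L33)+x^2*(-b*l122*L33+b*l132*L23+a*b*K212+b*l232*L13+a*l332*L11-a*c*K112+c*l232*L23-b^2*K332)
  · linear_combination w*x*(-b*L23-a*L13)+x*y*(a*L33)+x^2*(-a*l111*L33+a*l132*L23+b*l232*L23+a*l133*L33-b*l332*L22-b^2*K122+a*b*K222+a*l131*L13+a*c*K331)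
  · linear_combination w*x*(-b*L11)+x^2*(a*l132*L11+d*l132*L33+c*d*K132+a*c*K312-d*l332*L13-b*d*K232-b^2*K312+b*l232*L11)
  · linear_combination w*x*(-a*L11)+x^2*(a*l113*L33+a*l131*L11-b*l132*L22-a*d*K232+d*l332*L23+b*d*K132+a*c*K311+b^2*K322)
  · linear_combination w*x*(a*L12+b*L22)+x^2*(-a*l131*L12+b^2*K321+b*d*K131-b*l131*L22+d*l331*L23-a*c*K321-a*d*K231+a*l231*L11)

theorem sc_rel {k : Type*} [Field k] (lm : Fin 4 → Fin 4 → Fin 4 → k) (S : Fin 4 → Fin 4 → Fin 4 → Fin 4 → k)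
    (R : Fin 4 → Fin 4 → k)
    (lsym : ∀ i j n, lm i j n = lm j i n) (l0 : ∀ j n, lm 0 j n = if j = n then 1 else 0)
    (Rs : ∀ i j, R i j = R j i)
    (S0 : ∀ u w t, S u w t 0 = 0) (Sd : ∀ u w t, S u w t t = 0) (Sa : ∀ u w t m, S u w t m = - S u w m t)
    (relK : ∀ u w t n, ∑ i, lm w t i * lm u i n - ∑ i, lm u t i * lm w i n = ∑ m, S u w t m * R m n)
    (rel1 : ∀ t, ∑ m, lm 3 t m * S 1 2 t m + ∑ m, lm 1 t m * S 2 3 t m + ∑ m, lm 2 t m * S 3 1 t m = 0)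
    (rel2 : ∀ t s, ∑ m, (lm 3 s m * S 1 2 t m + lm 3 t m * S 1 2 s m)
      + ∑ m, (lm 1 s m * S 2 3 t m + lm 1 t m * S 2 3 s m)
      + ∑ m, (lm 2 s m * S 3 1 t m + lm 2 t m * S 3 1 s m) = 0)
    (a b c d : k) (Saa : S 2 3 2 3 = a) (Sab : S 2 3 3 1 = b) (Sac : S 2 3 1 2 = 0)
    (Sba : S 3 1 2 3 = b) (Sbb : S 3 1 3 1 = c) (Sbc : S 3 1 1 2 = 0)
    (Sca : S 1 2 2 3 = 0) (Scb : S 1 2 3 1 = 0) (Scc : S 1 2 1 2 = d) :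
    (-b * lm 1 1 3 - c * lm 1 2 3 + d * lm 1 3 2 = 0) ∧
    (a * lm 1 1 3 - c * lm 2 2 3 - d * lm 1 3 1 + d * lm 2 3 2 = 0) ∧
    (b * lm 1 1 1 - a * lm 1 1 2 - b * lm 1 3 3 + c * lm 1 2 1 - b * lm 1 2 2 - c * lm 2 3 3 + d * lm 3 3 2 = 0) ∧
    (a * lm 1 2 3 + b * lm 2 2 3 - d * lm 2 3 1 = 0) ∧
    (b * lm 1 2 1 - a * lm 1 2 2 + a * lm 1 3 3 + c * lm 2 2 1 - b * lm 2 2 2 + b * lm 2 3 3 - d * lm 3 3 1 = 0) ∧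
    (b * lm 1 3 1 - a * lm 1 3 2 + c * lm 2 3 1 - b * lm 2 3 2 = 0) ∧
    (lm 1 1 1 * lm 1 3 2 - lm 1 1 2 * lm 1 3 1 + lm 1 1 2 * lm 2 3 2 - lm 1 2 2 * lm 1 3 2 + lm 1 1 3 * lm 3 3 2 - lm 1 3 2 * lm 1 3 3 + R 2 3 * c = 0) ∧
    (lm 1 3 0 + lm 1 2 2 * lm 1 3 1 - lm 1 2 1 * lm 1 3 2 + lm 1 3 2 * lm 2 2 2 - lm 1 2 2 * lm 2 3 2 + lm 1 3 3 * lm 2 3 2 - lm 1 2 3 * lm 3 3 2 + R 2 3 * b = 0) ∧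
    (-lm 1 3 0 + lm 1 1 2 * lm 2 3 1 - lm 1 2 2 * lm 1 3 1 + lm 1 2 2 * lm 2 3 2 - lm 1 3 2 * lm 2 2 2 + lm 1 3 2 * lm 2 3 3 - lm 1 3 3 * lm 2 3 2 = 0) ∧
    (lm 2 3 0 + lm 1 2 2 * lm 2 3 1 - lm 1 3 2 * lm 2 2 1 + lm 2 3 2 * lm 2 3 3 - lm 2 2 3 * lm 3 3 2 - R 2 3 * a = 0) ∧
    (lm 1 2 1 * lm 1 3 2 - lm 1 1 2 * lm 2 3 1 + lm 1 2 3 * lm 3 3 2 - lm 1 3 2 * lm 2 3 3 - R 2 3 * b = 0) ∧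
    (lm 2 3 0 + lm 1 1 1 * lm 2 3 1 - lm 1 2 1 * lm 1 3 1 + lm 1 2 1 * lm 2 3 2 - lm 1 3 2 * lm 2 2 1 + lm 1 3 1 * lm 2 3 3 - lm 1 3 3 * lm 2 3 1 = 0) ∧
    (lm 3 3 0 + lm 1 2 2 * lm 3 3 1 - lm 1 3 2 * lm 2 3 1 + lm 2 2 2 * lm 3 3 2 - lm 2 3 2 * lm 2 3 2 + lm 2 3 2 * lm 3 3 3 - lm 2 3 3 * lm 3 3 2 - R 1 2 * b + R 2 2 * a = 0) ∧
    (-lm 1 1 0 + lm 1 1 2 * lm 1 2 1 - lm 1 1 1 * lm 1 2 2 + lm 1 2 2 * lm 1 2 2 - lm 1 1 2 * lm 2 2 2 + lm 1 2 3 * lm 1 3 2 - lm 1 1 3 * lm 2 3 2 - R 2 2 * d = 0) ∧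
    (lm 1 3 1 * lm 1 3 2 - lm 1 1 2 * lm 3 3 1 + lm 1 3 2 * lm 2 3 2 - lm 1 2 2 * lm 3 3 2 + lm 1 3 3 * lm 3 3 2 - lm 1 3 2 * lm 3 3 3 - R 1 2 * c + R 2 2 * b = 0) ∧
    (lm 1 2 0 + lm 1 2 1 * lm 1 2 2 - lm 1 1 2 * lm 2 2 1 + lm 1 2 3 * lm 1 3 1 - lm 1 1 3 * lm 2 3 1 - R 1 2 * d = 0) ∧
    (-lm 1 2 0 + lm 1 1 2 * lm 2 2 1 - lm 1 2 1 * lm 1 2 2 + lm 1 3 2 * lm 2 2 3 - lm 1 2 3 * lm 2 3 2 + R 1 2 * d = 0) ∧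
    (lm 1 2 1 * lm 3 3 1 - lm 1 3 1 * lm 2 3 1 + lm 2 2 1 * lm 3 3 2 - lm 2 3 1 * lm 2 3 2 + lm 2 3 1 * lm 3 3 3 - lm 2 3 3 * lm 3 3 1 - R 1 1 * b + R 1 2 * a = 0) ∧
    (lm 2 2 0 + lm 1 1 1 * lm 2 2 1 - lm 1 2 1 * lm 1 2 1 + lm 1 2 1 * lm 2 2 2 - lm 1 2 2 * lm 2 2 1 + lm 1 3 1 * lm 2 2 3 - lm 1 2 3 * lm 2 3 1 + R 1 1 * d = 0) ∧
    (-lm 3 3 0 + lm 1 3 1 * lm 1 3 1 - lm 1 1 1 * lm 3 3 1 + lm 1 3 2 * lm 2 3 1 - lm 1 2 1 * lm 3 3 2 + lm 1 3 3 * lm 3 3 1 - lm 1 3 1 * lm 3 3 3 - R 1 1 * c + R 1 2 * b = 0) := by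
  have l21 := lsym 2 1
  have l31 := lsym 3 1
  have l32 := lsym 3 2
  have l10 := fun n => (lsym 1 0 n).trans (l0 1 n)
  have l20 := fun n => (lsym 2 0 n).trans (l0 2 n)
  have l30 := fun n => (lsym 3 0 n).trans (l0 3 n)
  have R21 := Rs 2 1
  have R31 := Rs 3 1
  have R32 := Rs 3 2
  have e1 : ∀ u w, S u w 1 3 = - S u w 3 1 := fun u w => Sa u w 1 3
  have e2 : ∀ u w, S u w 2 1 = - S u w 1 2 := fun u w => Sa u w 2 1
  have e3 : ∀ u w, S u w 3 2 = - S u w 2 3 := fun u w => Sa u w 3 2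
  have f1 : ((1 : Fin 4) = 2) = False := by decide
  have f2 : ((1 : Fin 4) = 3) = False := by decide
  have f3 : ((2 : Fin 4) = 1) = False := by decide
  have f4 : ((2 : Fin 4) = 3) = False := by decide
  have f5 : ((3 : Fin 4) = 1) = False := by decide
  have f6 : ((3 : Fin 4) = 2) = False := by decide
  have H := (⟨rel1 1, rel2 1 2, rel2 1 3, rel1 2, rel2 2 3, rel1 3, relK 3 1 1 2, relK 2 3 1 2, relK 1 2 3 2, relK 2 3 2 2, relK 3 1 2 2, relK 1 2 3 1, relK 2 3 3 2, relK 1 2 1 2, relK 3 1 3 2, relK 1 2 1 1, relK 1 2 2 2, relK 2 3 3 1, relK 1 2 2 1, relK 3 1 3 1⟩ : _ ∧ _ ∧ _ ∧ _ ∧ _ ∧ _ ∧ _ ∧ _ ∧ _ ∧ _ ∧ _ ∧ _ ∧ _ ∧ _ ∧ _ ∧ _ ∧ _ ∧ _ ∧ _ ∧ _)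
  simp only [Fin.sum_univ_four, l21, l31, l32, l10, l20, l30, R21, R31, R32, e1, e2, e3, S0, Sd, Saa, Sab, Sac, Sba, Sbb, Sbc, Sca, Scb, Scc, f1, f2, f3, f4, f5, f6, if_true, if_false] at H
  obtain ⟨hL11, hL12, hL13, hL22, hL23, hL33, hK212, hK112, hK332, hK122, hK222, hK331, hK132, hK312, hK232, hK311, hK322, hK131, hK321, hK231⟩ := H
  exact ⟨by linear_combination hL11, by linear_combination hL12, by linear_combination hL13, by linear_combination hL22, by linear_combination hL23, by linear_combination hL33, by linear_combination hK212, by linear_combination hK112, by linear_combination hK332, by linear_combination hK122, by linear_combination hK222, by linear_combination hK331, by linear_combination hK132, by linear_combination hK312, by linear_combination hK232, by linear_combination hK311, by linear_combination hK322, by linear_combination hK131, by linear_combination hK321, by linear_combination hK231⟩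

end PfIdent

section Inv
variable {k : Type*} [Field k]

/-- degree-three functional with the inverse map -/
structure InvSys (Φ : MvPolynomial (Fin 4) k →ₗ[k] k)
    (L : MvPolynomial (Fin 4) k →ₗ[k] MvPolynomial (Fin 4) k) : Prop where
  L1 : ∀ q, (L q).IsHomogeneous 1
  hL : ∀ q v, v.IsHomogeneous 1 → Φ (X 0 * L q * v) = Φ (q * v)
  nd : ∀ a, a.IsHomogeneous 1 → (∀ v, v.IsHomogeneous 1 → Φ (X 0 * a * v) = 0) → a = 0
  dg : ∀ n p, n ≠ 3 → p.IsHomogeneous n → Φ p = 0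

/-- a basis of linear forms with its dual -/
structure LinFrame (Φ : MvPolynomial (Fin 4) k →ₗ[k] k) (v r : Fin 4 → MvPolynomial (Fin 4) k) : Prop where
  v0 : v 0 = X 0
  vh : ∀ i, (v i).IsHomogeneous 1
  rh : ∀ i, (r i).IsHomogeneous 1
  dual : ∀ i j, Φ (X 0 * v i * r j) = if i = j then 1 else 0
  dec : ∀ a, a.IsHomogeneous 1 → a = ∑ i, Φ (X 0 * a * r i) • v i

/-- the form -/
noncomputable def DD (Φ : MvPolynomial (Fin 4) k →ₗ[k] k)
    (L : MvPolynomial (Fin 4) k →ₗ[k] MvPolynomial (Fin 4) k) (u v t b : MvPolynomial (Fin 4) k) : k :=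
  Φ (u * b * L (v * t)) - Φ (u * t * L (v * b))

variable {Φ : MvPolynomial (Fin 4) k →ₗ[k] k}
    {L : MvPolynomial (Fin 4) k →ₗ[k] MvPolynomial (Fin 4) k}

theorem hom1_X0 : (X 0 : MvPolynomial (Fin 4) k).IsHomogeneous 1 := isHomogeneous_X _ _

theorem InvSys.sym (I : InvSys Φ L) (q q' : MvPolynomial (Fin 4) k) :
    Φ (q * L q') = Φ (q' * L q) := by
  rw [← I.hL q _ (I.L1 q'), ← I.hL q' _ (I.L1 q)]
  congr 1; ring

theorem InvSys.Lx (I : InvSys Φ L) (m : MvPolynomial (Fin 4) k) (hm : m.IsHomogeneous 1) :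
    L (X 0 * m) = m := by
  rw [← sub_eq_zero]
  refine I.nd _ ((I.L1 _).sub hm) fun v hv => ?_
  rw [mul_sub, sub_mul, map_sub, I.hL _ _ hv, sub_self]

theorem DD_self (u v t : MvPolynomial (Fin 4) k) : DD Φ L u v t t = 0 := sub_self _

theorem DD_anti (u v t b : MvPolynomial (Fin 4) k) : DD Φ L u v t b = - DD Φ L u v b t := by
  unfold DD; ring

theorem InvSys.DD_sym (I : InvSys Φ L) (u v t b : MvPolynomial (Fin 4) k) :
    DD Φ L u v t b = DD Φ L t b u v := by
  unfold DD
  rw [I.sym (u * b), mul_comm v t, mul_comm u b, mul_comm u t, mul_comm v b]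

theorem InvSys.DD_anti' (I : InvSys Φ L) (u v t b : MvPolynomial (Fin 4) k) :
    DD Φ L u v t b = - DD Φ L v u t b := by
  rw [I.DD_sym, DD_anti, I.DD_sym]

theorem DD_add (u v t b b' : MvPolynomial (Fin 4) k) :
    DD Φ L u v t (b + b') = DD Φ L u v t b + DD Φ L u v t b' := by
  unfold DD; simp only [mul_add, add_mul, map_add]; ring

theorem DD_smul (c : k) (u v t b : MvPolynomial (Fin 4) k) :
    DD Φ L u v t (c • b) = c * DD Φ L u v t b := by
  unfold DD; simp only [mul_smul_comm, smul_mul_assoc, map_smul, smul_eq_mul]; ring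

theorem DD_sum (u v t : MvPolynomial (Fin 4) k) (c : Fin 4 → k) (b : Fin 4 → MvPolynomial (Fin 4) k) :
    DD Φ L u v t (∑ i, c i • b i) = ∑ i, c i * DD Φ L u v t (b i) := by
  simp only [Fin.sum_univ_four, DD_add, DD_smul]

theorem InvSys.DD_x (I : InvSys Φ L) {u v t : MvPolynomial (Fin 4) k} (hu : u.IsHomogeneous 1)
    (hv : v.IsHomogeneous 1) : DD Φ L u v t (X 0) = 0 := by
  unfold DD
  rw [mul_comm v (X 0), I.Lx v hv, mul_comm u (X 0), mul_right_comm, I.hL _ _ hu, sub_eq_zero]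
  congr 1; ring

theorem InvSys.DD_L (I : InvSys Φ L) (u v t q : MvPolynomial (Fin 4) k) :
    DD Φ L u v t (L q) = Φ (u * L (v * t) * L q) - Φ (v * L (u * t) * L q) := by
  unfold DD
  rw [I.sym (u * t), mul_right_comm, mul_right_comm v]

theorem InvSys.rel2' (I : InvSys Φ L) (v : Fin 4 → MvPolynomial (Fin 4) k) (t s : MvPolynomial (Fin 4) k) :
    (DD Φ L (v 1) (v 2) t (L (v 3 * s)) + DD Φ L (v 1) (v 2) s (L (v 3 * t)))
    + (DD Φ L (v 2) (v 3) t (L (v 1 * s)) + DD Φ L (v 2) (v 3) s (L (v 1 * t)))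
    + (DD Φ L (v 3) (v 1) t (L (v 2 * s)) + DD Φ L (v 3) (v 1) s (L (v 2 * t))) = 0 := by
  simp only [I.DD_L, mul_right_comm _ (L (v _ * s)) (L (v _ * t))]
  ring

theorem InvSys.rel1' (I : InvSys Φ L) (v : Fin 4 → MvPolynomial (Fin 4) k) (t : MvPolynomial (Fin 4) k) :
    DD Φ L (v 1) (v 2) t (L (v 3 * t)) + DD Φ L (v 2) (v 3) t (L (v 1 * t))
    + DD Φ L (v 3) (v 1) t (L (v 2 * t)) = 0 := by
  simp only [I.DD_L]
  rw [mul_right_comm (v 1) (L (v 3 * t)), mul_right_comm (v 2) (L (v 3 * t)),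
    mul_right_comm (v 3) (L (v 2 * t))]
  ring

variable {v r : Fin 4 → MvPolynomial (Fin 4) k}

theorem LinFrame.Ldec (F : LinFrame Φ v r) (I : InvSys Φ L) (q : MvPolynomial (Fin 4) k) :
    L q = ∑ i, Φ (q * r i) • v i := by
  conv_lhs => rw [F.dec _ (I.L1 q)]
  simp only [I.hL _ _ (F.rh _)]

theorem LinFrame.Ddec (F : LinFrame Φ v r) {u w t b : MvPolynomial (Fin 4) k} (hb : b.IsHomogeneous 1) :
    DD Φ L u w t b = ∑ i, Φ (X 0 * b * r i) * DD Φ L u w t (v i) := by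
  conv_lhs => rw [F.dec b hb]
  rw [DD_sum]

theorem InvSys.Kel (I : InvSys Φ L) {u w t b : MvPolynomial (Fin 4) k} (hb : b.IsHomogeneous 1) :
    Φ (X 0 * (L (u * L (w * t)) - L (w * L (u * t))) * b) = DD Φ L u w t b := by
  rw [mul_sub, sub_mul, map_sub, I.hL _ _ hb, I.hL _ _ hb]
  unfold DD
  rw [mul_right_comm u, mul_right_comm w, I.sym (w * b)]

theorem LinFrame.Keq (F : LinFrame Φ v r) (I : InvSys Φ L) (u w t : MvPolynomial (Fin 4) k) :
    L (u * L (w * t)) - L (w * L (u * t)) = ∑ m, DD Φ L u w t (v m) • r m := by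
  rw [← sub_eq_zero]
  refine I.nd _ (((I.L1 _).sub (I.L1 _)).sub ?_) fun b hb => ?_
  · exact IsHomogeneous.sum _ _ _ fun i _ => by
      rw [smul_eq_C_mul]; simpa using (isHomogeneous_C _ _).mul (F.rh i)
  · rw [mul_sub, sub_mul, map_sub, I.Kel hb, F.Ddec hb, sub_eq_zero, Finset.mul_sum, Finset.sum_mul,
      map_sum]
    refine Finset.sum_congr rfl fun i _ => ?_
    rw [mul_smul_comm, smul_mul_assoc, map_smul, smul_eq_mul, mul_comm, mul_right_comm]

theorem LinFrame.relK (F : LinFrame Φ v r) (I : InvSys Φ L) (u w t n : Fin 4) :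
    ∑ i, Φ (v w * v t * r i) * Φ (v u * v i * r n) - ∑ i, Φ (v u * v t * r i) * Φ (v w * v i * r n)
      = ∑ m, DD Φ L (v u) (v w) (v t) (v m) * Φ (X 0 * r m * r n) := by
  have h := congrArg (fun p => Φ (X 0 * p * r n)) (F.Keq I (v u) (v w) (v t))
  simp only [mul_sub, sub_mul, map_sub, I.hL _ _ (F.rh n)] at h
  rw [F.Ldec I (v w * v t), F.Ldec I (v u * v t)] at h
  simpa only [Finset.mul_sum, Finset.sum_mul, map_sum, mul_smul_comm, smul_mul_assoc, map_smul,
    smul_eq_mul] using h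

theorem LinFrame.DL (F : LinFrame Φ v r) (I : InvSys Φ L) (u w t q : MvPolynomial (Fin 4) k) :
    DD Φ L u w t (L q) = ∑ m, Φ (q * r m) * DD Φ L u w t (v m) := by
  rw [F.Ddec (I.L1 q)]
  simp only [I.hL _ _ (F.rh _)]

end Inv

section Ann
variable {k : Type*} [Field k] {Φ : MvPolynomial (Fin 4) k →ₗ[k] k}
    {L : MvPolynomial (Fin 4) k →ₗ[k] MvPolynomial (Fin 4) k}
    {v r : Fin 4 → MvPolynomial (Fin 4) k}

theorem smul_hom {n : ℕ} (c : k) {p : MvPolynomial (Fin 4) k} (hp : p.IsHomogeneous n) :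
    (c • p).IsHomogeneous n := by
  rw [smul_eq_C_mul]; simpa using (isHomogeneous_C _ c).mul hp

theorem smul_memI (H : Ideal (MvPolynomial (Fin 4) k)) (c : k) {p : MvPolynomial (Fin 4) k}
    (hp : p ∈ H) : c • p ∈ H := by
  rw [smul_eq_C_mul]; exact H.mul_mem_left _ hp

theorem smul_memI_iff (H : Ideal (MvPolynomial (Fin 4) k)) {c : k} (hc : c ≠ 0)
    {p : MvPolynomial (Fin 4) k} (hp : c • p ∈ H) : p ∈ H := by
  have := smul_memI H c⁻¹ hp
  rwa [smul_smul, inv_mul_cancel₀ hc, one_smul] at this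

theorem InvSys.hann (I : InvSys Φ L) {q : MvPolynomial (Fin 4) k} (hq : q.IsHomogeneous 2)
    (g : MvPolynomial (Fin 4) k) : Φ ((q - X 0 * L q) * g) = 0 := by
  have h2 : (q - X 0 * L q).IsHomogeneous 2 := hq.sub (hom1_X0.mul (I.L1 q))
  rw [← sum_homogeneousComponent g, Finset.mul_sum, map_sum]
  refine Finset.sum_eq_zero fun n _ => ?_
  have hn := homogeneousComponent_isHomogeneous n g
  by_cases h : n = 1
  · subst h
    rw [sub_mul, map_sub, I.hL _ _ hn, sub_self]
  · exact I.dg _ _ (by omega) (h2.mul hn)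

theorem LinFrame.q1 (F : LinFrame Φ v r) (H : Ideal (MvPolynomial (Fin 4) k))
    (hH : ∀ i j, v i * v j - X 0 * L (v i * v j) ∈ H) {u m : MvPolynomial (Fin 4) k}
    (hu : u.IsHomogeneous 1) (hm : m.IsHomogeneous 1) : u * m - X 0 * L (u * m) ∈ H := by
  have : u * m = ∑ i, ∑ j, (Φ (X 0 * u * r i) * Φ (X 0 * m * r j)) • (v i * v j) := by
    conv_lhs => rw [F.dec u hu, F.dec m hm]
    rw [Finset.sum_mul_sum]
    refine Finset.sum_congr rfl fun i _ => Finset.sum_congr rfl fun j _ => ?_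
    rw [smul_mul_smul_comm]
  rw [this]
  simp only [map_sum, map_smul, Finset.mul_sum, mul_smul_comm, ← Finset.sum_sub_distrib, ← smul_sub]
  exact Ideal.sum_mem _ fun i _ => Ideal.sum_mem _ fun j _ => smul_memI H _ (hH i j)

theorem LinFrame.q2 (F : LinFrame Φ v r) (I : InvSys Φ L) (H : Ideal (MvPolynomial (Fin 4) k))
    (hH : ∀ i j, v i * v j - X 0 * L (v i * v j) ∈ H) (u w t : Fin 4) :
    ∑ m, DD Φ L (v u) (v w) (v t) (v m) • (X 0 ^ 2 * r m) ∈ H := by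
  have h1 := F.q1 H hH (F.vh u) (I.L1 (v w * v t))
  have h2 := hH w t
  have h3 := F.q1 H hH (F.vh w) (I.L1 (v u * v t))
  have h4 := hH u t
  have e : ∑ m, DD Φ L (v u) (v w) (v t) (v m) • (X 0 ^ 2 * r m)
      = X 0 ^ 2 * (L (v u * L (v w * v t)) - L (v w * L (v u * v t))) := by
    rw [F.Keq I, Finset.mul_sum]; simp only [mul_smul_comm]
  rw [e]
  have := H.add_mem (H.sub_mem (H.sub_mem (H.mul_mem_left (v w) h4) (H.mul_mem_left (v u) h2))
    (H.mul_mem_left (X 0) h1)) (H.mul_mem_left (X 0) h3)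
  convert this using 1
  ring

theorem LinFrame.rdec (F : LinFrame Φ v r) (I : InvSys Φ L) {a : MvPolynomial (Fin 4) k}
    (ha : a.IsHomogeneous 1) : a = ∑ i, Φ (X 0 * a * v i) • r i := by
  rw [← sub_eq_zero]
  refine I.nd _ (ha.sub (IsHomogeneous.sum _ _ _ fun i _ => smul_hom _ (F.rh i))) fun b hb => ?_
  rw [mul_sub, sub_mul, map_sub, sub_eq_zero]
  conv_lhs => rw [F.dec b hb]
  simp only [Finset.mul_sum, Finset.sum_mul, map_sum, mul_smul_comm, smul_mul_assoc, map_smul,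
    smul_eq_mul]
  refine Finset.sum_congr rfl fun i _ => ?_
  rw [mul_comm, mul_right_comm (X 0) b]

theorem LinFrame.annle (F : LinFrame Φ v r) (I : InvSys Φ L) (H : Ideal (MvPolynomial (Fin 4) k))
    (hH : ∀ i j, v i * v j - X 0 * L (v i * v j) ∈ H)
    (hH' : ∀ h ∈ H, ∀ g, Φ (h * g) = 0) (a b c : k)
    (Saa : DD Φ L (v 2) (v 3) (v 2) (v 3) = a) (Sab : DD Φ L (v 2) (v 3) (v 3) (v 1) = b)
    (Sac : DD Φ L (v 2) (v 3) (v 1) (v 2) = 0) (Sba : DD Φ L (v 3) (v 1) (v 2) (v 3) = b)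
    (Sbb : DD Φ L (v 3) (v 1) (v 3) (v 1) = c)
    (hδ : a * c - b ^ 2 ≠ 0) (p : MvPolynomial (Fin 4) k) (hp : ∀ g, Φ (p * g) = 0) : p ∈ H := by
  have S0 : ∀ u w t, DD Φ L (v u) (v w) t (v 0) = 0 := fun u w t => by
    rw [F.v0]; exact I.DD_x (F.vh u) (F.vh w)
  have k1 := F.q2 I H hH 2 3 3
  have k2 := F.q2 I H hH 3 1 3
  have k3 := F.q2 I H hH 2 3 2
  have k4 := F.q2 I H hH 2 3 1
  simp only [Fin.sum_univ_four, S0, DD_self, DD_anti (v 2) (v 3) (v 3) (v 2),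
    DD_anti (v 3) (v 1) (v 3) (v 2), DD_anti (v 2) (v 3) (v 2) (v 1),
    DD_anti (v 2) (v 3) (v 1) (v 3), Saa, Sab, Sac, Sba, Sbb, zero_smul, neg_smul, neg_zero,
    add_zero, zero_add] at k1 k2 k3 k4
  have x1 : X 0 ^ 2 * r 1 ∈ H := smul_memI_iff H hδ (by
    have := H.sub_mem (smul_memI H a k2) (smul_memI H b k1)
    convert this using 1
    simp only [smul_eq_C_mul, map_sub, map_mul, map_pow]; ring)
  have x2 : X 0 ^ 2 * r 2 ∈ H := smul_memI_iff H hδ (by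
    have := H.sub_mem (smul_memI H b k2) (smul_memI H c k1)
    convert this using 1
    simp only [smul_eq_C_mul, map_sub, map_mul, map_pow]; ring)
  have x3 : X 0 ^ 2 * r 3 ∈ H := smul_memI_iff H hδ (by
    have := H.add_mem (smul_memI H c k3) (smul_memI H b k4)
    convert this using 1
    simp only [smul_eq_C_mul, map_sub, map_mul, map_pow]; ring)
  have q4 : ∀ m, m.IsHomogeneous 1 → X 0 ^ 2 * m - Φ (X 0 * m * X 0) • (X 0 ^ 2 * r 0) ∈ H := by
    intro m hm
    have e : X 0 ^ 2 * m - Φ (X 0 * m * X 0) • (X 0 ^ 2 * r 0)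
        = Φ (X 0 * m * v 1) • (X 0 ^ 2 * r 1) + Φ (X 0 * m * v 2) • (X 0 ^ 2 * r 2)
          + Φ (X 0 * m * v 3) • (X 0 ^ 2 * r 3) := by
      have h := F.rdec I hm
      rw [Fin.sum_univ_four, F.v0] at h
      conv_lhs => enter [1]; rw [h]
      simp only [smul_eq_C_mul]; ring
    rw [e]
    exact H.add_mem (H.add_mem (smul_memI H _ x1) (smul_memI H _ x2)) (smul_memI H _ x3)
  have x0 : X 0 ^ 3 * r 0 ∈ H := by
    have h1 := H.mul_mem_right (v 1) x1
    have h2 := H.mul_mem_left (X 0 ^ 2) (F.q1 H hH (F.vh 1) (F.rh 1))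
    have h3 := H.mul_mem_left (X 0) (q4 _ (I.L1 (v 1 * r 1)))
    have e : Φ (X 0 * L (v 1 * r 1) * X 0) = 1 := by
      rw [I.hL _ _ hom1_X0, mul_comm, ← mul_assoc, F.dual]; simp
    rw [e, one_smul] at h3
    convert H.sub_mem (H.sub_mem h1 h2) h3 using 1
    ring
  have q5 : ∀ m, m.IsHomogeneous 1 → X 0 ^ 3 * m ∈ H := by
    intro m hm
    have := H.add_mem (H.mul_mem_left (X 0) (q4 m hm)) (smul_memI H (Φ (X 0 * m * X 0)) x0)
    convert this using 1
    simp only [smul_eq_C_mul]; ring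
  have N : ∃ (c c' : k) (m m' : MvPolynomial (Fin 4) k), m.IsHomogeneous 1 ∧ m'.IsHomogeneous 1 ∧
      p - (C c + m + X 0 * m' + C c' * (X 0 ^ 2 * r 0)) ∈ H := by
    clear hp
    induction p using MvPolynomial.induction_on with
    | C c => exact ⟨c, 0, 0, 0, isHomogeneous_zero _ _ _, isHomogeneous_zero _ _ _, by simp⟩
    | add p q hp hq =>
      obtain ⟨c1, c1', m1, m1', hm1, hm1', h1⟩ := hp
      obtain ⟨c2, c2', m2, m2', hm2, hm2', h2⟩ := hq
      refine ⟨c1 + c2, c1' + c2', m1 + m2, m1' + m2', hm1.add hm2, hm1'.add hm2', ?_⟩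
      convert H.add_mem h1 h2 using 1
      simp only [map_add]; ring
    | mul_X p i hp =>
      obtain ⟨c, c', m, m', hm, hm', h⟩ := hp
      have hX : (X i : MvPolynomial (Fin 4) k).IsHomogeneous 1 := isHomogeneous_X _ _
      refine ⟨0, Φ (X 0 * L (X i * m') * X 0), c • X i, L (X i * m), smul_hom c hX, I.L1 _, ?_⟩
      have t1 := F.q1 H hH hX hm
      have t2 := H.mul_mem_left (X 0) (F.q1 H hH hX hm')
      have t3 := q4 _ (I.L1 (X i * m'))
      have t4 := H.mul_mem_left (C c' * X 0 ^ 2) (F.q1 H hH hX (F.rh 0))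
      have t5 := H.mul_mem_left (C c') (q5 _ (I.L1 (X i * r 0)))
      convert H.add_mem (H.add_mem (H.add_mem (H.add_mem (H.add_mem
        (H.mul_mem_left (X i) h) t1) t2) t3) t4) t5 using 1
      simp only [map_zero, smul_eq_C_mul]; ring
  obtain ⟨c0, c1, m, m', hm, hm', h⟩ := N
  have hq : ∀ g, Φ (C c0 * g) + Φ (m * g) + Φ (X 0 * m' * g) + Φ (C c1 * (X 0 ^ 2 * r 0) * g) = 0 := by
    intro g
    have := hH' _ h g
    rw [sub_mul, map_sub, hp, zero_sub, neg_eq_zero, add_mul, add_mul, add_mul, map_add, map_add,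
      map_add] at this
    exact this
  have hxr : (X 0 ^ 2 * r 0).IsHomogeneous 3 := by
    simpa using (hom1_X0.pow 2).mul (F.rh 0)
  have hx2 : (C c1 * (X 0 ^ 2 * r 0)).IsHomogeneous 3 := by
    simpa using (isHomogeneous_C _ c1).mul hxr
  have h00 : Φ (X 0 ^ 2 * r 0) = 1 := by
    have := F.dual 0 0
    rw [F.v0] at this
    rw [pow_two]; simpa using this
  have Cc : ∀ (c : k) g, Φ (C c * g) = c * Φ g := fun c g => by
    rw [← smul_eq_C_mul, map_smul, smul_eq_mul]
  have z0 : c0 = 0 := by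
    have := hq (X 0 ^ 2 * r 0)
    rw [I.dg _ _ (by norm_num) (hm.mul hxr),
      I.dg _ _ (by norm_num) ((hom1_X0.mul hm').mul hxr),
      I.dg _ _ (by norm_num) (hx2.mul hxr), Cc, h00] at this
    simpa using this
  have zm : m = 0 := I.nd m hm fun u hu => by
    have := hq (X 0 * u)
    rw [z0, I.dg _ _ (by norm_num) ((hom1_X0.mul hm').mul (hom1_X0.mul hu)),
      I.dg _ _ (by norm_num) (hx2.mul (hom1_X0.mul hu))] at this
    rw [mul_right_comm, mul_comm]
    simpa using this
  have zm' : m' = 0 := I.nd m' hm' fun u hu => by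
    have := hq u
    rw [z0, zm, I.dg _ _ (by norm_num) (hx2.mul hu)] at this
    simpa using this
  have zc : c1 = 0 := by
    have := hq 1
    rw [z0, zm, zm', mul_one (C c1 * _), Cc c1, h00] at this
    simpa using this
  rw [z0, zm, zm', zc] at h
  simpa using h

end Ann

section Fin
variable {k : Type*} [Field k] {Φ : MvPolynomial (Fin 4) k →ₗ[k] k}
    {L : MvPolynomial (Fin 4) k →ₗ[k] MvPolynomial (Fin 4) k}
    {v r : Fin 4 → MvPolynomial (Fin 4) k}

/-- upper entries of the presentation matrix -/
noncomputable def entV (v : Fin 4 → MvPolynomial (Fin 4) k) (lm : Fin 4 → Fin 4 → Fin 4 → k) (a b c d : k) :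
    Fin 10 → MvPolynomial (Fin 4) k :=
  ![C d * v 3 + v 0 * (C d * C (lm 2 3 2) - C d * C (lm 3 3 3) + C a * C (lm 1 1 3) + C b * C (lm 1 2 3)),
    C a * v 2 + v 0 * (-C a * C (lm 1 2 1) - C b * C (lm 2 2 1)),
    -C a * v 1 + C b * v 2 + v 0 * (-C d * C (lm 3 3 1) + C a * C (lm 1 1 1) - C a * C (lm 1 2 2) + C b * C (lm 1 2 1) - C b * C (lm 2 2 2)),
    -C b * v 1 + v 0 * (-C d * C (lm 3 3 2) + C a * C (lm 1 1 2) + C b * C (lm 1 2 2)),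
    C b * v 2 + v 0 * (C d * C (lm 3 3 1) - C b * C (lm 1 2 1) - C c * C (lm 2 2 1)),
    -C b * v 1 + C c * v 2 + v 0 * (C d * C (lm 3 3 2) + C b * C (lm 1 1 1) - C b * C (lm 1 2 2) + C c * C (lm 1 2 1) - C c * C (lm 2 2 2)),
    -C c * v 1 + v 0 * (C b * C (lm 1 1 2) + C c * C (lm 1 2 2)),
    C a * v 3 + v 0 * (-C a * C (lm 1 3 1) - C b * C (lm 2 3 1)),
    C b * v 3 + v 0 * (-C a * C (lm 1 3 2) - C b * C (lm 2 3 2)),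
    C c * v 3 + v 0 * (-C b * C (lm 1 3 2) - C c * C (lm 2 3 2))]

theorem pf_poly (v : Fin 4 → MvPolynomial (Fin 4) k)
    (lm : Fin 4 → Fin 4 → Fin 4 → k) (S : Fin 4 → Fin 4 → Fin 4 → Fin 4 → k)
    (R : Fin 4 → Fin 4 → k)
    (lsym : ∀ i j n, lm i j n = lm j i n) (l0 : ∀ j n, lm 0 j n = if j = n then 1 else 0)
    (Rs : ∀ i j, R i j = R j i)
    (S0 : ∀ u w t, S u w t 0 = 0) (Sd : ∀ u w t, S u w t t = 0) (Sa : ∀ u w t m, S u w t m = - S u w m t)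
    (relK : ∀ u w t n, ∑ i, lm w t i * lm u i n - ∑ i, lm u t i * lm w i n = ∑ m, S u w t m * R m n)
    (rel1 : ∀ t, ∑ m, lm 3 t m * S 1 2 t m + ∑ m, lm 1 t m * S 2 3 t m + ∑ m, lm 2 t m * S 3 1 t m = 0)
    (rel2 : ∀ t s, ∑ m, (lm 3 s m * S 1 2 t m + lm 3 t m * S 1 2 s m)
      + ∑ m, (lm 1 s m * S 2 3 t m + lm 1 t m * S 2 3 s m)
      + ∑ m, (lm 2 s m * S 3 1 t m + lm 2 t m * S 3 1 s m) = 0)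
    (a b c d : k) (Saa : S 2 3 2 3 = a) (Sab : S 2 3 3 1 = b) (Sac : S 2 3 1 2 = 0)
    (Sba : S 3 1 2 3 = b) (Sbb : S 3 1 3 1 = c) (Sbc : S 3 1 1 2 = 0)
    (Sca : S 1 2 2 3 = 0) (Scb : S 1 2 3 1 = 0) (Scc : S 1 2 1 2 = d)
    (h : Fin 4 → Fin 4 → MvPolynomial (Fin 4) k)
    (hh : ∀ i j, h i j = v i * v j - v 0 * ∑ n, lm i j n • v n) :
    pfV (entV v lm a b c d) 0 = -((a * c - b ^ 2) • h 1 3) ∧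
    pfV (entV v lm a b c d) 1 = -((a * c - b ^ 2) • h 2 3) ∧
    pfV (entV v lm a b c d) 2 = -((a * c - b ^ 2) • h 1 1 - (c * d) • h 3 3) ∧
    pfV (entV v lm a b c d) 3 = -((a * c - b ^ 2) • h 1 2 + (b * d) • h 3 3) ∧
    pfV (entV v lm a b c d) 4 = -((a * c - b ^ 2) • h 2 2 - (a * d) • h 3 3) := by
  have H := sc_rel lm S R lsym l0 Rs S0 Sd Sa relK rel1 rel2 a b c d Saa Sab Sac Sba Sbb Sbc Sca Scb Scc
  have G : ∀ s : k, s = 0 → (C s : MvPolynomial (Fin 4) k) = 0 := fun s hs => by rw [hs, map_zero]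
  obtain ⟨L11, L12, L13, L22, L23, L33, K212, K112, K332, K122, K222, K331, K132, K312, K232, K311, K322, K131, K321, K231⟩ := H
  have P := pf_ident (v 0) (v 1) (v 2) (v 3) (C a) (C b) (C c) (C d) (C (lm 1 1 1)) (C (lm 1 1 2)) (C (lm 1 1 3)) (C (lm 1 2 1)) (C (lm 1 2 2)) (C (lm 1 2 3)) (C (lm 1 3 1)) (C (lm 1 3 2)) (C (lm 1 3 3)) (C (lm 2 2 1)) (C (lm 2 2 2)) (C (lm 2 2 3)) (C (lm 2 3 1)) (C (lm 2 3 2)) (C (lm 2 3 3)) (C (lm 3 3 1)) (C (lm 3 3 2)) (C (lm 3 3 3)) (C (lm 1 1 0)) (C (lm 1 2 0)) (C (lm 1 3 0)) (C (lm 2 2 0)) (C (lm 2 3 0)) (C (lm 3 3 0)) (C (R 1 1)) (C (R 1 2)) (C (R 1 3)) (C (R 2 2)) (C (R 2 3)) (C (R 3 3))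
    (by simpa using G _ L11)
    (by simpa using G _ L12)
    (by simpa using G _ L13)
    (by simpa using G _ L22)
    (by simpa using G _ L23)
    (by simpa using G _ L33)
    (by simpa using G _ K212)
    (by simpa using G _ K112)
    (by simpa using G _ K332)
    (by simpa using G _ K122)
    (by simpa using G _ K222)
    (by simpa using G _ K331)
    (by simpa using G _ K132)
    (by simpa using G _ K312)
    (by simpa using G _ K232)
    (by simpa using G _ K311)
    (by simpa using G _ K322)
    (by simpa using G _ K131)
    (by simpa using G _ K321)
    (by simpa using G _ K231)
  simp only [hh, Fin.sum_univ_four, smul_eq_C_mul, map_sub, map_mul, map_pow]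
  refine ⟨P.1, congrArg Neg.neg P.2.1, P.2.2.1, congrArg Neg.neg P.2.2.2.1, P.2.2.2.2⟩

theorem entV_hom (hv : ∀ i, (v i).IsHomogeneous 1) (lm : Fin 4 → Fin 4 → Fin 4 → k) (a b c d : k)
    (i : Fin 10) : (entV v lm a b c d i).IsHomogeneous 1 := by
  have hC : ∀ (s : k) j, (C s * v j).IsHomogeneous 1 := fun s j => by
    simpa using (isHomogeneous_C _ s).mul (hv j)
  have hx : ∀ s : k, (v 0 * C s).IsHomogeneous 1 := fun s => by
    rw [mul_comm]; exact hC s 0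
  have h2 : ∀ (s : k) j (t : k), (C s * v j + v 0 * C t).IsHomogeneous 1 := fun s j t =>
    (hC s j).add (hx t)
  have h3 : ∀ (s : k) j (s' : k) j' (t : k), (C s * v j + C s' * v j' + v 0 * C t).IsHomogeneous 1 :=
    fun s j s' j' t => ((hC s j).add (hC s' j')).add (hx t)
  fin_cases i <;>
  simp only [entV, Fin.zero_eta, Fin.mk_one, Fin.reduceFinMk, Matrix.cons_val, ← C_mul, ← C_neg,
      ← C_add, ← C_sub]
  exacts [h2 _ _ _, h2 _ _ _, h3 _ _ _ _ _, h2 _ _ _, h2 _ _ _, h3 _ _ _ _ _, h2 _ _ _, h2 _ _ _,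
    h2 _ _ _, h2 _ _ _]

end Fin

section FM
variable {k : Type*} [Field k] {Φ : MvPolynomial (Fin 4) k →ₗ[k] k}
    {L : MvPolynomial (Fin 4) k →ₗ[k] MvPolynomial (Fin 4) k}
    {v r : Fin 4 → MvPolynomial (Fin 4) k}

theorem frame_main (I : InvSys Φ L) (F : LinFrame Φ v r)
    (θ : MvPolynomial (Fin 4) k ≃ₐ[k] MvPolynomial (Fin 4) k)
    (θ0 : θ (X 0) = v 3) (θ1 : θ (X 1) = X 0) (θ2 : θ (X 2) = v 1) (θ3 : θ (X 3) = v 2)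
    (Sac : DD Φ L (v 2) (v 3) (v 1) (v 2) = 0) (Sbc : DD Φ L (v 3) (v 1) (v 1) (v 2) = 0)
    (hδ : DD Φ L (v 2) (v 3) (v 2) (v 3) * DD Φ L (v 3) (v 1) (v 3) (v 1)
      - DD Φ L (v 2) (v 3) (v 3) (v 1) ^ 2 ≠ 0) :
    ∃ (g : Fin 5 → MvPolynomial (Fin 4) k) (f : MvPolynomial (Fin 4) k)
      (M : Matrix (Fin 5) (Fin 5) (MvPolynomial (Fin 4) k)),
      (∀ i, (g i).IsHomogeneous 2) ∧ f.IsHomogeneous 2 ∧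
        (∀ i j, (M i j).IsHomogeneous 1) ∧
        Matrix.transpose M = -M ∧ (∀ i, M i i = 0) ∧
        annIdeal k Φ = Ideal.span (Set.range g) + Ideal.span {f} ∧
        (Ideal.span (Set.range g)).colon (Ideal.span {f}) = Ideal.span (Set.range g) ∧
        Function.Injective (colMap g) ∧
        LinearMap.range (colMap g) = LinearMap.ker M.mulVecLin ∧
        LinearMap.range M.mulVecLin = LinearMap.ker (rowMap g) := by
  obtain ⟨a, Saa⟩ : ∃ a, DD Φ L (v 2) (v 3) (v 2) (v 3) = a := ⟨_, rfl⟩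
  obtain ⟨b, Sab⟩ : ∃ a, DD Φ L (v 2) (v 3) (v 3) (v 1) = a := ⟨_, rfl⟩
  obtain ⟨c, Sbb⟩ : ∃ a, DD Φ L (v 3) (v 1) (v 3) (v 1) = a := ⟨_, rfl⟩
  obtain ⟨d, Scc⟩ : ∃ a, DD Φ L (v 1) (v 2) (v 1) (v 2) = a := ⟨_, rfl⟩
  have Sba : DD Φ L (v 3) (v 1) (v 2) (v 3) = b := by rw [I.DD_sym, Sab]
  have Sca : DD Φ L (v 1) (v 2) (v 2) (v 3) = 0 := by rw [I.DD_sym, Sac]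
  have Scb : DD Φ L (v 1) (v 2) (v 3) (v 1) = 0 := by rw [I.DD_sym, Sbc]
  rw [Saa, Sab, Sbb] at hδ
  set lm : Fin 4 → Fin 4 → Fin 4 → k := fun i j n => Φ (v i * v j * r n) with hlm
  set h : Fin 4 → Fin 4 → MvPolynomial (Fin 4) k := fun i j => v i * v j - X 0 * L (v i * v j) with hh
  have hh2 : ∀ i j, (h i j).IsHomogeneous 2 := fun i j =>
    ((F.vh i).mul (F.vh j)).sub (hom1_X0.mul (I.L1 _))
  obtain ⟨p0, p1, p2, p3, p4⟩ := pf_poly v lm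
    (fun u w t m => DD Φ L (v u) (v w) (v t) (v m)) (fun m n => Φ (X 0 * r m * r n))
    (fun i j n => by simp only [hlm]; rw [mul_comm (v i)])
    (fun j n => by simp only [hlm]; rw [F.v0]; exact F.dual j n)
    (fun i j => by rw [mul_right_comm])
    (fun u w t => by rw [F.v0]; exact I.DD_x (F.vh u) (F.vh w))
    (fun u w t => DD_self _ _ _) (fun u w t m => DD_anti _ _ _ _)
    (fun u w t n => F.relK I u w t n)
    (fun t => by
      have := I.rel1' v (v t)
      simpa only [F.DL I] using this)
    (fun t s => by
      have := I.rel2' v (v t) (v s)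
      simpa only [F.DL I, ← Finset.sum_add_distrib] using this)
    a b c d Saa Sab Sac Sba Sbb Sbc Sca Scb Scc h (fun i j => by
      simp only [hh, hlm]; rw [F.Ldec I, F.v0])
  set e := entV v lm a b c d with he
  have ehom : ∀ i, (e i).IsHomogeneous 1 := entV_hom F.vh lm a b c d
  have hann : ∀ i j, h i j ∈ annIdeal k Φ := fun i j g => I.hann ((F.vh i).mul (F.vh j)) g
  have annC : ∀ (s : k) i j, s • h i j ∈ annIdeal k Φ := fun s i j => smul_memI _ s (hann i j)
  have hle : Ideal.span (Set.range (pfV e)) ⊔ Ideal.span {h 3 3} ≤ annIdeal k Φ := by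
    refine sup_le (Ideal.span_le.2 ?_) (Ideal.span_le.2 ?_)
    · rintro _ ⟨i, rfl⟩
      fin_cases i
      · exact p0 ▸ neg_mem (annC _ _ _)
      · exact p1 ▸ neg_mem (annC _ _ _)
      · exact p2 ▸ neg_mem (sub_mem (annC _ _ _) (annC _ _ _))
      · exact p3 ▸ neg_mem (add_mem (annC _ _ _) (annC _ _ _))
      · exact p4 ▸ neg_mem (sub_mem (annC _ _ _) (annC _ _ _))
    · rintro _ rfl
      exact hann 3 3
  set H := Ideal.span (Set.range (pfV e)) ⊔ Ideal.span {h 3 3} with hH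
  have hg : ∀ i, pfV e i ∈ H := fun i =>
    Ideal.mem_sup_left (Ideal.subset_span ⟨i, rfl⟩)
  have h33 : h 3 3 ∈ H := Ideal.mem_sup_right (Ideal.subset_span rfl)
  have h13 : h 1 3 ∈ H := smul_memI_iff H hδ (by
    have := neg_mem (hg 0)
    rwa [p0, neg_neg] at this)
  have h23 : h 2 3 ∈ H := smul_memI_iff H hδ (by
    have := neg_mem (hg 1)
    rwa [p1, neg_neg] at this)
  have h11 : h 1 1 ∈ H := smul_memI_iff H hδ (by
    have := neg_mem (hg 2)
    rw [p2, neg_neg] at this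
    simpa using add_mem this (smul_memI H (c * d) h33))
  have h12 : h 1 2 ∈ H := smul_memI_iff H hδ (by
    have := neg_mem (hg 3)
    rw [p3, neg_neg] at this
    simpa using sub_mem this (smul_memI H (b * d) h33))
  have h22 : h 2 2 ∈ H := smul_memI_iff H hδ (by
    have := neg_mem (hg 4)
    rw [p4, neg_neg] at this
    simpa using add_mem this (smul_memI H (a * d) h33))
  have hs : ∀ i j, h i j = h j i := fun i j => by simp only [hh]; rw [mul_comm (v i)]
  have h0 : ∀ j, h 0 j ∈ H := fun j => by
    have : h 0 j = 0 := by
      simp only [hh]; rw [F.v0, I.Lx _ (F.vh j), sub_self]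
    rw [this]; exact H.zero_mem
  have hall : ∀ i j, h i j ∈ H := by
    intro i j
    fin_cases i
    · exact h0 j
    · fin_cases j
      · exact hs 1 0 ▸ h0 1
      · exact h11
      · exact h12
      · exact h13
    · fin_cases j
      · exact hs 2 0 ▸ h0 2
      · exact hs 2 1 ▸ h12
      · exact h22
      · exact h23
    · fin_cases j
      · exact hs 3 0 ▸ h0 3
      · exact hs 3 1 ▸ h13
      · exact hs 3 2 ▸ h23
      · exact h33
  have hA : annIdeal k Φ = H := le_antisymm
    (fun p hp => F.annle I H hall (fun q hq => hle hq) a b c Saa Sab Sac Sba Sbb hδ p hp) hle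
  have hmon : (finSuccEquiv k 3 (θ.symm (h 3 3))).Monic := by
    have : h 3 3 = θ (X 0 ^ 2 - X 1 * (C (lm 3 3 0) * X 1 + C (lm 3 3 1) * X 2 + C (lm 3 3 2) * X 3
        + C (lm 3 3 3) * X 0)) := by
      have hC : ∀ s : k, θ (C s) = C s := fun s => by
        simpa only [algebraMap_eq] using θ.commutes s
      simp only [map_sub, map_mul, map_add, map_pow, θ0, θ1, θ2, θ3, hC]
      simp only [hh]; rw [F.Ldec I, Fin.sum_univ_four, F.v0]
      simp only [smul_eq_C_mul, hlm]
      ring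
    rw [this, AlgEquiv.symm_apply_apply]
    exact mv_monic _ _ _ _
  have hX : ∀ i : Fin 3, (θ (X i.succ)).IsHomogeneous 1 := by
    intro i
    fin_cases i
    · exact θ1 ▸ hom1_X0
    · exact θ2 ▸ F.vh 1
    · exact θ3 ▸ F.vh 2
  have hpow : ∀ i : Fin 3, (θ (X i.succ)) ^ 4 ∈ H := by
    intro i
    rw [← hA]
    intro g
    have h4 : ((θ (X i.succ)) ^ 4).IsHomogeneous 4 := by simpa using (hX i).pow 4
    rw [← sum_homogeneousComponent g, Finset.mul_sum, map_sum]
    exact Finset.sum_eq_zero fun n _ =>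
      I.dg _ _ (by omega) (h4.mul (homogeneousComponent_isHomogeneous n g))
  obtain ⟨m1, m2, m3, m4⟩ := hom_main e ehom (h 3 3) (hh2 3 3) θ hmon hpow
  refine ⟨pfV e, h 3 3, altM e, pfV_hom e ehom, hh2 3 3, altM_hom e ehom, ?_, ?_, hA, ?_, ?_, ?_, ?_⟩
  · ext i j
    fin_cases i <;> fin_cases j <;> simp [altM]
  · intro i
    fin_cases i <;> simp [altM]
  · ext p
    rw [Submodule.mem_colon]
    constructor
    · intro hp
      exact m1 p (hp _ (Ideal.mem_span_singleton_self _))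
    · intro hp q _
      exact Ideal.mul_mem_right _ _ hp
  · rw [injective_iff_map_eq_zero]
    intro t ht
    exact m2 t fun i => congrFun ht i
  · ext w
    rw [LinearMap.mem_range, LinearMap.mem_ker, Matrix.mulVecLin_apply]
    constructor
    · rintro ⟨t, rfl⟩
      have : colMap (pfV e) t = t • pfV e := by
        funext j; simp [colMap, mul_comm]
      rw [this, Matrix.mulVec_smul]
      funext j; simp [altM_pfV]
    · intro hw
      obtain ⟨t, ht⟩ := m3 w hw
      exact ⟨t, funext fun j => (ht j).symm⟩
  · ext w
    rw [LinearMap.mem_range, LinearMap.mem_ker]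
    constructor
    · rintro ⟨t, rfl⟩
      exact pfV_altM e t
    · intro hw
      obtain ⟨u, hu⟩ := m4 w hw
      exact ⟨u, hu.symm⟩
end FM

section Fin10

theorem rank_le_one_of_minors {k : Type*} [Field k] (M : Matrix (Fin 3) (Fin 3) k)
    (h : ∀ i j i' j', M i j * M i' j' = M i j' * M i' j) : M.rank ≤ 1 := by
  by_cases h0 : ∃ i j, M i j ≠ 0
  · obtain ⟨i, j, hij⟩ := h0
    have : M = Matrix.vecMulVec (fun a => M a j) (fun b => M i b / M i j) := by
      ext a b
      rw [Matrix.vecMulVec_apply]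
      field_simp
      linear_combination h i j a b
    rw [this]
    exact Matrix.rank_vecMulVec_le _ _
  · push Not at h0
    have : M = 0 := by ext a b; exact h0 a b
    rw [this, Matrix.rank_zero]; exact Nat.zero_le _

theorem sym_rank {k : Type*} [Field k] (M : Matrix (Fin 3) (Fin 3) k) (a b c d e f : k)
    (h00 : M 0 0 = a) (h01 : M 0 1 = b) (h02 : M 0 2 = c) (h10 : M 1 0 = b) (h11 : M 1 1 = d)
    (h12 : M 1 2 = e) (h20 : M 2 0 = c) (h21 : M 2 1 = e) (h22 : M 2 2 = f)
    (hr : 2 ≤ M.rank) (k1 : a * d - b ^ 2 = 0) (k2 : d * f - e ^ 2 = 0) (k3 : f * a - c ^ 2 = 0)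
    (k4 : (d - 2 * b + a) * f - (e - c) ^ 2 = 0) : False := by
  have q : 2 * (c * e - b * f) = 0 := by linear_combination k4 - k2 - k3
  have dz : (a * (d * f - e ^ 2) - b * (b * f - c * e) + c * (b * e - c * d)) ^ 2 = 0 := by
    have e1 : (a * (d * f - e ^ 2) - b * (b * f - c * e) + c * (b * e - c * d)) ^ 2
      = (d * f - e ^ 2) * ((f * a - c ^ 2) * (a * d - b ^ 2) - (b * c - a * e) ^ 2)
        - (c * e - b * f) * ((c * e - b * f) * (a * d - b ^ 2) - (b * c - a * e) * (b * e - c * d))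
        + (b * e - c * d) * ((c * e - b * f) * (b * c - a * e) - (b * e - c * d) * (f * a - c ^ 2)) := by
      ring
    rw [e1, k1, k2, k3]
    linear_combination (b * c - a * e) * (b * e - c * d) * q
  have dz' : a * (d * f - e ^ 2) - b * (b * f - c * e) + c * (b * e - c * d) = 0 := by
    simpa using dz
  have m1 : c * e - b * f = 0 := by
    have : (c * e - b * f) ^ 2 = 0 := by
      linear_combination (f * a - c ^ 2) * k2 - f * dz'
    simpa using this
  have m2 : b * e - c * d = 0 := by
    have : (b * e - c * d) ^ 2 = 0 := by
      linear_combination (a * d - b ^ 2) * k2 - d * dz'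
    simpa using this
  have m3 : b * c - a * e = 0 := by
    have : (b * c - a * e) ^ 2 = 0 := by
      linear_combination (a * d - b ^ 2) * k3 - a * dz'
    simpa using this
  have := rank_le_one_of_minors M (by
    intro i j i' j'
    fin_cases i <;> fin_cases j <;> fin_cases i' <;> fin_cases j' <;>
      simp only [Fin.zero_eta, Fin.mk_one, Fin.reduceFinMk, h00, h01, h02, h10, h11, h12, h20, h21, h22] <;>
      grind)
  omega

variable {k : Type*} [Field k]

/-- equivalence from mutually inverse substitutions -/
noncomputable def mkE (f g : Fin 4 → MvPolynomial (Fin 4) k) (h1 : ∀ i, aeval g (f i) = X i)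
    (h2 : ∀ i, aeval f (g i) = X i) : MvPolynomial (Fin 4) k ≃ₐ[k] MvPolynomial (Fin 4) k :=
  AlgEquiv.ofAlgHom (aeval f) (aeval g)
    (by ext1 i; rw [AlgHom.comp_apply, aeval_X, h2]; rfl) (by ext1 i; rw [AlgHom.comp_apply, aeval_X, h1]; rfl)

theorem lin_expand (a : MvPolynomial (Fin 4) k) (ha : a.IsHomogeneous 1) :
    a = ∑ i, coeff (Finsupp.single i 1) a • X i := by
  have h : a ∈ homogeneousSubmodule (Fin 4) k 1 := ha
  have h' : a ∈ Submodule.span k (Set.range (X : Fin 4 → MvPolynomial (Fin 4) k)) := by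
    rwa [← homogeneousSubmodule_one_eq_span_X]
  clear ha h
  induction h' using Submodule.span_induction with
  | mem x hx =>
    obtain ⟨j, rfl⟩ := hx
    rw [Finset.sum_eq_single j]
    · simp
    · intro b _ hb
      rw [coeff_X, if_neg, zero_smul]
      intro h
      exact hb ((Finsupp.single_left_inj one_ne_zero).1 h).symm
    · simp
  | zero => simp
  | add x y _ _ hx hy =>
    conv_lhs => rw [hx, hy]
    simp [add_smul, Finset.sum_add_distrib]
  | smul c x _ hx =>
    conv_lhs => rw [hx]
    simp [Finset.smul_sum, smul_smul]

theorem alg_hom1 (θ : MvPolynomial (Fin 4) k →ₐ[k] MvPolynomial (Fin 4) k)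
    (h : ∀ i, (θ (X i)).IsHomogeneous 1) (a : MvPolynomial (Fin 4) k) (ha : a.IsHomogeneous 1) :
    (θ a).IsHomogeneous 1 := by
  rw [lin_expand a ha, map_sum]
  exact IsHomogeneous.sum _ _ _ fun i _ => by
    rw [map_smul, smul_eq_C_mul]; simpa using (isHomogeneous_C _ _).mul (h i)

variable {Φ : MvPolynomial (Fin 4) k →ₗ[k] k}
    {L : MvPolynomial (Fin 4) k →ₗ[k] MvPolynomial (Fin 4) k}

theorem mk_frame (hs : ∀ l : MvPolynomial (Fin 4) k →ₗ[k] k, ∃ r : MvPolynomial (Fin 4) k,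
      r.IsHomogeneous 1 ∧ ∀ a, a.IsHomogeneous 1 → Φ (X 0 * a * r) = l a)
    (θ : MvPolynomial (Fin 4) k ≃ₐ[k] MvPolynomial (Fin 4) k)
    (h1 : ∀ i, (θ (X i)).IsHomogeneous 1) (h2 : ∀ i, (θ.symm (X i)).IsHomogeneous 1)
    (θ1 : θ (X 1) = X 0) :
    ∃ r, LinFrame Φ ![X 0, θ (X 2), θ (X 3), θ (X 0)] r := by
  have H : ∀ i : Fin 4, ∃ r : MvPolynomial (Fin 4) k,
      r.IsHomogeneous 1 ∧ ∀ a, a.IsHomogeneous 1 →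
        Φ (X 0 * a * r) = coeff (Finsupp.single i 1) (θ.symm a) := fun i => by
    obtain ⟨r, hr, hr'⟩ := hs ((lcoeff k (Finsupp.single i 1)).comp θ.symm.toLinearMap)
    exact ⟨r, hr, fun a ha => by rw [hr' a ha]; rfl⟩
  choose r hr hr' using H
  have vh : ∀ i, ((![X 0, θ (X 2), θ (X 3), θ (X 0)] : Fin 4 → MvPolynomial (Fin 4) k) i).IsHomogeneous 1 := by
    intro i; fin_cases i
    · exact hom1_X0
    · exact h1 2
    · exact h1 3
    · exact h1 0
  refine ⟨![r 1, r 2, r 3, r 0], rfl, vh, ?_, ?_, ?_⟩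
  · intro i; fin_cases i
    · exact hr 1
    · exact hr 2
    · exact hr 3
    · exact hr 0
  · have key : ∀ i j, Φ (X 0 * θ (X i) * r j) = if i = j then 1 else 0 := fun i j => by
      rw [hr' j _ (h1 i), AlgEquiv.symm_apply_apply, coeff_X]
      simp only [Finsupp.single_left_inj one_ne_zero]
    intro i j
    have hv : ∀ i : Fin 4, (![X 0, θ (X 2), θ (X 3), θ (X 0)] : Fin 4 → MvPolynomial (Fin 4) k) i
        = θ (X (![1, 2, 3, 0] i)) := by
      intro i; fin_cases i
      · exact θ1.symm
      · rfl
      · rfl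
      · rfl
    have hrr : ∀ i : Fin 4, (![r 1, r 2, r 3, r 0] : Fin 4 → MvPolynomial (Fin 4) k) i
        = r (![1, 2, 3, 0] i) := by
      intro i; fin_cases i <;> rfl
    rw [hv, hrr, key]
    have : ((![1, 2, 3, 0] : Fin 4 → Fin 4) i = (![1, 2, 3, 0] : Fin 4 → Fin 4) j) = (i = j) := by
      revert i j; decide
    simp only [this]
  · intro a ha
    have := congrArg θ (lin_expand _ (alg_hom1 θ.symm.toAlgHom h2 a ha))
    simp only [Fin.sum_univ_four, map_add, map_smul, θ1] at this
    have e : θ (θ.symm.toAlgHom a) = a := θ.apply_symm_apply a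
    rw [e] at this
    simp only [Fin.sum_univ_four]
    refine this.trans ?_
    have e0 := hr' 0 a ha
    have e1 := hr' 1 a ha
    have e2 := hr' 2 a ha
    have e3 := hr' 3 a ha
    change _ = Φ (X 0 * a * r 1) • X 0 + Φ (X 0 * a * r 2) • θ (X 2) + Φ (X 0 * a * r 3) • θ (X 3)
      + Φ (X 0 * a * r 0) • θ (X 0)
    rw [e0, e1, e2, e3]
    change coeff _ (θ.symm a) • _ + coeff _ (θ.symm a) • _ + coeff _ (θ.symm a) • _
      + coeff _ (θ.symm a) • _ = _
    abel

theorem shear_main (I : InvSys Φ L)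
    (hs : ∀ l : MvPolynomial (Fin 4) k →ₗ[k] k, ∃ r : MvPolynomial (Fin 4) k,
      r.IsHomogeneous 1 ∧ ∀ a, a.IsHomogeneous 1 → Φ (X 0 * a * r) = l a)
    (fv gv : Fin 4 → MvPolynomial (Fin 4) k) (e1 : ∀ i, aeval gv (fv i) = X i)
    (e2 : ∀ i, aeval fv (gv i) = X i)
    (h1 : ∀ i, (fv i).IsHomogeneous 1) (h2 : ∀ i, (gv i).IsHomogeneous 1)
    (f1 : fv 1 = X 0)
    (hδ : DD Φ L (fv 3) (fv 0) (fv 3) (fv 0) * DD Φ L (fv 0) (fv 2) (fv 0) (fv 2)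
      - DD Φ L (fv 3) (fv 0) (fv 0) (fv 2) ^ 2 ≠ 0) :
    ∃ (g : Fin 5 → MvPolynomial (Fin 4) k) (f : MvPolynomial (Fin 4) k)
      (M : Matrix (Fin 5) (Fin 5) (MvPolynomial (Fin 4) k)),
      (∀ i, (g i).IsHomogeneous 2) ∧ f.IsHomogeneous 2 ∧
        (∀ i j, (M i j).IsHomogeneous 1) ∧
        Matrix.transpose M = -M ∧ (∀ i, M i i = 0) ∧
        annIdeal k Φ = Ideal.span (Set.range g) + Ideal.span {f} ∧
        (Ideal.span (Set.range g)).colon (Ideal.span {f}) = Ideal.span (Set.range g) ∧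
        Function.Injective (colMap g) ∧
        LinearMap.range (colMap g) = LinearMap.ker M.mulVecLin ∧
        LinearMap.range M.mulVecLin = LinearMap.ker (rowMap g) := by
  obtain ⟨Y, hY⟩ : ∃ Y, Y = fv 2 := ⟨_, rfl⟩
  obtain ⟨Z, hZ⟩ : ∃ Y, Y = fv 3 := ⟨_, rfl⟩
  obtain ⟨W, hW⟩ : ∃ Y, Y = fv 0 := ⟨_, rfl⟩
  rw [← hY, ← hZ, ← hW] at hδ
  obtain ⟨a, ha⟩ : ∃ a, DD Φ L Z W Z W = a := ⟨_, rfl⟩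
  obtain ⟨b, hb⟩ : ∃ a, DD Φ L Z W W Y = a := ⟨_, rfl⟩
  obtain ⟨c, hc⟩ : ∃ a, DD Φ L W Y W Y = a := ⟨_, rfl⟩
  obtain ⟨d, hd⟩ : ∃ a, DD Φ L Z W Y Z = a := ⟨_, rfl⟩
  obtain ⟨e, he⟩ : ∃ a, DD Φ L W Y Y Z = a := ⟨_, rfl⟩
  rw [ha, hb, hc] at hδ
  have hb' : DD Φ L W Y Z W = b := by rw [I.DD_sym, hb]
  set c1 : k := (c * d - b * e) / (a * c - b ^ 2) with hc1
  set d2 : k := (a * e - b * d) / (a * c - b ^ 2) with hd2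
  have hw : (a * c - b ^ 2) * (a * c - b ^ 2)⁻¹ = 1 := mul_inv_cancel₀ hδ
  have q1 : d - c1 * a - d2 * b = 0 := by rw [hc1, hd2, div_eq_mul_inv, div_eq_mul_inv]; linear_combination -d * hw
  have q2 : e - c1 * b - d2 * c = 0 := by rw [hc1, hd2, div_eq_mul_inv, div_eq_mul_inv]; linear_combination -e * hw
  -- linearity in the second argument pair
  have l1 : ∀ u v, DD Φ L u v (Z + d2 • W) W = DD Φ L u v Z W := fun u v => by
    rw [DD_anti, DD_add, DD_smul, DD_self, DD_anti u v Z]; ring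
  have l2 : ∀ u v, DD Φ L u v W (Y + c1 • W) = DD Φ L u v W Y := fun u v => by
    rw [DD_add, DD_smul, DD_self]; ring
  have l3 : ∀ u v, DD Φ L u v (Y + c1 • W) (Z + d2 • W)
      = DD Φ L u v Y Z - c1 * DD Φ L u v Z W - d2 * DD Φ L u v W Y := fun u v => by
    rw [DD_add, DD_smul, DD_anti u v _ Z, DD_anti u v _ W, DD_add, DD_smul, DD_add, DD_smul, DD_self,
      DD_anti u v Z Y]; ring
  have r1 : ∀ t s, DD Φ L (Z + d2 • W) W t s = DD Φ L Z W t s := fun t s => by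
    rw [I.DD_sym, l1, I.DD_sym]
  have r2 : ∀ t s, DD Φ L W (Y + c1 • W) t s = DD Φ L W Y t s := fun t s => by
    rw [I.DD_sym, l2, I.DD_sym]
  have hsm : ∀ (s : k) (q : MvPolynomial (Fin 4) k), q.IsHomogeneous 1 → (s • q).IsHomogeneous 1 :=
    fun s q hq => by rw [smul_eq_C_mul]; simpa using (isHomogeneous_C _ _).mul hq
  let E := mkE fv gv e1 e2
  have E0 : E (X 0) = W := by rw [hW]; exact aeval_X _ _
  have E1 : E (X 1) = X 0 := by rw [← f1]; exact aeval_X _ _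
  have E2 : E (X 2) = Y := by rw [hY]; exact aeval_X _ _
  have E3 : E (X 3) = Z := by rw [hZ]; exact aeval_X _ _
  let S := mkE (k := k) ![X 0, X 1, X 2 + c1 • X 0, X 3 + d2 • X 0]
    ![X 0, X 1, X 2 - c1 • X 0, X 3 - d2 • X 0]
    (by intro i; fin_cases i <;> simp)
    (by intro i; fin_cases i <;> simp)
  have S0 : S (X 0) = X 0 := aeval_X _ _
  have S1 : S (X 1) = X 1 := aeval_X _ _
  have S2 : S (X 2) = X 2 + c1 • X 0 := aeval_X _ _
  have S3 : S (X 3) = X 3 + d2 • X 0 := aeval_X _ _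
  let θ := S.trans E
  have T0 : θ (X 0) = W := by change E (S (X 0)) = _; rw [S0, E0]
  have T1 : θ (X 1) = X 0 := by change E (S (X 1)) = _; rw [S1, E1]
  have T2 : θ (X 2) = Y + c1 • W := by
    change E (S (X 2)) = _; rw [S2, map_add, map_smul, E0, E2]
  have T3 : θ (X 3) = Z + d2 • W := by
    change E (S (X 3)) = _; rw [S3, map_add, map_smul, E0, E3]
  have hWh : W.IsHomogeneous 1 := hW ▸ h1 0
  have hYh : Y.IsHomogeneous 1 := hY ▸ h1 2
  have hZh : Z.IsHomogeneous 1 := hZ ▸ h1 3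
  have hX : ∀ i : Fin 4, (X i : MvPolynomial (Fin 4) k).IsHomogeneous 1 := isHomogeneous_X k
  obtain ⟨r, F⟩ := mk_frame hs θ (by
      intro i; fin_cases i
      · exact T0 ▸ hWh
      · exact T1 ▸ hX 0
      · exact T2 ▸ hYh.add (hsm _ _ hWh)
      · exact T3 ▸ hZh.add (hsm _ _ hWh))
    (by
      intro i
      change (S.symm (E.symm (X i))).IsHomogeneous 1
      refine alg_hom1 S.symm.toAlgHom (fun j => ?_) _ ?_
      · change MvPolynomial.IsHomogeneous (aeval _ (X j)) 1
        rw [aeval_X]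
        fin_cases j
        · exact hX 0
        · exact hX 1
        · exact (hX 2).sub (hsm _ _ (hX 0))
        · exact (hX 3).sub (hsm _ _ (hX 0))
      · change MvPolynomial.IsHomogeneous (aeval _ (X i)) 1
        rw [aeval_X]
        exact h2 i) T1
  refine frame_main I F θ rfl T1 rfl rfl ?_ ?_ ?_
  · change DD Φ L (θ (X 3)) (θ (X 0)) (θ (X 2)) (θ (X 3)) = 0
    rw [T0, T2, T3, r1, l3, hd, ha, hb, q1]
  · change DD Φ L (θ (X 0)) (θ (X 2)) (θ (X 2)) (θ (X 3)) = 0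
    rw [T0, T2, T3, r2, l3, he, hb', hc, q2]
  · change DD Φ L (θ (X 3)) (θ (X 0)) (θ (X 3)) (θ (X 0)) * DD Φ L (θ (X 0)) (θ (X 2)) (θ (X 0)) (θ (X 2))
      - DD Φ L (θ (X 3)) (θ (X 0)) (θ (X 0)) (θ (X 2)) ^ 2 ≠ 0
    rw [T0, T2, T3, r1, r2, l1, l2, r1, l2, ha, hb, hc]
    exact hδ

end Fin10

/-- **Theorems 13.1 and 13.2.**  Assume `Φ` is a degree-3 Macaulay inverse
system on `P = k[x,y,z,w]` whose annihilator contains no nonzero linear form,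
`p` is bijective, and the symmetric matrix `SM` has rank at least two.  Then
`P/ann Φ` is a hypersurface section of a codimension-three Gorenstein algebra:
there are quadrics `g₁, …, g₅, f` and an alternating `5 × 5` matrix `X` of
linear forms such that `ann Φ = (g₁,…,g₅) + (f)`, `f` is a nonzerodivisor on
`P/(g₁,…,g₅)`, and `0 → P → P⁵ → P⁵ → P` (maps `gᵀ`, `X`, `g`) is exact at the
three interior positions. -/
theorem hypersurfaceSection_of_two_le_rank_smMatrix
    (Φ : MvPolynomial (Fin 4) k →ₗ[k] k)
    (hΦ : ∀ m : Fin 4 →₀ ℕ, (m.sum fun _ e => e) ≠ 3 → Φ (monomial m 1) = 0)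
    (hlin : ∀ u ∈ homogeneousSubmodule (Fin 4) k 1, u ∈ annIdeal k Φ → u = 0)
    (hp : Function.Bijective (pMap k Φ))
    (ly2 lyz lyw lz2 lzw lw2 : MvPolynomial (Fin 4) k)
    (hly2m : ly2 ∈ homogeneousSubmodule (Fin 4) k 1)
    (hlyzm : lyz ∈ homogeneousSubmodule (Fin 4) k 1)
    (hlywm : lyw ∈ homogeneousSubmodule (Fin 4) k 1)
    (hlz2m : lz2 ∈ homogeneousSubmodule (Fin 4) k 1)
    (hlzwm : lzw ∈ homogeneousSubmodule (Fin 4) k 1)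
    (hlw2m : lw2 ∈ homogeneousSubmodule (Fin 4) k 1)
    (hly2 : ∀ v ∈ homogeneousSubmodule (Fin 4) k 1,
      Φ (X 0 * ly2 * v) = Φ (X 1 ^ 2 * v))
    (hlyz : ∀ v ∈ homogeneousSubmodule (Fin 4) k 1,
      Φ (X 0 * lyz * v) = Φ (X 1 * X 2 * v))
    (hlyw : ∀ v ∈ homogeneousSubmodule (Fin 4) k 1,
      Φ (X 0 * lyw * v) = Φ (X 1 * X 3 * v))
    (hlz2 : ∀ v ∈ homogeneousSubmodule (Fin 4) k 1,
      Φ (X 0 * lz2 * v) = Φ (X 2 ^ 2 * v))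
    (hlzw : ∀ v ∈ homogeneousSubmodule (Fin 4) k 1,
      Φ (X 0 * lzw * v) = Φ (X 2 * X 3 * v))
    (hlw2 : ∀ v ∈ homogeneousSubmodule (Fin 4) k 1,
      Φ (X 0 * lw2 * v) = Φ (X 3 ^ 2 * v))
    (hSM : 2 ≤ (smMatrix k Φ ly2 lyz lyw lz2 lzw lw2).rank) :
    ∃ (g : Fin 5 → MvPolynomial (Fin 4) k) (f : MvPolynomial (Fin 4) k)
      (M : Matrix (Fin 5) (Fin 5) (MvPolynomial (Fin 4) k)),
      (∀ i, (g i).IsHomogeneous 2) ∧ f.IsHomogeneous 2 ∧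
        (∀ i j, (M i j).IsHomogeneous 1) ∧
        Matrix.transpose M = -M ∧ (∀ i, M i i = 0) ∧
        annIdeal k Φ = Ideal.span (Set.range g) + Ideal.span {f} ∧
        (Ideal.span (Set.range g)).colon (Ideal.span {f}) = Ideal.span (Set.range g) ∧
        Function.Injective (colMap g) ∧
        LinearMap.range (colMap g) = LinearMap.ker M.mulVecLin ∧
        LinearMap.range M.mulVecLin = LinearMap.ker (rowMap g) := by
  have hX : ∀ i : Fin 4, (X i : MvPolynomial (Fin 4) k).IsHomogeneous 1 := isHomogeneous_X k
  -- the inverse map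
  let Q : MvPolynomial (Fin 4) k →ₗ[k] (homogeneousSubmodule (Fin 4) k 1 →ₗ[k] k) :=
    { toFun := fun q => Φ.comp ((LinearMap.mulLeft k q).comp (homogeneousSubmodule (Fin 4) k 1).subtype)
      map_add' := fun a b => by ext v; simp [add_mul]
      map_smul' := fun a b => by ext v; simp }
  let E := LinearEquiv.ofBijective (pMap k Φ) hp
  let L : MvPolynomial (Fin 4) k →ₗ[k] MvPolynomial (Fin 4) k :=
    (homogeneousSubmodule (Fin 4) k 1).subtype.comp (E.symm.toLinearMap.comp Q)
  have I : InvSys Φ L := by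
    refine ⟨fun q => (E.symm (Q q)).2, fun q v hv => ?_, fun a ha h => ?_, fun n p hn hpn => ?_⟩
    · have h : E (E.symm (Q q)) = Q q := E.apply_symm_apply _
      exact congrArg (fun l => l ⟨v, hv⟩) h
    · have h0 : pMap k Φ ⟨a, ha⟩ = pMap k Φ 0 := by
        rw [map_zero]; ext v; exact h v.1 v.2
      exact congrArg Subtype.val (hp.1 h0)
    · rw [p.as_sum, map_sum]
      refine Finset.sum_eq_zero fun m hm => ?_
      have hd : (m.sum fun _ e => e) = n := by
        have := hpn (mem_support_iff.1 hm)
        rw [← this, Finsupp.weight_apply]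
        simp
      have e : monomial m (coeff m p) = coeff m p • monomial m (1 : k) := by
        rw [smul_monomial, smul_eq_mul, mul_one]
      rw [e, map_smul, hΦ m (hd ▸ hn), smul_zero]
  have hs : ∀ l : MvPolynomial (Fin 4) k →ₗ[k] k, ∃ r : MvPolynomial (Fin 4) k,
      r.IsHomogeneous 1 ∧ ∀ a, a.IsHomogeneous 1 → Φ (X 0 * a * r) = l a := fun l => by
    obtain ⟨r, hr⟩ := hp.2 (l.comp (homogeneousSubmodule (Fin 4) k 1).subtype)
    refine ⟨r.1, r.2, fun a ha => ?_⟩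
    rw [mul_right_comm]
    exact congrArg (fun l => l ⟨a, ha⟩) hr
  have un : ∀ q l, l ∈ homogeneousSubmodule (Fin 4) k 1 →
      (∀ v ∈ homogeneousSubmodule (Fin 4) k 1, Φ (X 0 * l * v) = Φ (q * v)) → l = L q := by
    intro q l hl h
    rw [← sub_eq_zero]
    refine I.nd _ (MvPolynomial.IsHomogeneous.sub hl (I.L1 q)) fun v hv => ?_
    rw [mul_sub, sub_mul, map_sub, h v hv, I.hL q v hv, sub_self]
  have uy2 := un _ _ hly2m hly2
  have uyz := un _ _ hlyzm hlyz
  have uyw := un _ _ hlywm hlyw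
  have uz2 := un _ _ hlz2m hlz2
  have uzw := un _ _ hlzwm hlzw
  have uw2 := un _ _ hlw2m hlw2
  clear_value L
  subst uy2 uyz uyw uz2 uzw uw2
  by_contra hno
  have m31 : (X 3 * X 1 : MvPolynomial (Fin 4) k) = X 1 * X 3 := mul_comm _ _
  have m32 : (X 3 * X 2 : MvPolynomial (Fin 4) k) = X 2 * X 3 := mul_comm _ _
  have m21 : (X 2 * X 1 : MvPolynomial (Fin 4) k) = X 1 * X 2 := mul_comm _ _
  have c1 : ∀ a b c : k, a * b - c ^ 2 = 0 → -a * -b - (-c) ^ 2 = 0 := fun a b c h => by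
    linear_combination h
  refine sym_rank _ (-DD Φ L (X 2) (X 3) (X 2) (X 3)) (-DD Φ L (X 2) (X 3) (X 3) (X 1))
    (-DD Φ L (X 2) (X 3) (X 1) (X 2)) (-DD Φ L (X 3) (X 1) (X 3) (X 1))
    (-DD Φ L (X 3) (X 1) (X 1) (X 2)) (-DD Φ L (X 1) (X 2) (X 1) (X 2))
    ?_ ?_ ?_ ?_ ?_ ?_ ?_ ?_ ?_ hSM (c1 _ _ _ ?_) (c1 _ _ _ ?_) (c1 _ _ _ ?_) ?_
  · change Φ (X 2 ^ 2 * L (X 3 ^ 2)) - Φ (X 2 * X 3 * L (X 2 * X 3)) = _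
    simp only [DD, pow_two, m31, m32, m21]
    ring
  · change Φ (X 2 * X 3 * L (X 1 * X 3)) - Φ (X 2 * X 1 * L (X 3 ^ 2)) = _
    simp only [DD, pow_two, m31, m32, m21]
    ring
  · change Φ (X 1 * X 2 * L (X 2 * X 3)) - Φ (X 2 ^ 2 * L (X 1 * X 3)) = _
    simp only [DD, pow_two, m31, m32, m21]
    ring
  · change Φ (X 1 * X 3 * L (X 2 * X 3)) - Φ (X 1 * X 2 * L (X 3 ^ 2)) = _
    simp only [DD, pow_two, m31, m32, m21]
    linear_combination I.sym (X 1 * X 3) (X 2 * X 3)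
  · change Φ (X 1 ^ 2 * L (X 3 ^ 2)) - Φ (X 1 * X 3 * L (X 1 * X 3)) = _
    simp only [DD, pow_two, m31, m32, m21]
    linear_combination I.sym (X 1 * X 1) (X 3 * X 3)
  · change Φ (X 1 * X 2 * L (X 1 * X 3)) - Φ (X 1 ^ 2 * L (X 2 * X 3)) = _
    simp only [DD, pow_two, m31, m32, m21]
    linear_combination I.sym (X 1 * X 2) (X 1 * X 3) - I.sym (X 1 * X 1) (X 2 * X 3)
  · change Φ (X 1 * X 2 * L (X 2 * X 3)) - Φ (X 1 * X 3 * L (X 2 ^ 2)) = _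
    simp only [DD, pow_two, m31, m32, m21]
    linear_combination -I.sym (X 1 * X 3) (X 2 * X 2)
  · change Φ (X 1 * X 3 * L (X 1 * X 2)) - Φ (X 1 ^ 2 * L (X 2 * X 3)) = _
    simp only [DD, pow_two, m31, m32, m21]
    linear_combination -I.sym (X 1 * X 1) (X 2 * X 3)
  · change Φ (X 1 ^ 2 * L (X 2 ^ 2)) - Φ (X 1 * X 2 * L (X 1 * X 2)) = _
    simp only [DD, pow_two, m31, m32, m21]
    ring
  · by_contra hd
    exact hno (shear_main I hs ![X 3, X 0, X 1, X 2] ![X 1, X 2, X 3, X 0]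
      (by intro i; fin_cases i <;> simp) (by intro i; fin_cases i <;> simp)
      (by intro i; fin_cases i <;> exact hX _) (by intro i; fin_cases i <;> exact hX _) rfl hd)
  · by_contra hd
    exact hno (shear_main I hs ![X 1, X 0, X 2, X 3] ![X 1, X 0, X 2, X 3]
      (by intro i; fin_cases i <;> simp) (by intro i; fin_cases i <;> simp)
      (by intro i; fin_cases i <;> exact hX _) (by intro i; fin_cases i <;> exact hX _) rfl hd)
  · rw [I.DD_sym (X 2) (X 3) (X 1)]
    by_contra hd
    exact hno (shear_main I hs ![X 2, X 0, X 3, X 1] ![X 1, X 3, X 0, X 2]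
      (by intro i; fin_cases i <;> simp) (by intro i; fin_cases i <;> simp)
      (by intro i; fin_cases i <;> exact hX _) (by intro i; fin_cases i <;> exact hX _) rfl hd)
  · by_contra hd
    refine hno (shear_main I hs ![X 1 + X 2, X 0, X 1, X 3] ![X 1, X 2, X 0 - X 2, X 3]
      (by intro i; fin_cases i <;> simp) (by intro i; fin_cases i <;> simp)
      (by
        intro i; fin_cases i
        · exact (hX 1).add (hX 2)
        · exact hX 0
        · exact hX 1
        · exact hX 3)
      (by
        intro i; fin_cases i
        · exact hX 1
        · exact hX 2
        · exact (hX 0).sub (hX 2)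
        · exact hX 3) rfl ?_)
    change DD Φ L (X 3) (X 1 + X 2) (X 3) (X 1 + X 2) * DD Φ L (X 1 + X 2) (X 1) (X 1 + X 2) (X 1)
      - DD Φ L (X 3) (X 1 + X 2) (X 1 + X 2) (X 1) ^ 2 ≠ 0
    have l : ∀ u v, DD Φ L u v (X 1 + X 2) (X 1) = - DD Φ L u v (X 1) (X 2) := fun u v => by
      rw [DD_anti, DD_add, DD_self, zero_add]
    have l2 : ∀ u v, DD Φ L u v (X 3) (X 1 + X 2) = DD Φ L u v (X 3) (X 1) - DD Φ L u v (X 2) (X 3) :=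
      fun u v => by rw [DD_add, DD_anti u v (X 3) (X 2)]; ring
    rw [l, l, l2, I.DD_sym (X 3) (X 1 + X 2), I.DD_sym (X 3) (X 1 + X 2), I.DD_sym (X 3) (X 1 + X 2),
      I.DD_sym (X 1 + X 2) (X 1), l, l2, l2, l2, I.DD_sym (X 1) (X 2) (X 3) (X 1),
      I.DD_sym (X 1) (X 2) (X 2) (X 3), I.DD_sym (X 3) (X 1) (X 2) (X 3)]
    intro h
    apply hd
    linear_combination h

end
end

section
/- Let k be a field and R = k[y,z,w]. Define the row vector F = (y², yz, yw, z², zw, w²), the 6×8 matrix D with rows (0,0,0,w,0,0,−z,0), (−w,0,0,0,w,0,y,−z), (z,0,0,−y,0,w,0,0), (0,−w,0,0,0,0,0,y), (0,z,−w,0,−y,0,0,0), (0,0,z,0,0,−y,0,0), and the 8×3 matrix A3 with rows (y,0,−w), (0,y,0), (0,0,y), (z,0,0), (0,z,−w), (0,0,z), (w,0,0), (0,w,0). Then: (1) the complex 0 → R³ → R⁸ → R⁶ → R with maps given by left multiplication by A3, D, and F is exact at R³, R⁸, and R⁶, and the image of the map given by F is the ideal (y²,yz,yw,z²,zw,w²),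 which equals the ideal of 2×2 minors of the 2×4 matrix with rows (y,z,w,0) and (0,y,z,w); and (2) the dual complex 0 → R → R⁶ → R⁸ → R³, with maps given by the transposes F^T, D^T, and A3^T, is exact at R, R⁶, and R⁸. -/
open MvPolynomial

noncomputable section

variable (k : Type*) [Field k]

/-- `R = k[y,z,w]`. -/
local notation "R" => MvPolynomial (Fin 3) k
/-- The variables `y`, `z`, `w` of `R = k[y,z,w]`. -/
local notation "Y" => (X 0 : MvPolynomial (Fin 3) k)
local notation "Z" => (X 1 : MvPolynomial (Fin 3) k)
local notation "W" => (X 2 : MvPolynomial (Fin 3) k)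

/-- The row vector `F = (y², yz, yw, z², zw, w²)`. -/
def Fvec : Fin 6 → MvPolynomial (Fin 3) k :=
  ![Y ^ 2, Y * Z, Y * W, Z ^ 2, Z * W, W ^ 2]

/-- The `6 × 8` matrix `D`. -/
def Dmat : Matrix (Fin 6) (Fin 8) (MvPolynomial (Fin 3) k) :=
  !![0, 0, 0, W, 0, 0, -Z, 0;
     -W, 0, 0, 0, W, 0, Y, -Z;
     Z, 0, 0, -Y, 0, W, 0, 0;
     0, -W, 0, 0, 0, 0, 0, Y;
     0, Z, -W, 0, -Y, 0, 0, 0;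
     0, 0, Z, 0, 0, -Y, 0, 0]

/-- The `8 × 3` matrix `A3`. -/
def A3mat : Matrix (Fin 8) (Fin 3) (MvPolynomial (Fin 3) k) :=
  !![Y, 0, -W;
     0, Y, 0;
     0, 0, Y;
     Z, 0, 0;
     0, Z, -W;
     0, 0, Z;
     W, 0, 0;
     0, W, 0]

/-- The `2 × 4` matrix `M` with rows `(y,z,w,0)` and `(0,y,z,w)`. -/
def Mmat : Matrix (Fin 2) (Fin 4) (MvPolynomial (Fin 3) k) :=
  !![Y, Z, W, 0;
     0, Y, Z, W]

theorem aux_H1 {A : Type*} [CommRing A] [IsDomain A] {u v : A} (hu : Prime u) (huv : ¬ u ∣ v)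
    {a b : A} (h : u * a = v * b) : ∃ c, a = v * c ∧ b = u * c := by
  have : u ∣ v * b := ⟨a, h.symm⟩
  rcases hu.dvd_or_dvd this with h1 | ⟨c, rfl⟩
  · exact absurd h1 huv
  · refine ⟨c, mul_left_cancel₀ hu.ne_zero ?_, rfl⟩
    rw [h]; ring

theorem aux_X (K : Type*) [Field K] {i j : Fin 3} (hij : i ≠ j) {a b : MvPolynomial (Fin 3) K}
    (h : X i * a = X j * b) : ∃ c, a = X j * c ∧ b = X i * c := by
  refine aux_H1 (MvPolynomial.X_prime) ?_ h
  rw [MvPolynomial.X_dvd_X]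
  simpa using hij

theorem aux_H2 (K : Type*) [Field K] {a b c : MvPolynomial (Fin 3) K}
    (h : X 0 * a + X 1 * b + X 2 * c = 0) :
    ∃ p q r, a = X 1 * p + X 2 * q ∧ b = - X 0 * p + X 2 * r ∧ c = - X 0 * q - X 1 * r := by
  have hm : X 2 * c ∈ Ideal.span ((X : Fin 3 → MvPolynomial (Fin 3) K) '' {0, 1}) := by
    rw [Set.image_pair, Ideal.mem_span_pair]
    exact ⟨-a, -b, by linear_combination (-1 : MvPolynomial (Fin 3) K) * h⟩
  have hc : c ∈ Ideal.span ((X : Fin 3 → MvPolynomial (Fin 3) K) '' {0, 1}) := by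
    rw [MvPolynomial.mem_ideal_span_X_image] at hm ⊢
    intro m hms
    obtain ⟨i, hi, hne⟩ := hm (Finsupp.single 2 1 + m) (by
      rw [MvPolynomial.mem_support_iff] at hms ⊢
      rwa [MvPolynomial.coeff_X_mul])
    refine ⟨i, hi, ?_⟩
    rcases hi with rfl | rfl <;> simpa using hne
  rw [Set.image_pair, Ideal.mem_span_pair] at hc
  obtain ⟨q, r, hqr⟩ := hc
  have h2 : X 0 * (a + X 2 * q) = X 1 * (-(b + X 2 * r)) := by
    linear_combination h + X 2 * hqr
  obtain ⟨p, hp, hp'⟩ := aux_X K (by decide) h2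
  exact ⟨p, -q, -r, by linear_combination hp, by linear_combination -hp',
    by linear_combination -hqr⟩

theorem aux_A3 (v : Fin 3 → R) : (A3mat k).mulVecLin v =
    ![Y * v 0 - W * v 2, Y * v 1, Y * v 2, Z * v 0, Z * v 1 - W * v 2, Z * v 2, W * v 0,
      W * v 1] := by
  funext i
  fin_cases i <;> simp [A3mat, Matrix.mulVec, dotProduct, Fin.sum_univ_succ] <;> ring

theorem aux_D (v : Fin 8 → R) : (Dmat k).mulVecLin v =
    ![W * v 3 - Z * v 6, -W * v 0 + W * v 4 + Y * v 6 - Z * v 7, Z * v 0 - Y * v 3 + W * v 5,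
      -W * v 1 + Y * v 7, Z * v 1 - W * v 2 - Y * v 4, Z * v 2 - Y * v 5] := by
  funext i
  fin_cases i <;> simp [Dmat, Matrix.mulVec, dotProduct, Fin.sum_univ_eight] <;> ring

theorem aux_DT (u : Fin 6 → R) : (Matrix.transpose (Dmat k)).mulVecLin u =
    ![-W * u 1 + Z * u 2, -W * u 3 + Z * u 4, -W * u 4 + Z * u 5, W * u 0 - Y * u 2,
      W * u 1 - Y * u 4, W * u 2 - Y * u 5, -Z * u 0 + Y * u 1, -Z * u 1 + Y * u 3] := by
  funext i
  rw [Matrix.mulVecLin_apply]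
  simp only [Matrix.mulVec, dotProduct, Fin.sum_univ_six, Matrix.transpose_apply]
  fin_cases i <;> simp [Dmat] <;> ring

theorem aux_A3T (x : Fin 8 → R) : (Matrix.transpose (A3mat k)).mulVecLin x =
    ![Y * x 0 + Z * x 3 + W * x 6, Y * x 1 + Z * x 4 + W * x 7,
      Y * x 2 + Z * x 5 + W * (-x 0 - x 4)] := by
  funext i
  rw [Matrix.mulVecLin_apply]
  simp only [Matrix.mulVec, dotProduct, Fin.sum_univ_eight, Matrix.transpose_apply]
  fin_cases i <;> simp [A3mat] <;> ring

theorem aux_F (u : Fin 6 → R) : rowMap (Fvec k) u =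
    Y ^ 2 * u 0 + Y * Z * u 1 + Y * W * u 2 + Z ^ 2 * u 3 + Z * W * u 4 + W ^ 2 * u 5 := by
  simp [rowMap, Fvec, Fin.sum_univ_six]

theorem aux_FT (t : R) : colMap (Fvec k) t =
    ![Y ^ 2 * t, Y * Z * t, Y * W * t, Z ^ 2 * t, Z * W * t, W ^ 2 * t] := by
  funext i
  fin_cases i <;> simp [colMap, Fvec]

theorem aux_e1 : Function.Injective (A3mat k).mulVecLin := by
  rw [← LinearMap.ker_eq_bot, LinearMap.ker_eq_bot']
  intro v hv
  rw [aux_A3] at hv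
  have h0 := congrFun hv 3
  have h1 := congrFun hv 7
  have h2 := congrFun hv 5
  simp at h0 h1 h2
  funext i
  fin_cases i <;> simp [h0, h1, h2]

theorem aux_e2 : LinearMap.ker (Dmat k).mulVecLin = LinearMap.range (A3mat k).mulVecLin := by
  ext v
  rw [LinearMap.mem_ker, LinearMap.mem_range, aux_D]
  constructor
  · intro hv
    have h0 := congrFun hv 0
    have h2 := congrFun hv 2
    have h3 := congrFun hv 3
    have h4 := congrFun hv 4
    have h5 := congrFun hv 5
    simp at h0 h2 h3 h4 h5
    obtain ⟨a, ha, ha'⟩ := aux_X k (i := 2) (j := 1) (by decide)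
      (show W * v 3 = Z * v 6 by linear_combination h0)
    obtain ⟨b, hb, hb'⟩ := aux_X k (i := 2) (j := 0) (by decide)
      (show W * v 1 = Y * v 7 by linear_combination -h3)
    obtain ⟨c, hc, hc'⟩ := aux_X k (i := 1) (j := 0) (by decide)
      (show Z * v 2 = Y * v 5 by linear_combination h5)
    have e0 : v 0 = Y * a - W * c := by
      refine mul_left_cancel₀ (show (X 1 : R) ≠ 0 from X_ne_zero _) ?_
      linear_combination h2 + Y * ha - W * hc'
    have e4 : v 4 = Z * b - W * c := by
      refine mul_left_cancel₀ (show (X 0 : R) ≠ 0 from X_ne_zero _) ?_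
      linear_combination -h4 + Z * hb - W * hc
    refine ⟨![a, b, c], ?_⟩
    rw [aux_A3]
    funext i
    fin_cases i <;> simp [*]
  · rintro ⟨u, rfl⟩
    rw [aux_A3]
    funext i
    fin_cases i <;> simp <;> ring

theorem aux_e3 : LinearMap.ker (rowMap (Fvec k)) = LinearMap.range (Dmat k).mulVecLin := by
  ext u
  rw [LinearMap.mem_ker, LinearMap.mem_range, aux_F]
  constructor
  · intro hu
    obtain ⟨p, q, r, h1, h2, h3⟩ := aux_H2 k (a := Y * u 0 + Z * u 1 + W * u 2)
      (b := Z * u 3 + W * u 4) (c := W * u 5) (by linear_combination hu)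
    obtain ⟨s, t, m, hq, hr, h5⟩ := aux_H2 k (a := q) (b := r) (c := u 5)
      (by linear_combination h3)
    obtain ⟨e, f, g, hp, hh3, h4⟩ := aux_H2 k (a := p) (b := u 3) (c := u 4 - r)
      (by linear_combination h2)
    obtain ⟨a, b, c, h0, hh1, hh2⟩ := aux_H2 k (a := u 0) (b := u 1 - p) (c := u 2 - q)
      (by linear_combination h1)
    refine ⟨![s - c, -g, -m, b, f + s, t, -a, -e], ?_⟩
    rw [aux_D]
    funext i
    fin_cases i <;> simp
    · linear_combination -h0
    · linear_combination -hh1 - hp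
    · linear_combination -hh2 - hq
    · linear_combination -hh3
    · linear_combination -h4 - hr
    · linear_combination -h5
  · rintro ⟨v, rfl⟩
    rw [aux_D]
    simp
    ring

theorem aux_e4 : LinearMap.range (rowMap (Fvec k)) =
    Ideal.span {Y ^ 2, Y * Z, Y * W, Z ^ 2, Z * W, W ^ 2} := by
  apply le_antisymm
  · rintro _ ⟨u, rfl⟩
    rw [aux_F]
    refine add_mem (add_mem (add_mem (add_mem (add_mem ?_ ?_) ?_) ?_) ?_) ?_ <;>
    exact Ideal.mul_mem_right _ _ (Ideal.subset_span (by simp))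
  · refine Submodule.span_le.2 ?_
    have key : ∀ i, Fvec k i ∈ LinearMap.range (rowMap (Fvec k)) := fun i =>
      ⟨Pi.single i 1, by simp [rowMap, Pi.single_apply]⟩
    rintro x (rfl | rfl | rfl | rfl | rfl | rfl)
    exacts [key 0, key 1, key 2, key 3, key 4, key 5]

theorem aux_e5 : Ideal.span {Y ^ 2, Y * Z, Y * W, Z ^ 2, Z * W, W ^ 2} =
    Ideal.span {d | ∃ i j : Fin 4,
      d = Mmat k 0 i * Mmat k 1 j - Mmat k 0 j * Mmat k 1 i} := by
  apply le_antisymm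
  · refine Ideal.span_le.2 ?_
    have key : ∀ i j : Fin 4, Mmat k 0 i * Mmat k 1 j - Mmat k 0 j * Mmat k 1 i ∈
      Ideal.span {d | ∃ i j : Fin 4,
        d = Mmat k 0 i * Mmat k 1 j - Mmat k 0 j * Mmat k 1 i} := fun i j =>
      Ideal.subset_span ⟨i, j, rfl⟩
    have k01 := key 0 1
    have k02 := key 0 2
    have k03 := key 0 3
    have k12 := key 1 2
    have k13 := key 1 3
    have k23 := key 2 3
    generalize Ideal.span {d | ∃ i j : Fin 4,
        d = Mmat k 0 i * Mmat k 1 j - Mmat k 0 j * Mmat k 1 i} = I at *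
    simp [Mmat] at k01 k02 k03 k12 k13 k23
    rintro x (rfl | rfl | rfl | rfl | rfl | rfl)
    · simpa [sq] using k01
    · exact k02
    · exact k03
    · have := add_mem k12 k03
      have e : Z ^ 2 = Z * Z - W * Y + Y * W := by ring
      rw [e]
      exact this
    · exact k13
    · simpa [sq] using k23
  · refine Ideal.span_le.2 ?_
    rintro _ ⟨i, j, rfl⟩
    have g : ∀ x ∈ ({Y ^ 2, Y * Z, Y * W, Z ^ 2, Z * W, W ^ 2} : Set R),
      x ∈ Ideal.span ({Y ^ 2, Y * Z, Y * W, Z ^ 2, Z * W, W ^ 2} : Set R) :=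
      fun x hx => Ideal.subset_span hx
    simp only [Set.mem_insert_iff, Set.mem_singleton_iff, forall_eq_or_imp, forall_eq] at g
    generalize Ideal.span ({Y ^ 2, Y * Z, Y * W, Z ^ 2, Z * W, W ^ 2} : Set R) = I at *
    obtain ⟨g0, g1, g2, g3, g4, g5⟩ := g
    have key : ∀ i : Fin 4, ∀ j : Fin 4, Mmat k 0 i * Mmat k 1 j ∈ I := by
      intro i j
      fin_cases i <;> fin_cases j <;> simp [Mmat] <;>
        first
        | assumption
        | (rw [← sq]; assumption)
        | (rw [mul_comm]; assumption)
    exact sub_mem (key i j) (key j i)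

theorem aux_f1 : Function.Injective (colMap (Fvec k)) := by
  rw [← LinearMap.ker_eq_bot, LinearMap.ker_eq_bot']
  intro v hv
  rw [aux_FT] at hv
  have h0 := congrFun hv 0
  simpa using h0

theorem aux_f2 : LinearMap.ker (Matrix.transpose (Dmat k)).mulVecLin =
    LinearMap.range (colMap (Fvec k)) := by
  ext u
  rw [LinearMap.mem_ker, LinearMap.mem_range, aux_DT]
  constructor
  · intro hu
    have h3 := congrFun hu 3
    have h4 := congrFun hu 4
    have h5 := congrFun hu 5
    have h6 := congrFun hu 6
    have h7 := congrFun hu 7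
    simp at h3 h4 h5 h6 h7
    obtain ⟨a, ha, ha'⟩ := aux_X k (i := 0) (j := 1) (by decide)
      (show Y * u 1 = Z * u 0 by linear_combination h6)
    obtain ⟨b, hb, hb'⟩ := aux_X k (i := 0) (j := 1) (by decide)
      (show Y * u 3 = Z * (u 1) by linear_combination h7)
    obtain ⟨c, hc, hc'⟩ := aux_X k (i := 0) (j := 1) (by decide)
      (show Y * b = Z * a by rw [← ha, hb'])
    have e2 : u 2 = Y * W * c := by
      refine mul_left_cancel₀ (show (X 0 : R) ≠ 0 from X_ne_zero _) ?_
      linear_combination -h3 + W * ha' + W * Y * hc'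
    have e4 : u 4 = Z * W * c := by
      refine mul_left_cancel₀ (show (X 0 : R) ≠ 0 from X_ne_zero _) ?_
      linear_combination -h4 + W * ha + W * Z * hc'
    have e5 : u 5 = W ^ 2 * c := by
      refine mul_left_cancel₀ (show (X 0 : R) ≠ 0 from X_ne_zero _) ?_
      linear_combination -h5 + W * e2
    refine ⟨c, ?_⟩
    rw [aux_FT]
    funext i
    fin_cases i <;> simp
    · linear_combination -ha' - Y * hc'
    · linear_combination -ha - Z * hc'
    · linear_combination -e2
    · linear_combination -hb - Z * hc
    · linear_combination -e4
    · linear_combination -e5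
  · rintro ⟨t, rfl⟩
    rw [aux_FT]
    funext i
    fin_cases i <;> simp <;> ring

theorem aux_f3 : LinearMap.ker (Matrix.transpose (A3mat k)).mulVecLin =
    LinearMap.range (Matrix.transpose (Dmat k)).mulVecLin := by
  ext x
  rw [LinearMap.mem_ker, LinearMap.mem_range, aux_A3T]
  constructor
  · intro hx
    have h0 := congrFun hx 0
    have h1 := congrFun hx 1
    have h2 := congrFun hx 2
    simp only [Matrix.cons_val, Pi.zero_apply] at h0 h1 h2
    obtain ⟨a, b, c, x0, x3, x6⟩ := aux_H2 k h0
    obtain ⟨d, e, f, x1, x4, x7⟩ := aux_H2 k h1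
    obtain ⟨g, h, i, x2, x5, xx⟩ := aux_H2 k h2
    obtain ⟨p, q, r, y0, y1, y2⟩ := aux_H2 k (a := -d - h) (b := a - i) (c := b + f)
      (by linear_combination -xx - x0 - x4)
    refine ⟨![c - Y * r, -b - Z * r, a - W * r, -e + Z * q, d + W * q, g - W * p], ?_⟩
    rw [aux_DT]
    funext j
    fin_cases j <;> simp
    · linear_combination -x0
    · linear_combination -x1
    · linear_combination -x2 + W * y0
    · linear_combination -x3
    · linear_combination -x4 - W * y2
    · linear_combination -x5 + W * y1
    · linear_combination -x6
    · linear_combination -x7 + Z * y2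
  · rintro ⟨v, rfl⟩
    rw [aux_DT]
    funext i
    fin_cases i <;> simp <;> ring

/-- **Observation 4.6** (the Eagon–Northcott resolution of `R/I₂(M)` and its
dual).  Over `R = k[y,z,w]`, the complex `0 → R³ → R⁸ → R⁶ → R` with maps
`A3`, `D`, `F` is exact at `R³`, `R⁸` and `R⁶`, the image of the last map is
the ideal `(y²,yz,yw,z²,zw,w²) = I₂(M)`, and the dual complex
`0 → R → R⁶ → R⁸ → R³` with maps `Fᵀ`, `Dᵀ`, `A3ᵀ` is exact at `R`, `R⁶`
and `R⁸`. -/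
theorem eagonNorthcott_complex_exact :
    (Function.Injective (A3mat k).mulVecLin ∧
        LinearMap.ker (Dmat k).mulVecLin = LinearMap.range (A3mat k).mulVecLin ∧
        LinearMap.ker (rowMap (Fvec k)) = LinearMap.range (Dmat k).mulVecLin ∧
        LinearMap.range (rowMap (Fvec k)) =
          Ideal.span {Y ^ 2, Y * Z, Y * W, Z ^ 2, Z * W, W ^ 2} ∧
        Ideal.span {Y ^ 2, Y * Z, Y * W, Z ^ 2, Z * W, W ^ 2} =
          Ideal.span {d | ∃ i j : Fin 4,
            d = Mmat k 0 i * Mmat k 1 j - Mmat k 0 j * Mmat k 1 i}) ∧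
      (Function.Injective (colMap (Fvec k)) ∧
        LinearMap.ker (Matrix.transpose (Dmat k)).mulVecLin =
          LinearMap.range (colMap (Fvec k)) ∧
        LinearMap.ker (Matrix.transpose (A3mat k)).mulVecLin =
          LinearMap.range (Matrix.transpose (Dmat k)).mulVecLin) := by
  exact ⟨⟨aux_e1 k, aux_e2 k, aux_e3 k, aux_e4 k, aux_e5 k⟩, aux_f1 k, aux_f2 k, aux_f3 k⟩

end
end

section
/- Let k be a field of characteristic 2 and P = k[x,y,z,w]. Define: K₁ = the row vector (y², z², xy, xz, xw); K₂ = the 5×6 matrix with rows (z²,0,x,0,0,0), (y²,x,0,0,0,0), (0,0,y,0,w,z), (0,z,0,w,0,y), (0,0,0,z,y,0); K₃ = the 6×2 matrix with rows (x,0), (y²,0), (z²,0), (0,y), (0,z), (yz,w); L₀ = the row vector (w², x³+yzw); and L₁ = the 5×6 matrix with rows (0,w²,0,zw,0,0), (0,0,w²,0,yw,0), (0,0,0,x²,0,0), (0,0,0,0,x²,0), (w,0,0,0,0,x²). Then the mapping-cone complex 0 → P → P⁵⊕P² → P⁶⊕P⁶ → P²⊕P⁵ → P, with differentials d₄(t)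 = (K₁^T t, L₀^T t), d₃(t,b) = (K₂^T t, L₁^T t + K₃ b), d₂(t,b) = (K₃^T t, L₁ t + K₂ b), d₁(t,b) = L₀ t + K₁ b, is exact at the four left positions, and the image of d₁ is the ideal (xy, xz, xw, y², z², w², x³+yzw). Hence this complex is a free resolution (with total Betti numbers (1,7,12,7,1)) of the unique standard graded Artinian Gorenstein algebra of embedding dimension four and socle degree three without the weak Lefschetz property. -/
open MvPolynomial

noncomputable section

variable (k : Type*) [Field k]

local notation "Xv" => (X 0 : MvPolynomial (Fin 4) k)
local notation "Yv" => (X 1 : MvPolynomial (Fin 4) k)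
local notation "Zv" => (X 2 : MvPolynomial (Fin 4) k)
local notation "Wv" => (X 3 : MvPolynomial (Fin 4) k)

/-- The row vector `K₁ = (y², z², xy, xz, xw)`. -/
def K1vec : Fin 5 → MvPolynomial (Fin 4) k :=
  ![Yv ^ 2, Zv ^ 2, Xv * Yv, Xv * Zv, Xv * Wv]

/-- The `5 × 6` matrix `K₂`. -/
def K2mat : Matrix (Fin 5) (Fin 6) (MvPolynomial (Fin 4) k) :=
  !![Zv ^ 2, 0, Xv, 0, 0, 0;
     Yv ^ 2, Xv, 0, 0, 0, 0;
     0, 0, Yv, 0, Wv, Zv;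
     0, Zv, 0, Wv, 0, Yv;
     0, 0, 0, Zv, Yv, 0]

/-- The `6 × 2` matrix `K₃`. -/
def K3mat : Matrix (Fin 6) (Fin 2) (MvPolynomial (Fin 4) k) :=
  !![Xv, 0;
     Yv ^ 2, 0;
     Zv ^ 2, 0;
     0, Yv;
     0, Zv;
     Yv * Zv, Wv]

/-- The row vector `L₀ = (w², x³ + yzw)`. -/
def L0vec : Fin 2 → MvPolynomial (Fin 4) k :=
  ![Wv ^ 2, Xv ^ 3 + Yv * Zv * Wv]

/-- The `5 × 6` matrix `L₁`. -/
def L1mat : Matrix (Fin 5) (Fin 6) (MvPolynomial (Fin 4) k) :=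
  !![0, Wv ^ 2, 0, Zv * Wv, 0, 0;
     0, 0, Wv ^ 2, 0, Yv * Wv, 0;
     0, 0, 0, Xv ^ 2, 0, 0;
     0, 0, 0, 0, Xv ^ 2, 0;
     Wv, 0, 0, 0, 0, Xv ^ 2]

/-- The differential `d₄ : P → P⁵ ⊕ P²`, `t ↦ (K₁ᵀ t, L₀ᵀ t)`. -/
def mcD4 : MvPolynomial (Fin 4) k →ₗ[MvPolynomial (Fin 4) k]
    (Fin 5 → MvPolynomial (Fin 4) k) × (Fin 2 → MvPolynomial (Fin 4) k) :=
  LinearMap.prod (colMap (K1vec k)) (colMap (L0vec k))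

/-- The differential `d₃ : P⁵ ⊕ P² → P⁶ ⊕ P⁶`, `(t,b) ↦ (K₂ᵀ t, L₁ᵀ t + K₃ b)`. -/
def mcD3 : (Fin 5 → MvPolynomial (Fin 4) k) × (Fin 2 → MvPolynomial (Fin 4) k) →ₗ[MvPolynomial (Fin 4) k]
    (Fin 6 → MvPolynomial (Fin 4) k) × (Fin 6 → MvPolynomial (Fin 4) k) :=
  LinearMap.prod
    ((Matrix.transpose (K2mat k)).mulVecLin.comp (LinearMap.fst _ _ _))
    ((Matrix.transpose (L1mat k)).mulVecLin.comp (LinearMap.fst _ _ _) +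
      (K3mat k).mulVecLin.comp (LinearMap.snd _ _ _))

/-- The differential `d₂ : P⁶ ⊕ P⁶ → P² ⊕ P⁵`, `(t,b) ↦ (K₃ᵀ t, L₁ t + K₂ b)`. -/
def mcD2 : (Fin 6 → MvPolynomial (Fin 4) k) × (Fin 6 → MvPolynomial (Fin 4) k) →ₗ[MvPolynomial (Fin 4) k]
    (Fin 2 → MvPolynomial (Fin 4) k) × (Fin 5 → MvPolynomial (Fin 4) k) :=
  LinearMap.prod
    ((Matrix.transpose (K3mat k)).mulVecLin.comp (LinearMap.fst _ _ _))
    ((L1mat k).mulVecLin.comp (LinearMap.fst _ _ _) +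
      (K2mat k).mulVecLin.comp (LinearMap.snd _ _ _))

/-- The differential `d₁ : P² ⊕ P⁵ → P`, `(t,b) ↦ L₀·t + K₁·b`. -/
def mcD1 : (Fin 2 → MvPolynomial (Fin 4) k) × (Fin 5 → MvPolynomial (Fin 4) k) →ₗ[MvPolynomial (Fin 4) k]
    MvPolynomial (Fin 4) k :=
  (rowMap (L0vec k)).comp (LinearMap.fst _ _ _) +
    (rowMap (K1vec k)).comp (LinearMap.snd _ _ _)

theorem aux_colon {σ K : Type*} [Field K] (S : Set (σ →₀ ℕ)) (i : σ) (n : ℕ)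
    (hS : ∀ s ∈ S, s i = 0) (p : MvPolynomial σ K)
    (h : (X i : MvPolynomial σ K) ^ n * p ∈
      Ideal.span ((fun s => monomial s (1 : K)) '' S)) :
    p ∈ Ideal.span ((fun s => monomial s (1 : K)) '' S) := by
  classical
  rw [mem_ideal_span_monomial_image] at h ⊢
  intro e he
  have h1 : Finsupp.single i n + e ∈ ((X i : MvPolynomial σ K) ^ n * p).support := by
    rw [mem_support_iff] at he ⊢
    rw [X_pow_eq_monomial, coeff_monomial_mul, one_mul]
    exact he
  obtain ⟨s, hs, hle⟩ := h _ h1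
  refine ⟨s, hs, fun j => ?_⟩
  by_cases hj : j = i
  · subst hj; rw [hS s hs]; exact Nat.zero_le _
  · have := hle j
    simpa [Finsupp.single_apply, Ne.symm hj] using this

theorem aux_colon3 {σ K : Type*} [Field K] {i a b c : σ} (n α β γ : ℕ)
    (ha : a ≠ i) (hb : b ≠ i) (hc : c ≠ i) {p A B C : MvPolynomial σ K}
    (h : X i ^ n * p = X a ^ α * A + X b ^ β * B + X c ^ γ * C) :
    ∃ A' B' C' : MvPolynomial σ K, p = X a ^ α * A' + X b ^ β * B' + X c ^ γ * C' := by
  have key := aux_colon (K := K)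
    {Finsupp.single a α, Finsupp.single b β, Finsupp.single c γ} i n
    (by
      classical
      intro s hs
      simp only [Set.mem_insert_iff, Set.mem_singleton_iff] at hs
      rcases hs with rfl | rfl | rfl <;> simp [*]) p
  simp only [Set.image_insert_eq, Set.image_singleton, ← X_pow_eq_monomial,
    Ideal.mem_span_insert, Ideal.mem_span_singleton] at key
  obtain ⟨A', _, ⟨B', _, ⟨C', rfl⟩, rfl⟩, h'⟩ := key
    ⟨A, _, ⟨B, _, ⟨C, rfl⟩, rfl⟩, by rw [h]; ring⟩
  exact ⟨A', B', C', by rw [h']; ring⟩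

theorem aux_koszul2 {σ K : Type*} [Field K] {i a : σ} (n α : ℕ)
    (ha : a ≠ i) {p q : MvPolynomial σ K} (h : X i ^ n * p = X a ^ α * q) :
    ∃ r : MvPolynomial σ K, p = X a ^ α * r ∧ q = X i ^ n * r := by
  obtain ⟨A, B, C, hp⟩ := aux_colon3 (A := q) (B := 0) (C := 0) (p := p) n α α α ha ha ha
    (by rw [h]; ring)
  refine ⟨A + B + C, by rw [hp]; ring, ?_⟩
  apply mul_left_cancel₀ (pow_ne_zero α (X_ne_zero a : (X a : MvPolynomial σ K) ≠ 0))
  rw [← h, hp]; ring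

/-- Koszul relations of three powers of variables, with signs dropped (characteristic two). -/
theorem aux_koszul3 {σ K : Type*} [Field K] [CharP K 2] {a b c : σ} (α β γ : ℕ)
    (hab : a ≠ b) (hac : a ≠ c) (hbc : b ≠ c) {p q r : MvPolynomial σ K}
    (h : X a ^ α * p + X b ^ β * q + X c ^ γ * r = 0) :
    ∃ f g e : MvPolynomial σ K, p = X b ^ β * f + X c ^ γ * g ∧
      q = X a ^ α * f + X c ^ γ * e ∧ r = X a ^ α * g + X b ^ β * e := by
  have h2 : (2 : MvPolynomial σ K) = 0 := CharTwo.two_eq_zero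
  obtain ⟨g, e, e', hr⟩ := aux_colon3 (i := c) (a := a) (b := b) (c := b) (A := -p) (B := -q)
    (C := 0) (p := r) γ α β β hac hbc hbc (by linear_combination h)
  have h1 : X a ^ α * (p + X c ^ γ * g) = X b ^ β * (- (q + X c ^ γ * (e + e'))) := by
    linear_combination h - X c ^ γ * hr
  obtain ⟨f, hf, hf'⟩ := aux_koszul2 α β hab.symm h1
  refine ⟨f, g, e + e', ?_, ?_, ?_⟩
  · linear_combination hf - X c ^ γ * g * h2
  · linear_combination -hf' - (X c ^ γ * (e + e') + X a ^ α * f) * h2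
  · linear_combination hr

section core
variable {K : Type*} [Field K] [CharP K 2]

local notation "x" => (X 0 : MvPolynomial (Fin 4) K)
local notation "y" => (X 1 : MvPolynomial (Fin 4) K)
local notation "z" => (X 2 : MvPolynomial (Fin 4) K)
local notation "w" => (X 3 : MvPolynomial (Fin 4) K)

theorem aux_K2T (t0 t1 t2 t3 t4 : MvPolynomial (Fin 4) K)
    (c0 : z ^ 2 * t0 + y ^ 2 * t1 = 0) (c1 : x * t1 + z * t3 = 0) (c2 : x * t0 + y * t2 = 0)
    (c3 : w * t3 + z * t4 = 0) :
    ∃ s, t0 = y ^ 2 * s ∧ t1 = z ^ 2 * s ∧ t2 = x * y * s ∧ t3 = x * z * s ∧ t4 = x * w * s := by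
  have h2 : (2 : MvPolynomial (Fin 4) K) = 0 := CharTwo.two_eq_zero
  obtain ⟨s, h0, h1⟩ := aux_koszul2 (i := (2 : Fin 4)) (a := 1) 2 2 (by decide) (p := t0) (q := t1)
    (by linear_combination c0 - y ^ 2 * t1 * h2)
  have hy : y ≠ 0 := X_ne_zero _
  have hz : z ≠ 0 := X_ne_zero _
  subst h0 h1
  have e3 : t3 = x * z * s := by
    apply mul_left_cancel₀ hz
    linear_combination c1 - x * z ^ 2 * s * h2
  subst e3
  refine ⟨s, rfl, rfl, ?_, rfl, ?_⟩
  · apply mul_left_cancel₀ hy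
    linear_combination c2 - x * y ^ 2 * s * h2
  · apply mul_left_cancel₀ hz
    linear_combination c3 - x * w * z * s * h2

theorem aux_K3T (t0 t1 t2 t3 t4 t5 : MvPolynomial (Fin 4) K)
    (c0 : x * t0 + y ^ 2 * t1 + z ^ 2 * t2 + y * z * t5 = 0)
    (c1 : y * t3 + z * t4 + w * t5 = 0) :
    ∃ u0 u1 u2 u3 u4 : MvPolynomial (Fin 4) K, t0 = z ^ 2 * u0 + y ^ 2 * u1 ∧
      t1 = x * u1 + z * u3 ∧ t2 = x * u0 + y * u2 ∧ t3 = w * u3 + z * u4 ∧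
      t4 = w * u2 + y * u4 ∧ t5 = z * u2 + y * u3 := by
  have h2 : (2 : MvPolynomial (Fin 4) K) = 0 := CharTwo.two_eq_zero
  obtain ⟨r, q, p, h3, h4, h5⟩ := aux_koszul3 (a := (1 : Fin 4)) (b := 2) (c := 3) 1 1 1
    (by decide) (by decide) (by decide) (p := t3) (q := t4) (r := t5)
    (by linear_combination c1)
  obtain ⟨u1, u0, e, k0, k1, k2⟩ := aux_koszul3 (a := (0 : Fin 4)) (b := 1) (c := 2) 1 2 2
    (by decide) (by decide) (by decide) (p := t0) (q := t1 + z * q) (r := t2 + y * p)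
    (by linear_combination c0 - y * z * h5)
  refine ⟨u0, u1, p + y * e, q + z * e, r + w * e, ?_, ?_, ?_, ?_, ?_, ?_⟩
  · linear_combination k0
  · linear_combination k1 - z * q * h2
  · linear_combination k2 - y * p * h2
  · linear_combination h3 - w * z * e * h2
  · linear_combination h4 - w * y * e * h2
  · linear_combination h5 - y * z * e * h2

theorem aux_K2 (u0 u1 u2 u3 u4 u5 : MvPolynomial (Fin 4) K)
    (c0 : z ^ 2 * u0 + x * u2 = 0) (c1 : y ^ 2 * u0 + x * u1 = 0)
    (c2 : y * u2 + w * u4 + z * u5 = 0) (c4 : z * u3 + y * u4 = 0) :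
    ∃ a b : MvPolynomial (Fin 4) K, u0 = x * a ∧ u1 = y ^ 2 * a ∧ u2 = z ^ 2 * a ∧ u3 = y * b ∧
      u4 = z * b ∧ u5 = y * z * a + w * b := by
  have h2 : (2 : MvPolynomial (Fin 4) K) = 0 := CharTwo.two_eq_zero
  have hx : x ≠ 0 := X_ne_zero _
  have hz : z ≠ 0 := X_ne_zero _
  obtain ⟨a, h0, h2'⟩ := aux_koszul2 (i := (2 : Fin 4)) (a := 0) 2 1 (by decide) (p := u0) (q := u2)
    (by linear_combination c0 - x * u2 * h2)
  obtain ⟨b, h3, h4⟩ := aux_koszul2 (i := (2 : Fin 4)) (a := 1) 1 1 (by decide) (p := u3) (q := u4)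
    (by linear_combination c4 - y * u4 * h2)
  subst h0 h2' h3 h4
  refine ⟨a, b, by ring, ?_, rfl, by ring, by ring, ?_⟩
  · apply mul_left_cancel₀ hx
    linear_combination c1 - x * y ^ 2 * a * h2
  · apply mul_left_cancel₀ hz
    linear_combination c2 - (y * z ^ 2 * a + w * z * b) * h2

theorem aux_K1 (v0 v1 v2 v3 v4 : MvPolynomial (Fin 4) K)
    (c : y ^ 2 * v0 + z ^ 2 * v1 + x * y * v2 + x * z * v3 + x * w * v4 = 0) :
    ∃ u0 u1 u2 u3 u4 u5 : MvPolynomial (Fin 4) K, v0 = z ^ 2 * u0 + x * u2 ∧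
      v1 = y ^ 2 * u0 + x * u1 ∧ v2 = y * u2 + w * u4 + z * u5 ∧
      v3 = z * u1 + w * u3 + y * u5 ∧ v4 = z * u3 + y * u4 := by
  have h2 : (2 : MvPolynomial (Fin 4) K) = 0 := CharTwo.two_eq_zero
  obtain ⟨u0, u2, u1, h0, h1, h⟩ := aux_koszul3 (a := (1 : Fin 4)) (b := 2) (c := 0) 2 2 1
    (by decide) (by decide) (by decide) (p := v0) (q := v1) (r := y * v2 + z * v3 + w * v4)
    (by linear_combination c)
  obtain ⟨u5, u4, u3, k2, k3, k4⟩ := aux_koszul3 (a := (1 : Fin 4)) (b := 2) (c := 3) 1 1 1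
    (by decide) (by decide) (by decide) (p := v2 + y * u2) (q := v3 + z * u1) (r := v4)
    (by linear_combination h + (y ^ 2 * u2 + z ^ 2 * u1) * h2)
  refine ⟨u0, u1, u2, u3, u4, u5, ?_, ?_, ?_, ?_, ?_⟩
  · linear_combination h0
  · linear_combination h1
  · linear_combination k2 - y * u2 * h2
  · linear_combination k3 - z * u1 * h2
  · linear_combination k4

theorem aux_L0 (t0 t1 v0 v1 v2 v3 v4 : MvPolynomial (Fin 4) K)
    (c : w ^ 2 * t0 + (x ^ 3 + y * z * w) * t1 +
      (y ^ 2 * v0 + z ^ 2 * v1 + x * y * v2 + x * z * v3 + x * w * v4) = 0) :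
    ∃ s0 s1 s2 s3 s4 s5 : MvPolynomial (Fin 4) K,
      t0 = x * s0 + y ^ 2 * s1 + z ^ 2 * s2 + y * z * s5 ∧ t1 = y * s3 + z * s4 + w * s5 := by
  have h2 : (2 : MvPolynomial (Fin 4) K) = 0 := CharTwo.two_eq_zero
  obtain ⟨s3, s4, s5, h1⟩ := aux_colon3 (i := (0 : Fin 4)) (a := 1) (b := 2) (c := 3) 3 1 1 1
    (by decide) (by decide) (by decide) (p := t1)
    (A := -(z * w * t1 + y * v0 + x * v2)) (B := -(z * v1 + x * v3)) (C := -(w * t0 + x * v4))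
    (by linear_combination c)
  obtain ⟨s0, s1, s2, h0⟩ := aux_colon3 (i := (3 : Fin 4)) (a := 0) (b := 1) (c := 2) 2 1 2 2
    (by decide) (by decide) (by decide) (p := t0 + y * z * s5)
    (A := -(x ^ 2 * t1 + y * v2 + z * v3 + w * v4)) (B := -(v0 + z * w * s3))
    (C := -(v1 + y * w * s4))
    (by linear_combination c - y * z * w * h1)
  refine ⟨s0, s1, s2, s3, s4, s5, ?_, ?_⟩
  · linear_combination h0 - y * z * s5 * h2
  · linear_combination h1

end core

theorem aux_d4 (t : MvPolynomial (Fin 4) k) : mcD4 k t =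
    (![Yv ^ 2 * t, Zv ^ 2 * t, Xv * Yv * t, Xv * Zv * t, Xv * Wv * t],
     ![Wv ^ 2 * t, (Xv ^ 3 + Yv * Zv * Wv) * t]) := by
  refine Prod.ext ?_ ?_ <;> funext i <;> fin_cases i <;>
    simp [mcD4, colMap, K1vec, L0vec]

theorem aux_d3 (t : Fin 5 → MvPolynomial (Fin 4) k) (b : Fin 2 → MvPolynomial (Fin 4) k) :
    mcD3 k (t, b) =
    (![Zv ^ 2 * t 0 + Yv ^ 2 * t 1, Xv * t 1 + Zv * t 3, Xv * t 0 + Yv * t 2,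
       Wv * t 3 + Zv * t 4, Wv * t 2 + Yv * t 4, Zv * t 2 + Yv * t 3],
     ![Wv * t 4 + Xv * b 0, Wv ^ 2 * t 0 + Yv ^ 2 * b 0, Wv ^ 2 * t 1 + Zv ^ 2 * b 0,
       Zv * Wv * t 0 + Xv ^ 2 * t 2 + Yv * b 1, Yv * Wv * t 1 + Xv ^ 2 * t 3 + Zv * b 1,
       Xv ^ 2 * t 4 + (Yv * Zv * b 0 + Wv * b 1)]) := by
  refine Prod.ext ?_ ?_ <;> funext i <;> fin_cases i <;>
    simp [mcD3, K2mat, K3mat, L1mat, dotProduct, Fin.sum_univ_succ, Matrix.vecHead, Matrix.vecTail] <;> ring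

theorem aux_d2 (t b : Fin 6 → MvPolynomial (Fin 4) k) :
    mcD2 k (t, b) =
    (![Xv * t 0 + Yv ^ 2 * t 1 + Zv ^ 2 * t 2 + Yv * Zv * t 5, Yv * t 3 + Zv * t 4 + Wv * t 5],
     ![Wv ^ 2 * t 1 + Zv * Wv * t 3 + (Zv ^ 2 * b 0 + Xv * b 2),
       Wv ^ 2 * t 2 + Yv * Wv * t 4 + (Yv ^ 2 * b 0 + Xv * b 1),
       Xv ^ 2 * t 3 + (Yv * b 2 + Wv * b 4 + Zv * b 5),
       Xv ^ 2 * t 4 + (Zv * b 1 + Wv * b 3 + Yv * b 5),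
       Wv * t 0 + Xv ^ 2 * t 5 + (Zv * b 3 + Yv * b 4)]) := by
  refine Prod.ext ?_ ?_ <;> funext i <;> fin_cases i <;>
    simp [mcD2, K2mat, K3mat, L1mat, dotProduct, Fin.sum_univ_succ, Matrix.vecHead, Matrix.vecTail] <;> ring

theorem aux_d1 (t : Fin 2 → MvPolynomial (Fin 4) k) (b : Fin 5 → MvPolynomial (Fin 4) k) :
    mcD1 k (t, b) = Wv ^ 2 * t 0 + (Xv ^ 3 + Yv * Zv * Wv) * t 1 +
      (Yv ^ 2 * b 0 + Zv ^ 2 * b 1 + Xv * Yv * b 2 + Xv * Zv * b 3 + Xv * Wv * b 4) := by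
  simp [mcD1, rowMap, K1vec, L0vec, Fin.sum_univ_succ]; ring

theorem aux_pair {R : Type*} {m n : ℕ} {a c : Fin m → R} {b d : Fin n → R}
    (h : (a, b) = (c, d)) : (∀ i, a i = c i) ∧ ∀ i, b i = d i :=
  ⟨fun i => congrFun (congrArg Prod.fst h) i, fun i => congrFun (congrArg Prod.snd h) i⟩

theorem aux_pair0 {R : Type*} [Zero R] {m n : ℕ} {a : Fin m → R} {b : Fin n → R}
    (h : (a, b) = 0) : (∀ i, a i = 0) ∧ ∀ i, b i = 0 :=
  ⟨fun i => congrFun (congrArg Prod.fst h) i, fun i => congrFun (congrArg Prod.snd h) i⟩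

set_option maxHeartbeats 4000000 in
/-- **Observation 8.1.**  Let `k` be a field of characteristic two and
`P = k[x,y,z,w]`.  The mapping-cone complex
`0 → P → P⁵⊕P² → P⁶⊕P⁶ → P²⊕P⁵ → P` built from `K₁, K₂, K₃, L₀, L₁` is exact
at the four left positions, and the image of its last differential is the
defining ideal `(xy, xz, xw, y², z², w², x³+yzw)` of the unique standard graded
Artinian Gorenstein algebra of embedding dimension four and socle degree three
without the weak Lefschetz property. -/
theorem mappingCone_resolution_char_two [CharP k 2] :
    Function.Injective (mcD4 k) ∧
      LinearMap.range (mcD4 k) = LinearMap.ker (mcD3 k) ∧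
      LinearMap.range (mcD3 k) = LinearMap.ker (mcD2 k) ∧
      LinearMap.range (mcD2 k) = LinearMap.ker (mcD1 k) ∧
      LinearMap.range (mcD1 k) =
        Ideal.span {Xv * Yv, Xv * Zv, Xv * Wv, Yv ^ 2, Zv ^ 2, Wv ^ 2,
          Xv ^ 3 + Yv * Zv * Wv} := by
  have h2 : (2 : MvPolynomial (Fin 4) k) = 0 := CharTwo.two_eq_zero
  have hx : Xv ≠ 0 := X_ne_zero _
  have hy : Yv ≠ 0 := X_ne_zero _
  refine ⟨?_, ?_, ?_, ?_, ?_⟩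
  · intro s t h
    rw [aux_d4, aux_d4] at h
    have h0 := (aux_pair h).1 0
    simp only [Matrix.cons_val] at h0
    exact mul_left_cancel₀ (pow_ne_zero 2 hy) h0
  · apply le_antisymm
    · rintro _ ⟨s, rfl⟩
      rw [LinearMap.mem_ker, aux_d4, aux_d3]
      refine Prod.ext ?_ ?_ <;> funext i <;> fin_cases i <;> simp <;> grind
    · rintro ⟨t, b⟩ h
      rw [LinearMap.mem_ker, aux_d3] at h
      obtain ⟨hk, hl⟩ := aux_pair0 h
      simp only [Fin.forall_fin_succ, Fin.forall_fin_zero, Matrix.cons_val, Fin.reduceSucc, Fin.succ_zero_eq_one] at hk hl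
      obtain ⟨c0, c1, c2, c3, c4, c5, -⟩ := hk
      obtain ⟨l0, l1, l2, l3, l4, l5, -⟩ := hl
      obtain ⟨s, e0, e1, e2, e3, e4⟩ := aux_K2T _ _ _ _ _ c0 c1 c2 c3
      refine ⟨s, ?_⟩
      have f0 : b 0 = Wv ^ 2 * s := by
        apply mul_left_cancel₀ hx
        rw [e4] at l0
        linear_combination l0 - Xv * Wv ^ 2 * s * h2
      have f1 : b 1 = (Xv ^ 3 + Yv * Zv * Wv) * s := by
        apply mul_left_cancel₀ hy
        rw [e0, e2] at l3
        linear_combination l3 - Yv * (Xv ^ 3 + Yv * Zv * Wv) * s * h2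
      rw [aux_d4]
      refine Prod.ext ?_ ?_ <;> funext i <;> fin_cases i <;> simp [*]
  · apply le_antisymm
    · rintro _ ⟨⟨t, b⟩, rfl⟩
      rw [LinearMap.mem_ker, aux_d3, aux_d2]
      refine Prod.ext ?_ ?_ <;> funext i <;> fin_cases i <;> simp <;> grind
    · rintro ⟨t, b⟩ h
      rw [LinearMap.mem_ker, aux_d2] at h
      obtain ⟨hk, hl⟩ := aux_pair0 h
      simp only [Fin.forall_fin_succ, Fin.forall_fin_zero, Matrix.cons_val, Fin.reduceSucc, Fin.succ_zero_eq_one] at hk hl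
      obtain ⟨c0, c1, -⟩ := hk
      obtain ⟨l0, l1, l2, l3, l4, -⟩ := hl
      obtain ⟨u0, u1, u2, u3, u4, e0, e1, e2, e3, e4, e5⟩ := aux_K3T _ _ _ _ _ _ c0 c1
      obtain ⟨a, c, f0, f1, f2, f3, f4, f5⟩ := aux_K2
        (b 0 + Wv * u4) (b 1 + Wv ^ 2 * u0) (b 2 + Wv ^ 2 * u1) (b 3 + (Zv * Wv * u0 + Xv ^ 2 * u2))
        (b 4 + (Yv * Wv * u1 + Xv ^ 2 * u3)) (b 5 + Xv ^ 2 * u4)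
        (by rw [e1, e3] at l0; linear_combination l0 - Zv * Wv ^ 2 * u3 * h2)
        (by rw [e2, e4] at l1; linear_combination l1 - Yv * Wv ^ 2 * u2 * h2)
        (by rw [e3] at l2; linear_combination l2 + Yv * Wv ^ 2 * u1 * h2)
        (by rw [e0, e5] at l4; linear_combination l4)
      clear c0 c1 l0 l1 l2 l3 l4 h
      refine ⟨(![u0, u1, u2, u3, u4], ![a, c]), ?_⟩
      rw [aux_d3]
      refine Prod.ext ?_ ?_ <;> funext i <;> fin_cases i <;> simp <;> first
        | linear_combination -e0
        | linear_combination -e1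
        | linear_combination -e2
        | linear_combination -e3
        | linear_combination -e4
        | linear_combination -e5
        | linear_combination (Wv * u4) * h2 - f0
        | linear_combination (Wv ^ 2 * u0) * h2 - f1
        | linear_combination (Wv ^ 2 * u1) * h2 - f2
        | linear_combination (Zv * Wv * u0 + Xv ^ 2 * u2) * h2 - f3
        | linear_combination (Yv * Wv * u1 + Xv ^ 2 * u3) * h2 - f4
        | linear_combination (Xv ^ 2 * u4) * h2 - f5
  · apply le_antisymm
    · rintro _ ⟨⟨t, b⟩, rfl⟩
      rw [LinearMap.mem_ker, aux_d2, aux_d1]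
      simp; grind
    · rintro ⟨t, b⟩ h
      rw [LinearMap.mem_ker, aux_d1] at h
      obtain ⟨s0, s1, s2, s3, s4, s5, e0, e1⟩ := aux_L0 _ _ _ _ _ _ _ h
      obtain ⟨u0, u1, u2, u3, u4, u5, f0, f1, f2, f3, f4⟩ := aux_K1
        (b 0 + (Wv ^ 2 * s1 + Zv * Wv * s3)) (b 1 + (Wv ^ 2 * s2 + Yv * Wv * s4))
        (b 2 + Xv ^ 2 * s3) (b 3 + Xv ^ 2 * s4) (b 4 + (Wv * s0 + Xv ^ 2 * s5))
        (by grind)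
      refine ⟨(![s0, s1, s2, s3, s4, s5], ![u0, u1, u2, u3, u4, u5]), ?_⟩
      rw [aux_d2]
      refine Prod.ext ?_ ?_ <;> funext i <;> fin_cases i <;> simp <;> first
        | linear_combination -e0
        | linear_combination -e1
        | linear_combination (Wv ^ 2 * s1 + Zv * Wv * s3) * h2 - f0
        | linear_combination (Wv ^ 2 * s2 + Yv * Wv * s4) * h2 - f1
        | linear_combination (Xv ^ 2 * s3) * h2 - f2
        | linear_combination (Xv ^ 2 * s4) * h2 - f3
        | linear_combination (Wv * s0 + Xv ^ 2 * s5) * h2 - f4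
  · ext p
    simp only [LinearMap.mem_range, Ideal.mem_span_insert, Ideal.mem_span_singleton]
    constructor
    · rintro ⟨⟨t, b⟩, rfl⟩
      rw [aux_d1]
      exact ⟨b 2, _, ⟨b 3, _, ⟨b 4, _, ⟨b 0, _, ⟨b 1, _, ⟨t 0, _, ⟨t 1, rfl⟩, rfl⟩, rfl⟩, rfl⟩,
        rfl⟩, rfl⟩, by ring⟩
    · rintro ⟨b2, _, ⟨b3, _, ⟨b4, _, ⟨b0, _, ⟨b1, _, ⟨t0, _, ⟨t1, rfl⟩, rfl⟩, rfl⟩, rfl⟩,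
        rfl⟩, rfl⟩, rfl⟩
      refine ⟨(![t0, t1], ![b0, b1, b2, b3, b4]), ?_⟩
      rw [aux_d1]
      simp; ring

end
end

section
/- With P = k[x,y,z,w], Φ a degree-3 Macaulay inverse system, ann Φ containing no nonzero linear form, p bijective, and the symmetric matrix SM equal to the diagonal matrix diag(α,0,0) for some nonzero α ∈ k, the following coefficient identities hold: c_w(ℓ_{y²}) = 0, c_w(ℓ_{yz}) = 0, c_z(ℓ_{yw}) = 0, c_z(ℓ_{y²}) = 0, and c_z(ℓ_{yz}) = c_w(ℓ_{yw}). -/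
open MvPolynomial

noncomputable section

variable (k : Type*) [Field k]

/-- The coefficient of the variable `Xᵢ` in a polynomial. -/
def varCoeff (i : Fin 4) (u : MvPolynomial (Fin 4) k) : k :=
  MvPolynomial.coeff (Finsupp.single i 1) u

lemma lin_expand_s12 (v : MvPolynomial (Fin 4) k) (hv : v ∈ homogeneousSubmodule (Fin 4) k 1) :
    v = ∑ i : Fin 4, varCoeff k i v • (X i : MvPolynomial (Fin 4) k) := by
  rw [mem_homogeneousSubmodule] at hv
  ext m
  by_cases hm : m.degree = 1
  · obtain ⟨i, rfl⟩ : ∃ i, m = Finsupp.single i 1 := by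
      obtain ⟨i, hi⟩ := Finsupp.range_single_one.symm.subset hm
      exact ⟨i, hi.symm⟩
    simp [coeff_sum, coeff_X, varCoeff, Finsupp.single_left_inj]
  · rw [hv.coeff_eq_zero hm, coeff_sum]
    symm
    apply Finset.sum_eq_zero
    intro i _
    rw [coeff_smul, coeff_X, if_neg, smul_zero]
    rintro rfl
    simp at hm

lemma functional_expand (Φ : MvPolynomial (Fin 4) k →ₗ[k] k) (p v : MvPolynomial (Fin 4) k)
    (hv : v ∈ homogeneousSubmodule (Fin 4) k 1) :
    Φ (p * v) = varCoeff k 0 v * Φ (p * X 0) + varCoeff k 1 v * Φ (p * X 1)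
      + varCoeff k 2 v * Φ (p * X 2) + varCoeff k 3 v * Φ (p * X 3) := by
  conv_lhs => rw [lin_expand_s12 k v hv]
  simp [Fin.sum_univ_four, mul_add]

lemma functional_ext (Φ : MvPolynomial (Fin 4) k →ₗ[k] k) (p q : MvPolynomial (Fin 4) k)
    (h0 : Φ (p * X 0) = Φ (q * X 0)) (h1 : Φ (p * X 1) = Φ (q * X 1))
    (h2 : Φ (p * X 2) = Φ (q * X 2)) (h3 : Φ (p * X 3) = Φ (q * X 3)) :
    ∀ v ∈ homogeneousSubmodule (Fin 4) k 1, Φ (p * v) = Φ (q * v) := by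
  intro v hv
  rw [functional_expand k Φ p v hv, functional_expand k Φ q v hv, h0, h1, h2, h3]

set_option maxHeartbeats 4000000 in
/-- **Lemma 11.1** (part (2.1.1)).  Assume `Φ` is a degree-3 Macaulay inverse
system on `P = k[x,y,z,w]` whose annihilator contains no nonzero linear form,
`p` is bijective, and `SM = diag(α,0,0)` with `α ≠ 0`.  Then
`c_w(ℓ_{y²}) = 0`, `c_w(ℓ_{yz}) = 0`, `c_z(ℓ_{yw}) = 0`, `c_z(ℓ_{y²}) = 0` and
`c_z(ℓ_{yz}) = c_w(ℓ_{yw})`. -/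
theorem coefficient_identities_of_smMatrix_rank_one
    (Φ : MvPolynomial (Fin 4) k →ₗ[k] k)
    (hΦ : ∀ m : Fin 4 →₀ ℕ, (m.sum fun _ e => e) ≠ 3 → Φ (monomial m 1) = 0)
    (hlin : ∀ u ∈ homogeneousSubmodule (Fin 4) k 1, u ∈ annIdeal k Φ → u = 0)
    (hp : Function.Bijective (pMap k Φ))
    (ly2 lyz lyw lz2 lzw lw2 : MvPolynomial (Fin 4) k)
    (hly2m : ly2 ∈ homogeneousSubmodule (Fin 4) k 1)
    (hlyzm : lyz ∈ homogeneousSubmodule (Fin 4) k 1)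
    (hlywm : lyw ∈ homogeneousSubmodule (Fin 4) k 1)
    (hlz2m : lz2 ∈ homogeneousSubmodule (Fin 4) k 1)
    (hlzwm : lzw ∈ homogeneousSubmodule (Fin 4) k 1)
    (hlw2m : lw2 ∈ homogeneousSubmodule (Fin 4) k 1)
    (hly2 : ∀ v ∈ homogeneousSubmodule (Fin 4) k 1,
      Φ (X 0 * ly2 * v) = Φ (X 1 ^ 2 * v))
    (hlyz : ∀ v ∈ homogeneousSubmodule (Fin 4) k 1,
      Φ (X 0 * lyz * v) = Φ (X 1 * X 2 * v))
    (hlyw : ∀ v ∈ homogeneousSubmodule (Fin 4) k 1,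
      Φ (X 0 * lyw * v) = Φ (X 1 * X 3 * v))
    (hlz2 : ∀ v ∈ homogeneousSubmodule (Fin 4) k 1,
      Φ (X 0 * lz2 * v) = Φ (X 2 ^ 2 * v))
    (hlzw : ∀ v ∈ homogeneousSubmodule (Fin 4) k 1,
      Φ (X 0 * lzw * v) = Φ (X 2 * X 3 * v))
    (hlw2 : ∀ v ∈ homogeneousSubmodule (Fin 4) k 1,
      Φ (X 0 * lw2 * v) = Φ (X 3 ^ 2 * v))
    (α : k) (hα : α ≠ 0)
    (hSM : smMatrix k Φ ly2 lyz lyw lz2 lzw lw2 = !![α, 0, 0; 0, 0, 0; 0, 0, 0]) :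
    varCoeff k 3 ly2 = 0 ∧ varCoeff k 3 lyz = 0 ∧ varCoeff k 2 lyw = 0 ∧
      varCoeff k 2 ly2 = 0 ∧ varCoeff k 2 lyz = varCoeff k 3 lyw := by
  have hX : ∀ i : Fin 4, (X i : MvPolynomial (Fin 4) k) ∈ homogeneousSubmodule (Fin 4) k 1 :=
    fun i => isHomogeneous_X k i
  have sy2yz : Φ (X 1 ^ 2 * lyz) = Φ (X 1 * X 2 * ly2) := by
    linear_combination (norm := ring_nf) hlyz ly2 hly2m - hly2 lyz hlyzm
  have sy2yw : Φ (X 1 ^ 2 * lyw) = Φ (X 1 * X 3 * ly2) := by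
    linear_combination (norm := ring_nf) hlyw ly2 hly2m - hly2 lyw hlywm
  have sy2z2 : Φ (X 1 ^ 2 * lz2) = Φ (X 2 ^ 2 * ly2) := by
    linear_combination (norm := ring_nf) hlz2 ly2 hly2m - hly2 lz2 hlz2m
  have sy2zw : Φ (X 1 ^ 2 * lzw) = Φ (X 2 * X 3 * ly2) := by
    linear_combination (norm := ring_nf) hlzw ly2 hly2m - hly2 lzw hlzwm
  have sy2w2 : Φ (X 1 ^ 2 * lw2) = Φ (X 3 ^ 2 * ly2) := by
    linear_combination (norm := ring_nf) hlw2 ly2 hly2m - hly2 lw2 hlw2m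
  have syzyw : Φ (X 1 * X 2 * lyw) = Φ (X 1 * X 3 * lyz) := by
    linear_combination (norm := ring_nf) hlyw lyz hlyzm - hlyz lyw hlywm
  have syzz2 : Φ (X 1 * X 2 * lz2) = Φ (X 2 ^ 2 * lyz) := by
    linear_combination (norm := ring_nf) hlz2 lyz hlyzm - hlyz lz2 hlz2m
  have syzzw : Φ (X 1 * X 2 * lzw) = Φ (X 2 * X 3 * lyz) := by
    linear_combination (norm := ring_nf) hlzw lyz hlyzm - hlyz lzw hlzwm
  have syzw2 : Φ (X 1 * X 2 * lw2) = Φ (X 3 ^ 2 * lyz) := by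
    linear_combination (norm := ring_nf) hlw2 lyz hlyzm - hlyz lw2 hlw2m
  have sywz2 : Φ (X 1 * X 3 * lz2) = Φ (X 2 ^ 2 * lyw) := by
    linear_combination (norm := ring_nf) hlz2 lyw hlywm - hlyw lz2 hlz2m
  have sywzw : Φ (X 1 * X 3 * lzw) = Φ (X 2 * X 3 * lyw) := by
    linear_combination (norm := ring_nf) hlzw lyw hlywm - hlyw lzw hlzwm
  have syww2 : Φ (X 1 * X 3 * lw2) = Φ (X 3 ^ 2 * lyw) := by
    linear_combination (norm := ring_nf) hlw2 lyw hlywm - hlyw lw2 hlw2m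
  have sz2zw : Φ (X 2 ^ 2 * lzw) = Φ (X 2 * X 3 * lz2) := by
    linear_combination (norm := ring_nf) hlzw lz2 hlz2m - hlz2 lzw hlzwm
  have sz2w2 : Φ (X 2 ^ 2 * lw2) = Φ (X 3 ^ 2 * lz2) := by
    linear_combination (norm := ring_nf) hlw2 lz2 hlz2m - hlz2 lw2 hlw2m
  have szww2 : Φ (X 2 * X 3 * lw2) = Φ (X 3 ^ 2 * lzw) := by
    linear_combination (norm := ring_nf) hlw2 lzw hlzwm - hlzw lw2 hlw2m
  have m00 := congrFun (congrFun hSM 0) 0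
  have m01 := congrFun (congrFun hSM 0) 1
  have m02 := congrFun (congrFun hSM 0) 2
  have m10 := congrFun (congrFun hSM 1) 0
  have m11 := congrFun (congrFun hSM 1) 1
  have m12 := congrFun (congrFun hSM 1) 2
  have m20 := congrFun (congrFun hSM 2) 0
  have m21 := congrFun (congrFun hSM 2) 1
  have m22 := congrFun (congrFun hSM 2) 2
  simp [smMatrix, -map_mul] at m00 m01 m02 m10 m11 m12 m20 m21 m22
  rw [mul_comm (X 2) (X 1)] at m01
  have c1 := functional_ext k Φ (X 3 * ly2) (X 1 * lyw)
    (by linear_combination (norm := ring_nf) hly2 (X 3) (hX 3) - hlyw (X 1) (hX 1))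
    (by rw [show X 3 * ly2 * X 1 = X 1 * X 3 * ly2 by ring,
        show X 1 * lyw * X 1 = X 1 ^ 2 * lyw by ring]; clear hly2 hlyz hlyw hlz2 hlzw hlw2 hΦ hlin hp; grind only)
    (by rw [show X 3 * ly2 * X 2 = X 2 * X 3 * ly2 by ring,
        show X 1 * lyw * X 2 = X 1 * X 2 * lyw by ring]; clear hly2 hlyz hlyw hlz2 hlzw hlw2 hΦ hlin hp; grind only)
    (by rw [show X 3 * ly2 * X 3 = X 3 ^ 2 * ly2 by ring,
        show X 1 * lyw * X 3 = X 1 * X 3 * lyw by ring]; clear hly2 hlyz hlyw hlz2 hlzw hlw2 hΦ hlin hp; grind only)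
  have c2 := functional_ext k Φ (X 2 * ly2) (X 1 * lyz)
    (by linear_combination (norm := ring_nf) hly2 (X 2) (hX 2) - hlyz (X 1) (hX 1))
    (by rw [show X 2 * ly2 * X 1 = X 1 * X 2 * ly2 by ring,
        show X 1 * lyz * X 1 = X 1 ^ 2 * lyz by ring]; clear hly2 hlyz hlyw hlz2 hlzw hlw2 hΦ hlin hp; grind only)
    (by rw [show X 2 * ly2 * X 2 = X 2 ^ 2 * ly2 by ring,
        show X 1 * lyz * X 2 = X 1 * X 2 * lyz by ring]; clear hly2 hlyz hlyw hlz2 hlzw hlw2 hΦ hlin hp; grind only)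
    (by rw [show X 2 * ly2 * X 3 = X 2 * X 3 * ly2 by ring,
        show X 1 * lyz * X 3 = X 1 * X 3 * lyz by ring]; clear hly2 hlyz hlyw hlz2 hlzw hlw2 hΦ hlin hp; grind only)
  have c3 := functional_ext k Φ (X 1 * lz2) (X 2 * lyz)
    (by linear_combination (norm := ring_nf) hlz2 (X 1) (hX 1) - hlyz (X 2) (hX 2))
    (by rw [show X 1 * lz2 * X 1 = X 1 ^ 2 * lz2 by ring,
        show X 2 * lyz * X 1 = X 1 * X 2 * lyz by ring]; clear hly2 hlyz hlyw hlz2 hlzw hlw2 hΦ hlin hp; grind only)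
    (by rw [show X 1 * lz2 * X 2 = X 1 * X 2 * lz2 by ring,
        show X 2 * lyz * X 2 = X 2 ^ 2 * lyz by ring]; clear hly2 hlyz hlyw hlz2 hlzw hlw2 hΦ hlin hp; grind only)
    (by rw [show X 1 * lz2 * X 3 = X 1 * X 3 * lz2 by ring,
        show X 2 * lyz * X 3 = X 2 * X 3 * lyz by ring]; clear hly2 hlyz hlyw hlz2 hlzw hlw2 hΦ hlin hp; grind only)
  have c4 := functional_ext k Φ (X 1 * lzw) (X 2 * lyw)
    (by linear_combination (norm := ring_nf) hlzw (X 1) (hX 1) - hlyw (X 2) (hX 2))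
    (by rw [show X 1 * lzw * X 1 = X 1 ^ 2 * lzw by ring,
        show X 2 * lyw * X 1 = X 1 * X 2 * lyw by ring]; clear hly2 hlyz hlyw hlz2 hlzw hlw2 hΦ hlin hp; grind only)
    (by rw [show X 1 * lzw * X 2 = X 1 * X 2 * lzw by ring,
        show X 2 * lyw * X 2 = X 2 ^ 2 * lyw by ring]; clear hly2 hlyz hlyw hlz2 hlzw hlw2 hΦ hlin hp; grind only)
    (by rw [show X 1 * lzw * X 3 = X 1 * X 3 * lzw by ring,
        show X 2 * lyw * X 3 = X 2 * X 3 * lyw by ring]; clear hly2 hlyz hlyw hlz2 hlzw hlw2 hΦ hlin hp; grind only)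
  have c4b := functional_ext k Φ (X 1 * lzw) (X 3 * lyz)
    (by linear_combination (norm := ring_nf) hlzw (X 1) (hX 1) - hlyz (X 3) (hX 3))
    (by rw [show X 1 * lzw * X 1 = X 1 ^ 2 * lzw by ring,
        show X 3 * lyz * X 1 = X 1 * X 3 * lyz by ring]; clear hly2 hlyz hlyw hlz2 hlzw hlw2 hΦ hlin hp; grind only)
    (by rw [show X 1 * lzw * X 2 = X 1 * X 2 * lzw by ring,
        show X 3 * lyz * X 2 = X 2 * X 3 * lyz by ring]; clear hly2 hlyz hlyw hlz2 hlzw hlw2 hΦ hlin hp; grind only)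
    (by rw [show X 1 * lzw * X 3 = X 1 * X 3 * lzw by ring,
        show X 3 * lyz * X 3 = X 3 ^ 2 * lyz by ring]; clear hly2 hlyz hlyw hlz2 hlzw hlw2 hΦ hlin hp; grind only)
  have c5 := functional_ext k Φ (X 1 * lw2) (X 3 * lyw)
    (by linear_combination (norm := ring_nf) hlw2 (X 1) (hX 1) - hlyw (X 3) (hX 3))
    (by rw [show X 1 * lw2 * X 1 = X 1 ^ 2 * lw2 by ring,
        show X 3 * lyw * X 1 = X 1 * X 3 * lyw by ring]; clear hly2 hlyz hlyw hlz2 hlzw hlw2 hΦ hlin hp; grind only)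
    (by rw [show X 1 * lw2 * X 2 = X 1 * X 2 * lw2 by ring,
        show X 3 * lyw * X 2 = X 2 * X 3 * lyw by ring]; clear hly2 hlyz hlyw hlz2 hlzw hlw2 hΦ hlin hp; grind only)
    (by rw [show X 1 * lw2 * X 3 = X 1 * X 3 * lw2 by ring,
        show X 3 * lyw * X 3 = X 3 ^ 2 * lyw by ring]; clear hly2 hlyz hlyw hlz2 hlzw hlw2 hΦ hlin hp; grind only)
  have eE : ∀ u ∈ homogeneousSubmodule (Fin 4) k 1,
      Φ (X 3 * lz2 * u) - Φ (X 2 * lzw * u) = α * varCoeff k 3 u := by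
    intro u hu
    have h0 : Φ (X 3 * lz2 * X 0) = Φ (X 2 * lzw * X 0) := by
      linear_combination (norm := ring_nf) hlz2 (X 3) (hX 3) - hlzw (X 2) (hX 2)
    have h1 : Φ (X 3 * lz2 * X 1) = Φ (X 2 * lzw * X 1) := by
      rw [show X 3 * lz2 * X 1 = X 1 * X 3 * lz2 by ring,
        show X 2 * lzw * X 1 = X 1 * X 2 * lzw by ring]; clear hly2 hlyz hlyw hlz2 hlzw hlw2 hΦ hlin hp; grind only
    have h2 : Φ (X 3 * lz2 * X 2) = Φ (X 2 * lzw * X 2) := by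
      rw [show X 3 * lz2 * X 2 = X 2 * X 3 * lz2 by ring,
        show X 2 * lzw * X 2 = X 2 ^ 2 * lzw by ring]; clear hly2 hlyz hlyw hlz2 hlzw hlw2 hΦ hlin hp; grind only
    have h3 : Φ (X 3 * lz2 * X 3) = Φ (X 2 * lzw * X 3) + α := by
      rw [show X 3 * lz2 * X 3 = X 3 ^ 2 * lz2 by ring,
        show X 2 * lzw * X 3 = X 2 * X 3 * lzw by ring]; clear hly2 hlyz hlyw hlz2 hlzw hlw2 hΦ hlin hp; grind only
    rw [functional_expand k Φ _ u hu, functional_expand k Φ (X 2 * lzw) u hu, h0, h1, h2, h3]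
    ring
  have eF : ∀ u ∈ homogeneousSubmodule (Fin 4) k 1,
      Φ (X 2 * lw2 * u) - Φ (X 3 * lzw * u) = α * varCoeff k 2 u := by
    intro u hu
    have h0 : Φ (X 2 * lw2 * X 0) = Φ (X 3 * lzw * X 0) := by
      linear_combination (norm := ring_nf) hlw2 (X 2) (hX 2) - hlzw (X 3) (hX 3)
    have h1 : Φ (X 2 * lw2 * X 1) = Φ (X 3 * lzw * X 1) := by
      rw [show X 2 * lw2 * X 1 = X 1 * X 2 * lw2 by ring,
        show X 3 * lzw * X 1 = X 1 * X 3 * lzw by ring]; clear hly2 hlyz hlyw hlz2 hlzw hlw2 hΦ hlin hp; grind only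
    have h2 : Φ (X 2 * lw2 * X 2) = Φ (X 3 * lzw * X 2) + α := by
      rw [show X 2 * lw2 * X 2 = X 2 ^ 2 * lw2 by ring,
        show X 3 * lzw * X 2 = X 2 * X 3 * lzw by ring]; clear hly2 hlyz hlyw hlz2 hlzw hlw2 hΦ hlin hp; grind only
    have h3 : Φ (X 2 * lw2 * X 3) = Φ (X 3 * lzw * X 3) := by
      rw [show X 2 * lw2 * X 3 = X 2 * X 3 * lw2 by ring,
        show X 3 * lzw * X 3 = X 3 ^ 2 * lzw by ring]; clear hly2 hlyz hlyw hlz2 hlzw hlw2 hΦ hlin hp; grind only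
    rw [functional_expand k Φ _ u hu, functional_expand k Φ (X 3 * lzw) u hu, h0, h1, h2, h3]
    ring
  refine ⟨?_, ?_, ?_, ?_, ?_⟩ <;> apply mul_left_cancel₀ hα
  · linear_combination (norm := ring_nf) -eE ly2 hly2m + c1 lz2 hlz2m - c2 lzw hlzwm
      + c3 lyw hlywm - c4 lyz hlyzm
  · linear_combination (norm := ring_nf) -eE lyz hlyzm - c4b lz2 hlz2m + c3 lzw hlzwm
  · linear_combination (norm := ring_nf) -eF lyw hlywm - c4 lw2 hlw2m + c5 lzw hlzwm
  · linear_combination (norm := ring_nf) -eF ly2 hly2m + c2 lw2 hlw2m - c1 lzw hlzwm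
      + c5 lyz hlyzm - c4b lyw hlywm
  · linear_combination (norm := ring_nf) -eF lyz hlyzm + eE lyw hlywm - c3 lw2 hlw2m
      + c4b lzw hlzwm + c5 lz2 hlz2m - c4 lzw hlzwm


end
end
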